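/- There is no polygonal proper coloring of the plane with 6 colors. That is, there do not exist a coloring c : EuclideanSpace ℝ (Fin 2) → Fin 6 and a family 𝒫 of subsets of the plane such that: (1) c is proper; (2) every P ∈ 𝒫 is nonempty, open, connected and bounded, and frontier P equals a union of finitely many nondegenerate closed line segments; (3) the members of 𝒫 are pairwise disjoint; (4) the union of the closures of the members of 𝒫 is the whole plane; (5) every bounded subset of the plane meets only finitely many members of 𝒫; (6) c is constant on every P ∈ 𝒫; (7) for every point x there exists P ∈ 𝒫 with x ∈ closure P such that c x equals the constant value of c on P; (8) whenever P ≠ Q in 𝒫 and frontier P ∩ frontier Q is an infinite set, the constant values of c on P and on Q are different. -/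

import Mathlib

open Set Metric

namespace Hx

/-- the part of the hypotheses that is used, transported to the complex plane -/
structure Col (c : ℂ → Fin 6) (F : Set (Set ℂ)) : Prop where
  proper : ∀ x y : ℂ, dist x y = 1 → c x ≠ c y
  ne : ∀ P ∈ F, P.Nonempty
  opn : ∀ P ∈ F, IsOpen P
  conn : ∀ P ∈ F, IsPreconnected P
  seg : ∀ P ∈ F, ∃ S : Finset (ℂ × ℂ), frontier P ⊆ ⋃ e ∈ S, segment ℝ e.1 e.2
  lf : ∀ B : Set ℂ, Bornology.IsBounded B → {P ∈ F | (P ∩ B).Nonempty}.Finite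
  const : ∀ P ∈ F, ∀ x ∈ P, ∀ y ∈ P, c x = c y
  adj : ∀ x : ℂ, ∃ P ∈ F, x ∈ closure P ∧ ∀ y ∈ P, c y = c x

/-- `P` is a tile of color `i` with `x` in its closure -/
def At (c : ℂ → Fin 6) (F : Set (Set ℂ)) (x : ℂ) (i : Fin 6) (P : Set ℂ) : Prop :=
  P ∈ F ∧ x ∈ closure P ∧ ∀ y ∈ P, c y = i

open Classical in
/-- colors of the tiles at `x` -/
noncomputable def CC (c : ℂ → Fin 6) (F : Set (Set ℂ)) (x : ℂ) : Finset (Fin 6) :=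
  Finset.univ.filter fun i => ∃ P, At c F x i P

/-- generic points: interior points of tiles -/
def Gn (F : Set (Set ℂ)) (x : ℂ) : Prop := ∃ P ∈ F, x ∈ P

def Near (P Q : Set ℂ) : Prop := ∀ p ∈ closure P, ∀ q ∈ closure Q, dist p q ≤ 1
def Far (P Q : Set ℂ) : Prop := ∀ p ∈ closure P, ∀ q ∈ closure Q, 1 ≤ dist p q

def Nr (c : ℂ → Fin 6) (F : Set (Set ℂ)) (i : Fin 6) (x y : ℂ) : Prop :=
  ∀ P Q, At c F x i P → At c F y i Q → Near P Q
def Fa (c : ℂ → Fin 6) (F : Set (Set ℂ)) (i : Fin 6) (x y : ℂ) : Prop :=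
  ∀ P Q, At c F x i P → At c F y i Q → Far P Q

variable {c : ℂ → Fin 6} {F : Set (Set ℂ)}

theorem mem_CC {x : ℂ} {i : Fin 6} : i ∈ CC c F x ↔ ∃ P, At c F x i P := by
  simp [CC]

theorem dich (h : Col c F) {P Q : Set ℂ} {i : Fin 6} (hP : P ∈ F) (hQ : Q ∈ F)
    (cP : ∀ y ∈ P, c y = i) (cQ : ∀ y ∈ Q, c y = i) : Near P Q ∨ Far P Q := by
  have hc : IsPreconnected (P ×ˢ Q) := (h.conn P hP).prod (h.conn Q hQ)
  have hne : ∀ p ∈ P ×ˢ Q, dist p.1 p.2 ≠ 1 := by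
    rintro ⟨p, q⟩ ⟨hp, hq⟩ hd
    exact h.proper p q hd ((cP p hp).trans (cQ q hq).symm)
  have hcl : ∀ (p : ℂ) (q : ℂ), p ∈ closure P → q ∈ closure Q → (p, q) ∈ closure (P ×ˢ Q) := by
    intro p q hp hq
    rw [closure_prod_eq]; exact ⟨hp, hq⟩
  have cont : Continuous fun p : ℂ × ℂ => dist p.1 p.2 := by fun_prop
  by_cases hh : ∀ p ∈ P ×ˢ Q, dist p.1 p.2 ≤ 1
  · left
    intro p hp q hq
    have : closure (P ×ˢ Q) ⊆ {p : ℂ × ℂ | dist p.1 p.2 ≤ 1} :=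
      closure_minimal hh (isClosed_le cont continuous_const)
    exact this (hcl p q hp hq)
  · right
    push Not at hh
    obtain ⟨a, ha, ha1⟩ := hh
    have key : ∀ p ∈ P ×ˢ Q, 1 ≤ dist p.1 p.2 := by
      intro b hb
      by_contra hlt
      push Not at hlt
      have := hc.intermediate_value hb ha (cont.continuousOn)
      obtain ⟨z, hz, hz1⟩ := this ⟨hlt.le, ha1.le⟩
      exact hne z hz hz1
    intro p hp q hq
    have : closure (P ×ˢ Q) ⊆ {p : ℂ × ℂ | 1 ≤ dist p.1 p.2} :=
      closure_minimal key (isClosed_le continuous_const cont)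
    exact this (hcl p q hp hq)

theorem Near.symm {P Q : Set ℂ} (h : Near P Q) : Near Q P := by
  intro q hq p hp; rw [dist_comm]; exact h p hp q hq
theorem Far.symm {P Q : Set ℂ} (h : Far P Q) : Far Q P := by
  intro q hq p hp; rw [dist_comm]; exact h p hp q hq

theorem Near.lt {P Q : Set ℂ} (h : Near P Q) (hP : IsOpen P) {p y : ℂ} (hp : p ∈ P)
    (hy : y ∈ closure Q) : dist p y < 1 := by
  have : P ⊆ interior (closedBall y 1) :=
    interior_maximal (fun p hp => h p (subset_closure hp) y hy) hP
  rw [interior_closedBall _ one_ne_zero] at this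
  exact this hp

theorem Far.gt {P Q : Set ℂ} (h : Far P Q) (hP : IsOpen P) {p y : ℂ} (hp : p ∈ P)
    (hy : y ∈ closure Q) : 1 < dist p y := by
  have h1 : P ⊆ (ball y 1)ᶜ := by
    intro q hq; simpa using h q (subset_closure hq) y hy
  have : P ⊆ interior (ball y 1)ᶜ := interior_maximal h1 hP
  rw [interior_compl, closure_ball _ one_ne_zero] at this
  simpa using this hp

theorem not_both (h : Col c F) {P P' Q : Set ℂ} {y : ℂ} (hQ : Q ∈ F) (h1 : Near P Q)
    (h2 : Far P' Q) (hy : y ∈ closure P) (hy' : y ∈ closure P') : False := by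
  obtain ⟨q, hq⟩ := h.ne Q hQ
  exact absurd (h1.symm.lt (h.opn Q hQ) hq hy) (not_lt.2 (h2.symm.gt (h.opn Q hQ) hq hy').le)

theorem near_congr (h : Col c F) {x y : ℂ} {i : Fin 6} {P P' Q Q' : Set ℂ} (hP : At c F x i P)
    (hP' : At c F x i P') (hQ : At c F y i Q) (hQ' : At c F y i Q') (hn : Near P Q) :
    Near P' Q' := by
  have h1 : Near P' Q := by
    rcases dich h hP'.1 hQ.1 hP'.2.2 hQ.2.2 with h1 | h1
    · exact h1
    · exact (not_both h hQ.1 hn h1 hP.2.1 hP'.2.1).elim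
  rcases dich h hP'.1 hQ'.1 hP'.2.2 hQ'.2.2 with h2 | h2
  · exact h2
  · exact (not_both h hP'.1 h1.symm h2.symm hQ.2.1 hQ'.2.1).elim

theorem nr_or_fa (h : Col c F) (i : Fin 6) (x y : ℂ) : Nr c F i x y ∨ Fa c F i x y := by
  by_cases hh : ∃ P Q, At c F x i P ∧ At c F y i Q ∧ Near P Q
  · left
    obtain ⟨P, Q, hP, hQ, hn⟩ := hh
    intro P' Q' hP' hQ'
    exact near_congr h hP hP' hQ hQ' hn
  · right
    intro P Q hP hQ
    rcases dich h hP.1 hQ.1 hP.2.2 hQ.2.2 with h2 | h2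
    · exact (hh ⟨P, Q, hP, hQ, h2⟩).elim
    · exact h2

theorem Nr.symm {i : Fin 6} {x y : ℂ} (h : Nr c F i x y) : Nr c F i y x :=
  fun P Q hP hQ => (h Q P hQ hP).symm
theorem Fa.symm {i : Fin 6} {x y : ℂ} (h : Fa c F i x y) : Fa c F i y x :=
  fun P Q hP hQ => (h Q P hQ hP).symm

theorem nr_fa_false (h : Col c F) {i : Fin 6} {x y : ℂ} (hn : Nr c F i x y) (hf : Fa c F i x y)
    (hx : i ∈ CC c F x) (hy : i ∈ CC c F y) : False := by
  obtain ⟨P, hP⟩ := mem_CC.1 hx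
  obtain ⟨Q, hQ⟩ := mem_CC.1 hy
  exact not_both h hQ.1 (hn P Q hP hQ) (hf P Q hP hQ) hP.2.1 hP.2.1

theorem Nr.le {i : Fin 6} {x y : ℂ} (hn : Nr c F i x y)
    (hx : i ∈ CC c F x) (hy : i ∈ CC c F y) : dist x y ≤ 1 := by
  obtain ⟨P, hP⟩ := mem_CC.1 hx
  obtain ⟨Q, hQ⟩ := mem_CC.1 hy
  exact hn P Q hP hQ x hP.2.1 y hQ.2.1

theorem Fa.ge {i : Fin 6} {x y : ℂ} (hn : Fa c F i x y)
    (hx : i ∈ CC c F x) (hy : i ∈ CC c F y) : 1 ≤ dist x y := by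
  obtain ⟨P, hP⟩ := mem_CC.1 hx
  obtain ⟨Q, hQ⟩ := mem_CC.1 hy
  exact hn P Q hP hQ x hP.2.1 y hQ.2.1

/-- `p` in a tile closure at `x`, `q` in a tile closure at `y`, at distance `< 1` -/
theorem nr_of_lt (h : Col c F) {i : Fin 6} {x y p q : ℂ} {P Q : Set ℂ} (hP : At c F x i P)
    (hQ : At c F y i Q) (hp : p ∈ closure P) (hq : q ∈ closure Q) (hd : dist p q < 1) :
    Nr c F i x y := by
  rcases nr_or_fa h i x y with h1 | h1
  · exact h1
  · exact absurd (h1 P Q hP hQ p hp q hq) (not_le.2 hd)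

theorem fa_of_gt (h : Col c F) {i : Fin 6} {x y p q : ℂ} {P Q : Set ℂ} (hP : At c F x i P)
    (hQ : At c F y i Q) (hp : p ∈ closure P) (hq : q ∈ closure Q) (hd : 1 < dist p q) :
    Fa c F i x y := by
  rcases nr_or_fa h i x y with h1 | h1
  · exact absurd (h1 P Q hP hQ p hp q hq) (not_le.2 hd)
  · exact h1

theorem At.self {x : ℂ} {i : Fin 6} {P : Set ℂ} (hP : At c F x i P) {p : ℂ} (hp : p ∈ closure P) :
    At c F p i P := ⟨hP.1, hp, hP.2.2⟩

theorem At.mem {x : ℂ} {i : Fin 6} {P : Set ℂ} (hP : At c F x i P) : i ∈ CC c F x :=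
  mem_CC.2 ⟨P, hP⟩

theorem exists_at (h : Col c F) (x : ℂ) : ∃ P, At c F x (c x) P := by
  obtain ⟨P, hP, hx, hc⟩ := h.adj x
  exact ⟨P, hP, hx, hc⟩

theorem c_mem (h : Col c F) (x : ℂ) : c x ∈ CC c F x := mem_CC.2 (exists_at h x)

theorem gn_at (h : Col c F) {s : ℂ} (hs : Gn F s) : ∃ P, At c F s (c s) P ∧ s ∈ P := by
  obtain ⟨P, hP, hsP⟩ := hs
  exact ⟨P, ⟨hP, subset_closure hsP, fun y hy => h.const P hP y hy s hsP⟩, hsP⟩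

theorem gn_CC (h : Col c F) {s : ℂ} (hs : Gn F s) {i : Fin 6} (hi : i ∈ CC c F s) : i = c s := by
  obtain ⟨P, hP, hsP⟩ := hs
  obtain ⟨Q, hQ⟩ := mem_CC.1 hi
  obtain ⟨q, hqP, hqQ⟩ := mem_closure_iff.1 hQ.2.1 P (h.opn P hP) hsP
  rw [← hQ.2.2 q hqQ]; exact h.const P hP q hqP s hsP

/-- A7 -/
theorem gn_not_mem (h : Col c F) {s x : ℂ} (hs : Gn F s) (hd : dist s x = 1) :
    c s ∉ CC c F x := by
  intro hx
  obtain ⟨Q, hQ⟩ := mem_CC.1 hx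
  obtain ⟨P, hP, hsP⟩ := gn_at h hs
  rcases dich h hP.1 hQ.1 hP.2.2 hQ.2.2 with h1 | h1
  · have := h1.lt (h.opn P hP.1) hsP hQ.2.1; linarith
  · have := h1.gt (h.opn P hP.1) hsP hQ.2.1; linarith

/-- A4 -/
theorem loc (h : Col c F) (z : ℂ) :
    ∃ ε > 0, ∀ p, dist p z < ε → ∀ i P, At c F p i P → At c F z i P := by
  have hf := h.lf (ball z 1) isBounded_ball
  set A := {P ∈ F | (P ∩ ball z 1).Nonempty ∧ z ∉ closure P} with hA
  have hAf : A.Finite := hf.subset (fun P hP => ⟨hP.1, hP.2.1⟩)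
  have hcl : IsClosed (⋃ P ∈ A, closure P) := hAf.isClosed_biUnion fun P _ => isClosed_closure
  have hz : z ∈ (⋃ P ∈ A, closure P)ᶜ := by
    simp only [mem_compl_iff, mem_iUnion, not_exists]
    intro P hP hz
    exact hP.2.2 hz
  obtain ⟨ε, hε, hb⟩ := Metric.isOpen_iff.1 hcl.isOpen_compl z hz
  refine ⟨min ε 1, by positivity, fun p hp i P hP => ⟨hP.1, ?_, hP.2.2⟩⟩
  by_contra hzP
  have hpb : p ∈ ball z 1 := lt_of_lt_of_le hp (min_le_right _ _)
  have : p ∈ ball z ε := lt_of_lt_of_le hp (min_le_left _ _)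
  apply hb this
  simp only [mem_iUnion]
  refine ⟨P, ⟨hP.1, ?_, hzP⟩, hP.2.1⟩
  obtain ⟨q, hq1, hq2⟩ := mem_closure_iff.1 hP.2.1 _ isOpen_ball hpb
  exact ⟨q, hq2, hq1⟩

theorem seg_sphere (a b x : ℂ) : (segment ℝ a b ∩ sphere x 1).Finite := by
  by_cases hab : a = b
  · subst hab; rw [segment_same]; exact (finite_singleton a).subset inter_subset_left
  set A := Complex.normSq (b - a) with hA
  have hA0 : A ≠ 0 := by
    rw [hA]; intro h0; exact hab (sub_eq_zero.1 (Complex.normSq_eq_zero.1 h0)).symm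
  set B := 2 * ((a - x).re * (b - a).re + (a - x).im * (b - a).im) with hB
  set C := Complex.normSq (a - x) - 1 with hC
  have hs : {t : ℝ | A * t ^ 2 + B * t + C = 0}.Finite := by
    rcases eq_empty_or_nonempty {t : ℝ | A * t ^ 2 + B * t + C = 0} with h0 | ⟨t0, ht0⟩
    · rw [h0]; exact finite_empty
    · refine (Set.toFinite {t0, -B / A - t0}).subset ?_
      intro t ht
      simp only [mem_setOf_eq] at ht ht0
      have : (t - t0) * (A * (t + t0) + B) = 0 := by linear_combination ht - ht0
      rcases mul_eq_zero.1 this with h1 | h1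
      · left; linarith
      · right; simp only [mem_singleton_iff]; field_simp; linarith
  refine (hs.image fun t : ℝ => a + t * (b - a)).subset ?_
  rintro p ⟨hp1, hp2⟩
  rw [segment_eq_image'] at hp1
  obtain ⟨t, -, rfl⟩ := hp1
  refine ⟨t, ?_, by simp⟩
  rw [mem_sphere, Complex.dist_eq] at hp2
  have : Complex.normSq (a + t • (b - a) - x) = 1 := by
    rw [Complex.normSq_eq_norm_sq, hp2]; norm_num
  rw [Complex.normSq_apply] at this
  simp only [mem_setOf_eq, hA, hB, hC, Complex.normSq_apply]
  simp at this ⊢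
  linarith

theorem not_gn (h : Col c F) {s : ℂ} (hs : ¬ Gn F s) : ∃ P ∈ F, s ∈ frontier P := by
  obtain ⟨P, hP, hx, -⟩ := h.adj s
  refine ⟨P, hP, ?_⟩
  rw [(h.opn P hP).frontier_eq]
  exact ⟨hx, fun h1 => hs ⟨P, hP, h1⟩⟩

theorem fin_circle (h : Col c F) (x : ℂ) : {s | dist s x = 1 ∧ ¬ Gn F s}.Finite := by
  have hf := h.lf (ball x 2) isBounded_ball
  have : {s | dist s x = 1 ∧ ¬ Gn F s} ⊆
      ⋃ P ∈ {P ∈ F | (P ∩ ball x 2).Nonempty}, frontier P ∩ sphere x 1 := by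
    rintro s ⟨hs, hg⟩
    obtain ⟨P, hP, hsP⟩ := not_gn h hg
    simp only [mem_iUnion]
    refine ⟨P, ⟨hP, ?_⟩, hsP, hs⟩
    have : s ∈ ball x 2 := by rw [mem_ball, hs]; norm_num
    obtain ⟨q, hq1, hq2⟩ := mem_closure_iff.1 (frontier_subset_closure hsP) _ isOpen_ball this
    exact ⟨q, hq2, hq1⟩
  refine (hf.biUnion ?_).subset this
  intro P hP
  obtain ⟨S, hS⟩ := h.seg P hP.1
  have : frontier P ∩ sphere x 1 ⊆ ⋃ e ∈ (S : Set (ℂ × ℂ)), segment ℝ e.1 e.2 ∩ sphere x 1 := by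
    rintro s ⟨h1, h2⟩
    have := hS h1
    simp only [mem_iUnion] at this ⊢
    obtain ⟨e, he, hse⟩ := this
    exact ⟨e, he, hse, h2⟩
  exact (S.finite_toSet.biUnion fun e _ => seg_sphere e.1 e.2 x).subset this

theorem not_gn_of_two (h : Col c F) {s : ℂ} {i j : Fin 6} (hij : i ≠ j) (hi : i ∈ CC c F s)
    (hj : j ∈ CC c F s) : ¬ Gn F s := fun hg => hij ((gn_CC h hg hi).trans (gn_CC h hg hj).symm)

/-- M1 -/
theorem same_side (h : Col c F) {y p p' q : ℂ} {P P' : Set ℂ} {i : Fin 6}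
    (hP : At c F y i P) (hP' : At c F y i P') (hp : p ∈ closure P) (hp' : p' ∈ closure P')
    (hcp : c p' = i) (hq : c q = i) (hd : dist p q < 1) : dist p' q < 1 := by
  obtain ⟨Q, hQ⟩ := exists_at h q
  rw [hq] at hQ
  have hn := nr_of_lt h hP hQ hp hQ.2.1 hd
  have := hn P' Q hP' hQ p' hp' q hQ.2.1
  rcases this.lt_or_eq with h1 | h1
  · exact h1
  · exact (h.proper p' q h1 (hcp.trans hq.symm)).elim

end Hx


open Set Metric Filter Topology

namespace Hx

variable {c : ℂ → Fin 6} {F : Set (Set ℂ)}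

/-- primitive sixth root of unity -/
noncomputable def om : ℂ := ⟨1 / 2, √3 / 2⟩

theorem om_sq : om ^ 2 = om - 1 := by
  have h3 : (√3 : ℝ) ^ 2 = 3 := Real.sq_sqrt (by norm_num)
  apply Complex.ext <;> simp [om, sq] <;> nlinarith

theorem om_cube : om ^ 3 = -1 := by
  linear_combination (om + 1) * om_sq

theorem om_six : om ^ 6 = 1 := by
  have : om ^ 6 = (om ^ 3) ^ 2 := by ring
  rw [this, om_cube]; norm_num

theorem om_norm : ‖om‖ = 1 := by
  have h3 : (√3 : ℝ) ^ 2 = 3 := Real.sq_sqrt (by norm_num)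
  have h1 : ‖om‖ ^ 2 = 1 := by
    rw [← Complex.normSq_eq_norm_sq, Complex.normSq_apply]; simp [om]; nlinarith
  nlinarith [norm_nonneg om]

theorem om_ne : om ≠ 0 := by
  intro h; have := om_norm; rw [h] at this; simp at this

theorem om_sub_norm : ‖om - 1‖ = 1 := by
  rw [← om_sq, norm_pow, om_norm]; norm_num

theorem expI_norm (θ : ℝ) : ‖Complex.exp (θ * Complex.I)‖ = 1 := Complex.norm_exp_ofReal_mul_I θ

theorem bad_countable {Z : Set ℂ} (hZ : Z.Finite) (x a : ℂ) (ha : a ≠ 0) :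
    {θ : ℝ | x + a * Complex.exp (θ * Complex.I) ∈ Z}.Countable := by
  have : {θ : ℝ | x + a * Complex.exp (θ * Complex.I) ∈ Z} =
      ⋃ z ∈ Z, {θ : ℝ | x + a * Complex.exp (θ * Complex.I) = z} := by
    ext θ; simp
  rw [this]
  refine hZ.countable.biUnion fun z _ => ?_
  rcases eq_empty_or_nonempty {θ : ℝ | x + a * Complex.exp (θ * Complex.I) = z} with h0 | ⟨t, ht⟩
  · rw [h0]; exact countable_empty
  · refine (countable_range fun n : ℤ => t + n * (2 * Real.pi)).mono ?_
    intro θ hθ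
    have h1 : Complex.exp (θ * Complex.I) = Complex.exp (t * Complex.I) := by
      have : a * Complex.exp (θ * Complex.I) = a * Complex.exp (t * Complex.I) := by
        have e1 : x + a * Complex.exp (θ * Complex.I) = z := hθ
        have e2 : x + a * Complex.exp (t * Complex.I) = z := ht
        linear_combination e1 - e2
      exact mul_left_cancel₀ ha this
    obtain ⟨n, hn⟩ := Complex.exp_eq_exp_iff_exists_int.1 h1
    refine ⟨n, ?_⟩
    have h2 : (θ : ℂ) = t + n * (2 * Real.pi) := by
      apply mul_right_cancel₀ Complex.I_ne_zero
      linear_combination hn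
    have h3 : ((t + n * (2 * Real.pi) : ℝ) : ℂ) = (θ : ℂ) := by
      rw [h2]; push_cast; ring
    exact_mod_cast h3

theorem bad_gn (h : Col c F) (x a : ℂ) (ha : ‖a‖ = 1) :
    {θ : ℝ | ¬ Gn F (x + a * Complex.exp (θ * Complex.I))}.Countable := by
  refine (bad_countable (fin_circle h x) x a (by rintro rfl; simp at ha)).mono ?_
  intro θ hθ
  refine ⟨?_, hθ⟩
  rw [Complex.dist_eq]; simp [ha, expI_norm]

theorem arc_pos (h : Col c F) {z u : ℂ} (hz : dist z u = 1) {ε : ℝ} (hε : 0 < ε) {p : ℂ → Prop}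
    (hp : ∀ᶠ θ : ℝ in 𝓝[>] 0, p (u + (z - u) * Complex.exp (θ * Complex.I))) :
    ∃ s, Gn F s ∧ dist s u = 1 ∧ dist s z < ε ∧ p s := by
  have hn : ‖z - u‖ = 1 := by rw [← Complex.dist_eq, hz]
  have hc : ∀ᶠ θ : ℝ in 𝓝[>] 0, dist (u + (z - u) * Complex.exp (θ * Complex.I)) z < ε := by
    have : Tendsto (fun θ : ℝ => u + (z - u) * Complex.exp (θ * Complex.I)) (𝓝 0) (𝓝 z) := by
      have h1 : Continuous (fun θ : ℝ => u + (z - u) * Complex.exp (θ * Complex.I)) := by fun_prop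
      simpa using h1.tendsto 0
    exact (this.mono_left nhdsWithin_le_nhds).eventually (Metric.ball_mem_nhds z hε)
  obtain ⟨b, hb, hb2⟩ := mem_nhdsGT_iff_exists_Ioo_subset.1 (hp.and hc)
  obtain ⟨θ, hθ1, hθ2⟩ := ((bad_gn h u (z - u) hn).dense_compl ℝ).exists_between
    (show (0:ℝ) < b from hb)
  obtain ⟨h1, h2⟩ := hb2 hθ2
  refine ⟨_, not_not.1 hθ1, ?_, h2, h1⟩
  rw [Complex.dist_eq]; simp [hn, expI_norm]

theorem arc_neg (h : Col c F) {z u : ℂ} (hz : dist z u = 1) {ε : ℝ} (hε : 0 < ε) {p : ℂ → Prop}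
    (hp : ∀ᶠ θ : ℝ in 𝓝[<] 0, p (u + (z - u) * Complex.exp (θ * Complex.I))) :
    ∃ s, Gn F s ∧ dist s u = 1 ∧ dist s z < ε ∧ p s := by
  have hn : ‖z - u‖ = 1 := by rw [← Complex.dist_eq, hz]
  have hc : ∀ᶠ θ : ℝ in 𝓝[<] 0, dist (u + (z - u) * Complex.exp (θ * Complex.I)) z < ε := by
    have : Tendsto (fun θ : ℝ => u + (z - u) * Complex.exp (θ * Complex.I)) (𝓝 0) (𝓝 z) := by
      have h1 : Continuous (fun θ : ℝ => u + (z - u) * Complex.exp (θ * Complex.I)) := by fun_prop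
      simpa using h1.tendsto 0
    exact (this.mono_left nhdsWithin_le_nhds).eventually (Metric.ball_mem_nhds z hε)
  obtain ⟨b, hb, hb2⟩ := mem_nhdsLT_iff_exists_Ioo_subset.1 (hp.and hc)
  obtain ⟨θ, hθ1, hθ2⟩ := ((bad_gn h u (z - u) hn).dense_compl ℝ).exists_between
    (show b < (0:ℝ) from hb)
  obtain ⟨h1, h2⟩ := hb2 hθ2
  refine ⟨_, not_not.1 hθ1, ?_, h2, h1⟩
  rw [Complex.dist_eq]; simp [hn, expI_norm]

/-- orientation number of the pair of circles at `z` -/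
noncomputable def orn (z u u' : ℂ) : ℝ := ((z - u) * (starRingEnd ℂ) (u - u')).im

theorem arc_dist {z u u' : ℂ} (hz' : dist z u' = 1) (θ : ℝ) :
    dist (u + (z - u) * Complex.exp (θ * Complex.I)) u' ^ 2 = 1 - 4 * Real.sin (θ / 2) *
      (Real.sin (θ / 2) * ((z - u) * (starRingEnd ℂ) (u - u')).re +
        Real.cos (θ / 2) * orn z u u') := by
  have e1 : ∀ w : ℂ, dist w u' ^ 2 = (w.re - u'.re) ^ 2 + (w.im - u'.im) ^ 2 := by
    intro w
    rw [Complex.dist_eq, ← Complex.normSq_eq_norm_sq, Complex.normSq_apply]; simp; ring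
  have h2 := e1 z
  rw [hz'] at h2
  rw [e1, Complex.exp_mul_I, ← Complex.ofReal_cos, ← Complex.ofReal_sin]
  have hc : Real.cos θ = 1 - 2 * Real.sin (θ / 2) ^ 2 := by
    have := Real.cos_sq' (θ / 2)
    have h3 := Real.cos_two_mul (θ / 2)
    rw [show 2 * (θ / 2) = θ by ring] at h3
    linarith
  have hs : Real.sin θ = 2 * Real.sin (θ / 2) * Real.cos (θ / 2) := by
    have h3 := Real.sin_two_mul (θ / 2)
    rwa [show 2 * (θ / 2) = θ by ring] at h3
  have hcs := Real.sin_sq_add_cos_sq (θ / 2)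
  set S := Real.sin (θ / 2)
  set C := Real.cos (θ / 2)
  simp only [orn, Complex.add_re, Complex.add_im, Complex.mul_re, Complex.mul_im, Complex.sub_re,
    Complex.sub_im, Complex.ofReal_re, Complex.ofReal_im, Complex.I_re, Complex.I_im,
    Complex.conj_re, Complex.conj_im, hc, hs]
  have hC : C ^ 2 = 1 - S ^ 2 := by linarith
  linear_combination -h2 + 4 * S ^ 2 * ((z.re - u.re) ^ 2 + (z.im - u.im) ^ 2) * hC

theorem arc_sign {z u u' : ℂ} (hz' : dist z u' = 1) {L : Filter ℝ} (hL : L ≤ 𝓝 0) {a b : ℝ}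
    (hs : ∀ᶠ θ in L, 0 < a * Real.sin (θ / 2)) (hb : 0 < b * orn z u u') :
    ∀ᶠ θ : ℝ in L, 0 < a * b * (1 - dist (u + (z - u) * Complex.exp (θ * Complex.I)) u' ^ 2) := by
  have hc : Continuous fun θ : ℝ => b * (Real.sin (θ / 2) *
      ((z - u) * (starRingEnd ℂ) (u - u')).re + Real.cos (θ / 2) * orn z u u') := by fun_prop
  have ht := hc.tendsto 0
  have hp : 0 < b * (Real.sin (0 / 2) *
      ((z - u) * (starRingEnd ℂ) (u - u')).re + Real.cos (0 / 2) * orn z u u') := by simpa using hb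
  filter_upwards [hs, (ht.mono_left hL).eventually (lt_mem_nhds hp)] with θ h1 h2
  rw [arc_dist hz']
  have := mul_pos h1 h2
  nlinarith

theorem sin_pos_ev : ∀ᶠ θ : ℝ in 𝓝[>] 0, 0 < (1:ℝ) * Real.sin (θ / 2) := by
  filter_upwards [Ioo_mem_nhdsGT (show (0:ℝ) < 1 by norm_num)] with θ hθ
  rw [one_mul]
  exact Real.sin_pos_of_pos_of_lt_pi (by linarith [hθ.1]) (by linarith [hθ.2, Real.pi_gt_three])

theorem sin_neg_ev : ∀ᶠ θ : ℝ in 𝓝[<] 0, 0 < (-1:ℝ) * Real.sin (θ / 2) := by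
  filter_upwards [Ioo_mem_nhdsLT (show (-1:ℝ) < 0 by norm_num)] with θ hθ
  have := Real.sin_neg_of_neg_of_neg_pi_lt (x := θ / 2) (by linarith [hθ.2])
    (by linarith [hθ.1, Real.pi_gt_three])
  linarith

theorem lt_one_of_sq {d : ℝ} (hd : 0 < 1 - d ^ 2) : d < 1 := by nlinarith [sq_nonneg (d - 1)]
theorem gt_one_of_sq {d : ℝ} (h0 : 0 ≤ d) (hd : 0 < -(1 - d ^ 2)) : 1 < d := by nlinarith

/-- `orn < 0`: positive angles lead outside, negative angles inside -/
theorem neg_out {z u u' : ℂ} (hz' : dist z u' = 1) (ho : orn z u u' < 0) :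
    ∀ᶠ θ : ℝ in 𝓝[>] 0, 1 < dist (u + (z - u) * Complex.exp (θ * Complex.I)) u' := by
  filter_upwards [arc_sign (b := -1) hz' nhdsWithin_le_nhds sin_pos_ev (by linarith)] with θ hθ
  exact gt_one_of_sq dist_nonneg (by linarith)

theorem neg_in {z u u' : ℂ} (hz' : dist z u' = 1) (ho : orn z u u' < 0) :
    ∀ᶠ θ : ℝ in 𝓝[<] 0, dist (u + (z - u) * Complex.exp (θ * Complex.I)) u' < 1 := by
  filter_upwards [arc_sign (b := -1) hz' nhdsWithin_le_nhds sin_neg_ev (by linarith)] with θ hθ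
  exact lt_one_of_sq (by linarith)

theorem pos_in {z u u' : ℂ} (hz' : dist z u' = 1) (ho : 0 < orn z u u') :
    ∀ᶠ θ : ℝ in 𝓝[>] 0, dist (u + (z - u) * Complex.exp (θ * Complex.I)) u' < 1 := by
  filter_upwards [arc_sign (b := 1) hz' nhdsWithin_le_nhds sin_pos_ev (by linarith)] with θ hθ
  exact lt_one_of_sq (by linarith)

theorem pos_out {z u u' : ℂ} (hz' : dist z u' = 1) (ho : 0 < orn z u u') :
    ∀ᶠ θ : ℝ in 𝓝[<] 0, 1 < dist (u + (z - u) * Complex.exp (θ * Complex.I)) u' := by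
  filter_upwards [arc_sign (b := 1) hz' nhdsWithin_le_nhds sin_neg_ev (by linarith)] with θ hθ
  exact gt_one_of_sq dist_nonneg (by linarith)

theorem arc_in (h : Col c F) {z u u' : ℂ} (hz : dist z u = 1) (hz' : dist z u' = 1)
    (ho : orn z u u' ≠ 0) {ε : ℝ} (hε : 0 < ε) :
    ∃ s, Gn F s ∧ dist s u = 1 ∧ dist s z < ε ∧ dist s u' < 1 := by
  rcases lt_or_gt_of_ne ho with h1 | h1
  · exact arc_neg h hz hε (neg_in hz' h1)
  · exact arc_pos h hz hε (pos_in hz' h1)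

theorem arc_out (h : Col c F) {z u u' : ℂ} (hz : dist z u = 1) (hz' : dist z u' = 1)
    (ho : orn z u u' ≠ 0) {ε : ℝ} (hε : 0 < ε) :
    ∃ s, Gn F s ∧ dist s u = 1 ∧ dist s z < ε ∧ 1 < dist s u' := by
  rcases lt_or_gt_of_ne ho with h1 | h1
  · exact arc_pos h hz hε (neg_out hz' h1)
  · exact arc_neg h hz hε (pos_out hz' h1)

theorem gn_dense (h : Col c F) (z : ℂ) {ε : ℝ} (hε : 0 < ε) : ∃ s, Gn F s ∧ dist s z < ε := by
  obtain ⟨s, h1, -, h2, -⟩ := arc_pos h (z := z) (u := z - 1) (by simp [Complex.dist_eq]) hε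
    (p := fun _ => True) (by simp)
  exact ⟨s, h1, h2⟩

/-- a generic point near `z` -/
theorem gn_near (h : Col c F) {z s : ℂ} {ε : ℝ}
    (hl : ∀ p, dist p z < ε → ∀ i P, At c F p i P → At c F z i P) (hs : Gn F s)
    (hd : dist s z < ε) : ∃ P, At c F z (c s) P ∧ s ∈ P := by
  obtain ⟨P, hP, hsP⟩ := gn_at h hs
  exact ⟨P, hl s hd _ P hP, hsP⟩

/-- two colors on the two sides of the circle around `w` -/
theorem two_sides (h : Col c F) {z u w : ℂ} (hz : dist z u = 1) (hz' : dist z w = 1)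
    (ho : orn z u w ≠ 0) :
    ∃ a b, a ∈ CC c F z ∧ b ∈ CC c F z ∧ a ∉ CC c F u ∧ b ∉ CC c F u ∧
      Nr c F a z w ∧ Fa c F b z w := by
  obtain ⟨ε, hε, hl⟩ := loc h z
  obtain ⟨s, s1, s2, s3, s4⟩ := arc_in h hz hz' ho hε
  obtain ⟨t, t1, t2, t3, t4⟩ := arc_out h hz hz' ho hε
  obtain ⟨P, hP, hsP⟩ := gn_near h hl s1 s3
  obtain ⟨Q, hQ, htQ⟩ := gn_near h hl t1 t3
  refine ⟨c s, c t, hP.mem, hQ.mem, gn_not_mem h s1 s2, gn_not_mem h t1 t2, ?_, ?_⟩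
  · rcases nr_or_fa h (c s) z w with h1 | h1
    · exact h1
    · intro P' Q' hP' hQ'
      exact absurd (h1 P Q' hP hQ' s (subset_closure hsP) w hQ'.2.1) (not_le.2 s4)
  · rcases nr_or_fa h (c t) z w with h1 | h1
    · intro P' Q' hP' hQ'
      exact absurd (h1 Q Q' hQ hQ' t (subset_closure htQ) w hQ'.2.1) (not_le.2 t4)
    · exact h1

theorem orn_hex {x v : ℂ} (hv : ‖v‖ = 1) : orn (x + v) (x + v * om) x = - (√3 / 2) := by
  have h3 : (√3 : ℝ) ^ 2 = 3 := Real.sq_sqrt (by norm_num)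
  have hn : v.re ^ 2 + v.im ^ 2 = 1 := by
    have := Complex.normSq_eq_norm_sq v
    rw [hv, Complex.normSq_apply] at this; linarith
  simp [orn, om]
  linear_combination (-(√3 / 2)) * hn

theorem orn_hex' {x v : ℂ} (hv : ‖v‖ = 1) :
    orn (x + v) (x + v * om) (x + v * om ^ 5) = - (√3 / 2) := by
  have h3 : (√3 : ℝ) ^ 2 = 3 := Real.sq_sqrt (by norm_num)
  have hn : v.re ^ 2 + v.im ^ 2 = 1 := by
    have := Complex.normSq_eq_norm_sq v
    rw [hv, Complex.normSq_apply] at this; linarith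
  have h5 : om ^ 5 = ⟨1 / 2, - (√3 / 2)⟩ := by
    have : om ^ 5 = om ^ 3 * om ^ 2 := by ring
    rw [this, om_cube, om_sq]; apply Complex.ext <;> simp [om] ; norm_num
  rw [h5]
  simp [orn, om]
  linear_combination (-(√3 / 2)) * hn

theorem sqrt3_pos : (0:ℝ) < √3 / 2 := by positivity

theorem dist_hex {x v : ℂ} (hv : ‖v‖ = 1) : dist (x + v) (x + v * om) = 1 := by
  rw [Complex.dist_eq]
  have : x + v - (x + v * om) = - (v * (om - 1)) := by ring
  rw [this, norm_neg, norm_mul, hv, om_sub_norm]; norm_num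

theorem dist_cen {x v : ℂ} (hv : ‖v‖ = 1) : dist (x + v) x = 1 := by
  rw [Complex.dist_eq]; simpa using hv

theorem norm_vom {v : ℂ} (hv : ‖v‖ = 1) (k : ℕ) : ‖v * om ^ k‖ = 1 := by
  rw [norm_mul, norm_pow, om_norm, hv]; norm_num

end Hx


open Set Metric Filter Topology

namespace Hx

variable {c : ℂ → Fin 6} {F : Set (Set ℂ)}

/-- all rotates of the point at angle `θ` are generic -/
def AllGn (F : Set (Set ℂ)) (z : ℂ) (θ : ℝ) : Prop :=
  ∀ k : ℕ, Gn F (z + Complex.exp (θ * Complex.I) * om ^ k)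

theorem allGn_dense (h : Col c F) (z : ℂ) : Dense {θ : ℝ | AllGn F z θ} := by
  have : {θ : ℝ | AllGn F z θ} =
      (⋃ k : ℕ, {θ : ℝ | ¬ Gn F (z + om ^ k * Complex.exp (θ * Complex.I))})ᶜ := by
    ext θ
    simp [AllGn, mul_comm]
  rw [this]
  refine Set.Countable.dense_compl ℝ (countable_iUnion fun k => bad_gn h z _ ?_)
  rw [norm_pow, om_norm, one_pow]

theorem rot_color (h : Col c F) {z v : ℂ} (hv : ‖v‖ = 1) (k : ℕ) :
    c (z + v * om ^ k) ≠ c (z + v * om ^ (k + 1)) := by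
  apply h.proper
  have := dist_hex (x := z) (norm_vom hv k)
  rwa [mul_assoc, ← pow_succ] at this

theorem comp2 (h : Col c F) {z : ℂ} (hz : 4 ≤ (CC c F z).card) :
    (CC c F z).card = 4 ∧ ∃ θ : ℝ, AllGn F z θ := by
  obtain ⟨θ, hθ⟩ := (allGn_dense h z).nonempty
  refine ⟨?_, θ, hθ⟩
  have hv := expI_norm θ
  set v := Complex.exp (θ * Complex.I)
  have h0 := gn_not_mem h (hθ 0) (dist_cen (norm_vom hv 0))
  have h1 := gn_not_mem h (hθ 1) (dist_cen (norm_vom hv 1))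
  have hne := rot_color h (z := z) hv 0
  have hs : ({c (z + v * om ^ 0), c (z + v * om ^ 1)} : Finset (Fin 6)) ⊆ (CC c F z)ᶜ := by
    intro i hi
    rw [Finset.mem_compl]
    rw [Finset.mem_insert, Finset.mem_singleton] at hi
    rcases hi with rfl | rfl
    · exact h0
    · exact h1
  have := Finset.card_le_card hs
  rw [Finset.card_pair hne, Finset.card_compl, Fintype.card_fin] at this
  omega

theorem hex_exists (h : Col c F) {z : ℂ} (hz : 4 ≤ (CC c F z).card) :
    ∃ e f, ∃ v : ℂ, e ≠ f ∧ (CC c F z)ᶜ = {e, f} ∧ ‖v‖ = 1 ∧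
      ∀ k : ℕ, e ∈ CC c F (z + v * om ^ k) ∧ f ∈ CC c F (z + v * om ^ k) := by
  have hcard := (comp2 h hz).1
  have hc2 : ((CC c F z)ᶜ).card = 2 := by rw [Finset.card_compl, hcard]; rfl
  obtain ⟨e, f, hef, hC⟩ := Finset.card_eq_two.1 hc2
  have hcol : ∀ θ : ℝ, AllGn F z θ → ∀ k : ℕ,
      c (z + Complex.exp (θ * Complex.I) * om ^ k) = e ∨
      c (z + Complex.exp (θ * Complex.I) * om ^ k) = f := by
    intro θ hθ k
    have h0 := gn_not_mem h (hθ k) (dist_cen (norm_vom (expI_norm θ) k))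
    rw [← Finset.mem_compl, hC] at h0
    simpa using h0
  set A : Fin 6 → Set ℝ := fun i => {θ | AllGn F z θ ∧ c (z + Complex.exp (θ * Complex.I)) = i}
  have hcov : ∀ θ, AllGn F z θ → θ ∈ A e ∪ A f := by
    intro θ hθ
    rcases hcol θ hθ 0 with h1 | h1
    · left; exact ⟨hθ, by simpa using h1⟩
    · right; exact ⟨hθ, by simpa using h1⟩
  have hcov2 : (univ : Set ℝ) ⊆ closure (A e) ∪ closure (A f) := by
    rw [← closure_union, ← (allGn_dense h z).closure_eq]
    exact closure_mono hcov
  have hshift : ∀ θ : ℝ, AllGn F z θ → ∃ θ' : ℝ, AllGn F z θ' ∧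
      c (z + Complex.exp (θ' * Complex.I)) ≠ c (z + Complex.exp (θ * Complex.I)) := by
    intro θ hθ
    have e1 : Complex.exp ((θ + Real.pi / 3 : ℝ) * Complex.I) =
        Complex.exp (θ * Complex.I) * om := by
      have : Complex.exp ((Real.pi / 3 : ℝ) * Complex.I) = om := by
        rw [Complex.exp_mul_I, ← Complex.ofReal_cos, ← Complex.ofReal_sin, Real.cos_pi_div_three,
          Real.sin_pi_div_three]
        apply Complex.ext <;> simp [om]
      rw [← this, ← Complex.exp_add]; congr 1; push_cast; ring
    refine ⟨θ + Real.pi / 3, ?_, ?_⟩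
    · intro k
      rw [e1, mul_assoc, ← pow_succ']; exact hθ (k + 1)
    · rw [e1]
      have := rot_color h (z := z) (expI_norm θ) 0
      simpa using this.symm
  obtain ⟨θ, hθ⟩ := (allGn_dense h z).nonempty
  obtain ⟨θ', hθ', hne⟩ := hshift θ hθ
  have hboth : (A e).Nonempty ∧ (A f).Nonempty := by
    rcases hcov θ hθ with h1 | h1 <;> rcases hcov θ' hθ' with h2 | h2
    · exact (hne (h2.2.trans h1.2.symm)).elim
    · exact ⟨⟨_, h1⟩, ⟨_, h2⟩⟩
    · exact ⟨⟨_, h2⟩, ⟨_, h1⟩⟩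
    · exact (hne (h2.2.trans h1.2.symm)).elim
  obtain ⟨t, -, ht1, ht2⟩ := isPreconnected_closed_iff.1 (isPreconnected_univ (α := ℝ)) _ _
    isClosed_closure isClosed_closure hcov2
    (by obtain ⟨a, ha⟩ := hboth.1; exact ⟨a, trivial, subset_closure ha⟩)
    (by obtain ⟨a, ha⟩ := hboth.2; exact ⟨a, trivial, subset_closure ha⟩)
  refine ⟨e, f, Complex.exp (t * Complex.I), hef, hC, expI_norm t, fun k => ?_⟩
  -- colors differ at all levels
  have hdiff : ∀ a ∈ A e, ∀ b ∈ A f, ∀ k : ℕ, c (z + Complex.exp (a * Complex.I) * om ^ k) ≠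
      c (z + Complex.exp (b * Complex.I) * om ^ k) := by
    intro a ha b hb k
    induction k with
    | zero => simpa [ha.2, hb.2] using hef
    | succ k ih =>
      have a1 := rot_color h (z := z) (expI_norm a) k
      have b1 := rot_color h (z := z) (expI_norm b) k
      have a2 := hcol a ha.1 k
      have a3 := hcol a ha.1 (k + 1)
      have b2 := hcol b hb.1 k
      have b3 := hcol b hb.1 (k + 1)
      grind
  obtain ⟨ε, hε, hl⟩ := loc h (z + Complex.exp (t * Complex.I) * om ^ k)
  have hcont : Continuous fun θ : ℝ => z + Complex.exp (θ * Complex.I) * om ^ k := by fun_prop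
  have hU : {θ : ℝ | dist (z + Complex.exp (θ * Complex.I) * om ^ k)
      (z + Complex.exp (t * Complex.I) * om ^ k) < ε} ∈ 𝓝 t :=
    hcont.continuousAt (ball_mem_nhds _ hε)
  obtain ⟨a, ha1, ha2⟩ := mem_closure_iff_nhds.1 ht1 _ hU
  obtain ⟨b, hb1, hb2⟩ := mem_closure_iff_nhds.1 ht2 _ hU
  obtain ⟨P, hP, -⟩ := gn_near h hl (ha2.1 k) ha1
  obtain ⟨Q, hQ, -⟩ := gn_near h hl (hb2.1 k) hb1
  have m1 := hP.mem
  have m2 := hQ.mem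
  have d := hdiff a ha2 b hb2 k
  rcases hcol a ha2.1 k with h1 | h1 <;> rcases hcol b hb2.1 k with h2 | h2
  · exact (d (h1.trans h2.symm)).elim
  · rw [h1] at m1; rw [h2] at m2; exact ⟨m1, m2⟩
  · rw [h1] at m1; rw [h2] at m2; exact ⟨m2, m1⟩
  · exact (d (h1.trans h2.symm)).elim

theorem om_pow_re : (om ^ 0).re = 1 ∧ (om ^ 1).re = 1 / 2 ∧ (om ^ 2).re = -(1 / 2) ∧
    (om ^ 3).re = -1 ∧ (om ^ 4).re = - (1 / 2) ∧ (om ^ 5).re = 1 / 2 := by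
  have h4 : om ^ 4 = - om := by linear_combination om * om_cube
  have h5 : om ^ 5 = - (om - 1) := by linear_combination om ^ 2 * om_cube - om_sq
  rw [h4, h5, om_cube, om_sq]
  simp [om]; norm_num

/-- squared distance from `x + tv` to `x + v ω^j` -/
theorem dist_dir {x v : ℂ} (hv : ‖v‖ = 1) (t : ℝ) (j : ℕ) :
    dist (x + t * v) (x + v * om ^ j) ^ 2 = 1 - 2 * t * (om ^ j).re + t ^ 2 := by
  rw [Complex.dist_eq]
  have : x + t * v - (x + v * om ^ j) = v * (t - om ^ j) := by ring
  rw [this, norm_mul, hv, one_mul, ← Complex.normSq_eq_norm_sq]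
  have h1 : Complex.normSq (om ^ j) = 1 := by
    rw [Complex.normSq_eq_norm_sq, norm_pow, om_norm]; norm_num
  rw [Complex.normSq_apply] at h1 ⊢
  simp
  nlinarith

/-- a tile at `z` in the direction of `v` -/
theorem dir_tile (h : Col c F) (z : ℂ) {v : ℂ} (hv : ‖v‖ = 1) :
    ∃ i ∈ CC c F z, (∀ j ∈ ({0, 1, 5} : Finset ℕ), Nr c F i z (z + v * om ^ j)) ∧
      (∀ j ∈ ({2, 3, 4} : Finset ℕ), Fa c F i z (z + v * om ^ j)) := by
  obtain ⟨ε, hε, hl⟩ := loc h z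
  set t : ℝ := min (ε / 2) (1 / 2) with ht
  have ht0 : 0 < t := by positivity
  have ht1 : t ≤ 1 / 2 := min_le_right _ _
  have ht2 : t ≤ ε / 2 := min_le_left _ _
  set q := z + t * v
  have r := om_pow_re
  have hin : ∀ j ∈ ({0, 1, 5} : Finset ℕ), dist q (z + v * om ^ j) < 1 := by
    intro j hj
    have := dist_dir (x := z) hv t j
    apply lt_one_of_sq
    rw [this]
    simp only [Finset.mem_insert, Finset.mem_singleton] at hj
    rcases hj with rfl | rfl | rfl
    · rw [r.1]; nlinarith
    · rw [r.2.1]; nlinarith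
    · rw [r.2.2.2.2.2]; nlinarith
  have hout : ∀ j ∈ ({2, 3, 4} : Finset ℕ), 1 < dist q (z + v * om ^ j) := by
    intro j hj
    have := dist_dir (x := z) hv t j
    apply gt_one_of_sq dist_nonneg
    rw [this]
    simp only [Finset.mem_insert, Finset.mem_singleton] at hj
    rcases hj with rfl | rfl | rfl
    · rw [r.2.2.1]; nlinarith
    · rw [r.2.2.2.1]; nlinarith
    · rw [r.2.2.2.2.1]; nlinarith
  have ev : ∀ᶠ s in 𝓝 q, (∀ j ∈ ({0, 1, 5} : Finset ℕ), dist s (z + v * om ^ j) < 1) ∧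
      (∀ j ∈ ({2, 3, 4} : Finset ℕ), 1 < dist s (z + v * om ^ j)) ∧ dist s z < ε := by
    refine ((Finset.eventually_all _).2 fun j hj => ?_).and
      (((Finset.eventually_all _).2 fun j hj => ?_).and ?_)
    · have : ContinuousAt (fun s => dist s (z + v * om ^ j)) q := by fun_prop
      exact this.eventually_lt continuousAt_const (hin j hj)
    · have : ContinuousAt (fun s => dist s (z + v * om ^ j)) q := by fun_prop
      exact continuousAt_const.eventually_lt this (hout j hj)
    · have : ContinuousAt (fun s => dist s z) q := by fun_prop
      refine this.eventually_lt continuousAt_const ?_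
      rw [Complex.dist_eq]; simp [q, hv, abs_of_pos ht0]; linarith
  obtain ⟨η, hη, hb⟩ := Metric.eventually_nhds_iff.1 ev
  obtain ⟨s, hs, hsd⟩ := gn_dense h q hη
  obtain ⟨h1, h2, h3⟩ := hb hsd
  obtain ⟨P, hP, hsP⟩ := gn_near h hl hs h3
  refine ⟨c s, hP.mem, fun j hj => ?_, fun j hj => ?_⟩
  · rcases nr_or_fa h (c s) z (z + v * om ^ j) with h4 | h4
    · exact h4
    · intro P' Q' hP' hQ'
      exact absurd (h4 P Q' hP hQ' s (subset_closure hsP) _ hQ'.2.1) (not_le.2 (h1 j hj))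
  · rcases nr_or_fa h (c s) z (z + v * om ^ j) with h4 | h4
    · intro P' Q' hP' hQ'
      exact absurd (h4 P Q' hP hQ' s (subset_closure hsP) _ hQ'.2.1) (not_le.2 (h2 j hj))
    · exact h4

theorem E1_comb' : ∀ m m' : Fin 6, m ≠ m' → ∀ p : Fin 2, ∃ j ∈ ({0, 1, 5} : Finset (Fin 6)),
    ∃ j' ∈ ({2, 3, 4} : Finset (Fin 6)), ((m.val + j.val) % 6 = (m'.val + j'.val) % 6 ∧
      (m.val + j.val) % 2 = p.val) ∨
      ((m'.val + j.val) % 6 = (m.val + j'.val) % 6 ∧ (m'.val + j.val) % 2 = p.val) := by decide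

theorem E1_comb (m : ℕ) (hm : m < 6) (m' : ℕ) (hm' : m' < 6) (hmm : m ≠ m') (p : ℕ) (hp : p < 2) :
    ∃ j ∈ ({0, 1, 5} : Finset ℕ),
    ∃ j' ∈ ({2, 3, 4} : Finset ℕ), ((m + j) % 6 = (m' + j') % 6 ∧ (m + j) % 2 = p) ∨
      ((m' + j) % 6 = (m + j') % 6 ∧ (m' + j) % 2 = p) := by
  obtain ⟨j, hj, j', hj', hh⟩ := E1_comb' ⟨m, hm⟩ ⟨m', hm'⟩ (by simpa using hmm) ⟨p, hp⟩
  refine ⟨j.val, ?_, j'.val, ?_, hh⟩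
  · clear hh hj'; revert j; decide
  · clear hh hj; revert j'; decide

theorem E1 (h : Col c F) (z : ℂ) : (CC c F z).card ≤ 3 := by
  by_contra hcon
  have hz : 4 ≤ (CC c F z).card := by omega
  obtain ⟨e, f, v, hef, hC, hv, hev⟩ := hex_exists h hz
  have hcz : (CC c F z).card = 4 := (comp2 h hz).1
  set y : ℕ → ℂ := fun k => z + v * om ^ k with hy
  have yper : ∀ k, y (k % 6) = y k := by
    intro k
    simp only [hy]
    congr 2
    conv_rhs => rw [← Nat.div_add_mod k 6, pow_add, pow_mul, om_six, one_pow, one_mul]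
  have notez : ∀ i, i ∈ CC c F z ↔ i ≠ e ∧ i ≠ f := by
    intro i
    have : i ∉ (CC c F z)ᶜ ↔ i ≠ e ∧ i ≠ f := by rw [hC]; simp
    rw [← this]; simp
  have alt : ∀ k, ∀ i ∈ CC c F z, (i ∈ CC c F (y k) ↔ i ∉ CC c F (y (k + 1))) := by
    intro k i hi
    have hvk := norm_vom hv k
    have e1 : y (k + 1) = z + v * om ^ k * om := by simp only [hy]; ring
    have d1 : dist (y k) (y (k + 1)) = 1 := by rw [e1]; exact dist_hex hvk
    have d2 : dist (y k) z = 1 := dist_cen hvk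
    have ho : orn (y k) (y (k + 1)) z ≠ 0 := by
      rw [e1, orn_hex hvk]; have := sqrt3_pos; linarith
    obtain ⟨a, b, ha, hb, ha', hb', na, fb⟩ := two_sides h d1 d2 ho
    have hk := hev k
    have hk1 := hev (k + 1)
    have ae : a ≠ e ∧ a ≠ f := ⟨fun q => ha' (q ▸ hk1.1), fun q => ha' (q ▸ hk1.2)⟩
    have be : b ≠ e ∧ b ≠ f := ⟨fun q => hb' (q ▸ hk1.1), fun q => hb' (q ▸ hk1.2)⟩
    have hab : a ≠ b := by
      rintro rfl
      exact nr_fa_false h na fb ha ((notez a).2 ae)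
    have hsub : ({e, f, a, b} : Finset (Fin 6)) ⊆ CC c F (y k) := by
      intro i hi
      simp only [Finset.mem_insert, Finset.mem_singleton] at hi
      rcases hi with rfl | rfl | rfl | rfl
      exacts [hk.1, hk.2, ha, hb]
    have hcard4 : ({e, f, a, b} : Finset (Fin 6)).card = 4 := by
      rw [Finset.card_eq_of_equiv_fin]
      exact Finset.equivFinOfCardEq (by
        rw [Finset.card_insert_of_notMem, Finset.card_insert_of_notMem,
          Finset.card_insert_of_notMem, Finset.card_singleton]
        · simpa using hab
        · simp only [Finset.mem_insert, Finset.mem_singleton]; tauto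
        · simp only [Finset.mem_insert, Finset.mem_singleton]; tauto)
    have h4 : ∀ k, 4 ≤ (CC c F (y k)).card → (CC c F (y k)).card = 4 := fun k hk => (comp2 h hk).1
    have hk4 : (CC c F (y k)).card = 4 := h4 k (hcard4 ▸ Finset.card_le_card hsub)
    have heq : ({e, f, a, b} : Finset (Fin 6)) = CC c F (y k) :=
      Finset.eq_of_subset_of_card_le hsub (by rw [hk4, hcard4])
    -- the next one
    have hk14 : (CC c F (y (k + 1))).card = 4 := by
      apply h4
      have hvk' := norm_vom hv (k + 1)
      have e2 : y (k + 2) = z + v * om ^ (k + 1) * om := by simp only [hy]; ring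
      have d1' : dist (y (k + 1)) (y (k + 2)) = 1 := by rw [e2]; exact dist_hex hvk'
      have d2' : dist (y (k + 1)) z = 1 := dist_cen hvk'
      have ho' : orn (y (k + 1)) (y (k + 2)) z ≠ 0 := by
        rw [e2, orn_hex hvk']; have := sqrt3_pos; linarith
      obtain ⟨a2, b2, g1, g2, g3, g4, g5, g6⟩ := two_sides h d1' d2' ho'
      have hk2 := hev (k + 2)
      have ae : a2 ≠ e ∧ a2 ≠ f := ⟨fun q => g3 (q ▸ hk2.1), fun q => g3 (q ▸ hk2.2)⟩
      have be : b2 ≠ e ∧ b2 ≠ f := ⟨fun q => g4 (q ▸ hk2.1), fun q => g4 (q ▸ hk2.2)⟩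
      have hab : a2 ≠ b2 := by
        rintro rfl
        exact nr_fa_false h g5 g6 g1 ((notez a2).2 ae)
      have hsub : ({e, f, a2, b2} : Finset (Fin 6)) ⊆ CC c F (y (k + 1)) := by
        intro i hi
        simp only [Finset.mem_insert, Finset.mem_singleton] at hi
        rcases hi with rfl | rfl | rfl | rfl
        exacts [hk1.1, hk1.2, g1, g2]
      refine le_trans (le_of_eq ?_) (Finset.card_le_card hsub)
      symm
      rw [Finset.card_insert_of_notMem, Finset.card_insert_of_notMem,
          Finset.card_insert_of_notMem, Finset.card_singleton]
      · simpa using hab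
      · simp only [Finset.mem_insert, Finset.mem_singleton]; tauto
      · simp only [Finset.mem_insert, Finset.mem_singleton]; tauto
    have heq2 : CC c F (y (k + 1)) = ({a, b} : Finset (Fin 6))ᶜ := by
      apply Finset.eq_of_subset_of_card_le
      · intro i hi
        rw [Finset.mem_compl, Finset.mem_insert, Finset.mem_singleton]
        rintro (rfl | rfl)
        exacts [ha' hi, hb' hi]
      · rw [Finset.card_compl, Finset.card_pair hab, hk14]; rfl
    rw [← heq, heq2]
    have := (notez i).1 hi
    simp only [Finset.mem_insert, Finset.mem_singleton, Finset.mem_compl, not_not]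
    tauto
  have par : ∀ i ∈ CC c F z, ∃ p < 2, ∀ k, k % 2 = p → i ∈ CC c F (y k) := by
    intro i hi
    by_cases h0 : i ∈ CC c F (y 0)
    · refine ⟨0, by norm_num, ?_⟩
      have : ∀ n, i ∈ CC c F (y (2 * n)) := by
        intro n
        induction n with
        | zero => exact h0
        | succ n ih =>
          have a1 := alt (2 * n) i hi
          have a2 := alt (2 * n + 1) i hi
          rw [show 2 * (n + 1) = 2 * n + 1 + 1 by ring]
          tauto
      intro k hk
      have := this (k / 2)
      rwa [show 2 * (k / 2) = k by omega] at this
    · refine ⟨1, by norm_num, ?_⟩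
      have : ∀ n, i ∈ CC c F (y (2 * n + 1)) := by
        intro n
        induction n with
        | zero => have := alt 0 i hi; simp only [mul_zero]; tauto
        | succ n ih =>
          have a1 := alt (2 * n + 1) i hi
          have a2 := alt (2 * n + 1 + 1) i hi
          rw [show 2 * (n + 1) + 1 = 2 * n + 1 + 1 + 1 by ring]
          tauto
      intro k hk
      have := this (k / 2)
      rwa [show 2 * (k / 2) + 1 = k by omega] at this
  have dirs := fun m : ℕ => dir_tile h z (norm_vom hv m)
  choose ι hι hN hF using dirs
  have hcardlt : (CC c F z).card < (Finset.range 6).card := by rw [hcz]; simp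
  obtain ⟨m, hm, m', hm', hmm, heq⟩ := Finset.exists_ne_map_eq_of_card_lt_of_maps_to hcardlt
    (fun m _ => hι m)
  rw [Finset.mem_range] at hm hm'
  obtain ⟨p, hp, hpar⟩ := par (ι m) (hι m)
  have yadd : ∀ m j, z + v * om ^ m * om ^ j = y (m + j) := by
    intro m j; simp only [hy]; rw [mul_assoc, ← pow_add]
  obtain ⟨j, hj, j', hj', hh | hh⟩ := E1_comb m hm m' hm' hmm p hp
  · have n1 := hN m j hj
    have f1 := hF m' j' hj'
    rw [yadd, ← yper] at n1 f1
    rw [← heq, ← hh.1] at f1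
    refine nr_fa_false h n1 f1 (hι m) ?_
    rw [yper]; exact hpar _ hh.2
  · have n1 := hN m' j hj
    have f1 := hF m j' hj'
    rw [yadd, ← yper] at n1 f1
    rw [← heq, hh.1] at n1
    refine nr_fa_false h n1 f1 (hι m) ?_
    rw [← hh.1, yper]; exact hpar _ hh.2

theorem two_circles {v w : ℂ} (hne : v ≠ w) (hd : dist v w < 2) :
    ∃ z, dist z v = 1 ∧ dist z w = 1 ∧ orn z v w ≠ 0 ∧ orn z w v ≠ 0 := by
  set d := w - v with hdd
  have hd0 : d ≠ 0 := sub_ne_zero.2 hne.symm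
  set n := Complex.normSq d with hn
  have hn0 : 0 < n := Complex.normSq_pos.2 hd0
  have hn4 : n < 4 := by
    rw [hn, Complex.normSq_eq_norm_sq, hdd, ← Complex.dist_eq, dist_comm]
    nlinarith [dist_nonneg (x := v) (y := w)]
  have hpos : 0 < 1 / n - 1 / 4 := by
    have : 1 / 4 < 1 / n := one_div_lt_one_div_of_lt hn0 hn4
    linarith
  set t := √(1 / n - 1 / 4) with ht
  have ht0 : 0 < t := Real.sqrt_pos.2 hpos
  have ht2 : t ^ 2 = 1 / n - 1 / 4 := Real.sq_sqrt hpos.le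
  have htn : (t ^ 2 + 1 / 4) * n = 1 := by rw [ht2]; field_simp; ring
  have hnn : n = d.re ^ 2 + d.im ^ 2 := by rw [hn, Complex.normSq_apply]; ring
  have dsq : ∀ a : ℂ, Complex.normSq a = 1 → ‖a‖ = 1 := by
    intro a ha
    rw [Complex.normSq_eq_norm_sq] at ha
    nlinarith [norm_nonneg a]
  have hw : w = v + d := by rw [hdd]; ring
  refine ⟨v + d * ⟨1 / 2, t⟩, ?_, ?_, ?_, ?_⟩
  · rw [Complex.dist_eq]
    apply dsq
    rw [add_sub_cancel_left, Complex.normSq_mul, ← hn, Complex.normSq_apply]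
    linarith
  · rw [Complex.dist_eq]
    apply dsq
    have : v + d * ⟨1 / 2, t⟩ - w = d * ⟨-(1 / 2), t⟩ := by
      rw [hw]; apply Complex.ext <;> simp <;> ring
    rw [this, Complex.normSq_mul, ← hn, Complex.normSq_apply]
    simp only []
    linarith
  · have : orn (v + d * ⟨1 / 2, t⟩) v w = - (t * n) := by
      rw [hw, hnn]; simp [orn]; ring
    rw [this]
    have := mul_pos ht0 hn0
    linarith
  · have : orn (v + d * ⟨1 / 2, t⟩) w v = t * n := by
      rw [hw, hnn]; simp [orn]; ring
    rw [this]
    exact (mul_pos ht0 hn0).ne'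

theorem E3 (h : Col c F) {v w : ℂ} (hu : ∀ i, i ∈ CC c F v ∨ i ∈ CC c F w) (hne : v ≠ w) :
    2 ≤ dist v w := by
  by_contra hd
  push Not at hd
  obtain ⟨z, z1, z2, o1, o2⟩ := two_circles hne hd
  obtain ⟨a, b, ha, hb, ha', hb', na, fb⟩ := two_sides h z1 z2 o1
  obtain ⟨a2, b2, g1, g2, g3, g4, g5, g6⟩ := two_sides h z2 z1 o2
  have haw := (hu a).resolve_left ha'
  have hbw := (hu b).resolve_left hb'
  have haw2 := (hu a2).resolve_right g3
  have hbw2 := (hu b2).resolve_right g4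
  have hab : a ≠ b := by rintro rfl; exact nr_fa_false h na fb ha haw
  have hab2 : a2 ≠ b2 := by rintro rfl; exact nr_fa_false h g5 g6 g1 haw2
  have hE := E1 h z
  have hsub : ({a, b, a2, b2} : Finset (Fin 6)) ⊆ CC c F z := by
    intro i hi
    simp only [Finset.mem_insert, Finset.mem_singleton] at hi
    rcases hi with rfl | rfl | rfl | rfl
    exacts [ha, hb, g1, g2]
  have : ({a, b, a2, b2} : Finset (Fin 6)).card = 4 := by
    rw [Finset.card_insert_of_notMem, Finset.card_insert_of_notMem,
          Finset.card_insert_of_notMem, Finset.card_singleton]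
    · simpa using hab2
    · simp only [Finset.mem_insert, Finset.mem_singleton]
      rintro (rfl | rfl) <;> contradiction
    · simp only [Finset.mem_insert, Finset.mem_singleton]
      rintro (rfl | rfl | rfl) <;> contradiction
  have := Finset.card_le_card hsub
  omega

end Hx


open Set Metric Filter Topology

namespace Hx

/-- indicator in `ZMod 2` -/
noncomputable def I2 (p : Prop) : ZMod 2 := by
  classical exact if p then 1 else 0

theorem I2_true {p : Prop} (h : p) : I2 p = 1 := by simp [I2, h]
theorem I2_false {p : Prop} (h : ¬ p) : I2 p = 0 := by simp [I2, h]
theorem I2_congr {p q : Prop} (h : p ↔ q) : I2 p = I2 q := by rw [propext h]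
theorem z2_add_self (a : ZMod 2) : a + a = 0 := CharTwo.add_self_eq_zero a
theorem z2_cases (a : ZMod 2) : a = 0 ∨ a = 1 := by revert a; decide
theorem z2_two : (2 : ZMod 2) = 0 := by decide
theorem I2_eq_one {p : Prop} : I2 p = 1 ↔ p := by
  by_cases h : p <;> simp [I2, h]
theorem I2_eq_zero {p : Prop} : I2 p = 0 ↔ ¬ p := by
  by_cases h : p <;> simp [I2, h]

section comb
variable {g : ℕ → ZMod 3} {N : ℕ}

theorem step_dec : ∀ p q p' q' : ZMod 3, p ≠ q → p' ≠ q' → ¬ (p ≠ p' ∧ q = p' ∧ q' = p) →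
    ((if q' - p' = 2 then 1 else 0 : ZMod 2) + (if q - p = 2 then 1 else 0)) =
      (if p ≠ p' then 1 else 0) + (if q ≠ q' then 1 else 0) := by decide

theorem fro_dec : ∀ p q p' q' s : ZMod 3, p ≠ q → p' ≠ q' → ¬ (p ≠ p' ∧ q = p' ∧ q' = p) →
    q = p + s → (p' - p = 0 → q' - q ≠ - s) ∧ (p' - p = s → q' - q = s) ∧
      (p' - p = -s → q' - q ≠ s) ∧ (q' - q = 0 ∨ q' - q = s ∨ q' - q = -s) := by decide

theorem sum_dec : ∀ a b c d e f : ZMod 3, a ≠ 0 → b ≠ 0 → c ≠ 0 → d ≠ 0 → e ≠ 0 → f ≠ 0 →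
    a + b + c + d + e + f = 0 →
    ((if a = 2 then 1 else 0 : ZMod 2) + (if b = 2 then 1 else 0) + (if c = 2 then 1 else 0) +
    (if d = 2 then 1 else 0) + (if e = 2 then 1 else 0) + (if f = 2 then 1 else 0) = 1) ∨
    (a = b ∧ b = c ∧ c = d ∧ d = e ∧ e = f) := by decide

theorem tele (m : ℕ → ZMod 2) (n : ℕ) : ∑ i ∈ Finset.range n, (m (i + 1) + m i) = m n + m 0 := by
  induction n with
  | zero => simp [z2_add_self]
  | succ n ih => rw [Finset.sum_range_succ, ih]; linear_combination m n * z2_two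

structure Cyc (g : ℕ → ZMod 3) (N : ℕ) : Prop where
  pos : 0 < N
  per : ∀ i, g (i + 6 * N) = g i
  ne : ∀ i, g i ≠ g (i + N)
  noswap : ∀ i, ¬ (g i ≠ g (i + 1) ∧ g (i + N) = g (i + 1) ∧ g (i + 1 + N) = g i)
  nofwd : ∀ i s, s ≠ 0 → (∀ k : ℕ, g (i + k * N) = g i + k * s) →
    ¬ (∀ k : ℕ, g (i + 1 + k * N) = g i + (k + 1) * s)
  noback : ∀ i s, s ≠ 0 → (∀ k : ℕ, g (i + k * N) = g i + k * s) →
    ¬ (∀ k : ℕ, g (i + 1 + k * N) = g i + (k + 2) * s)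

theorem Cyc.per' (h : Cyc g N) (j i : ℕ) : g (i + j * (6 * N)) = g i := by
  induction j with
  | zero => simp
  | succ j ih => rw [show i + (j + 1) * (6 * N) = i + j * (6 * N) + 6 * N by ring, h.per, ih]

theorem Cyc.frozen_step (h : Cyc g N) {i : ℕ} {s : ZMod 3} (hs : s ≠ 0)
    (hi : ∀ k : ℕ, g (i + k * N) = g i + k * s) : ∀ k : ℕ, g (i + 1 + k * N) = g (i + k * N) := by
  have key := fun k : ℕ => fro_dec (g (i + k * N)) (g (i + (k + 1) * N)) (g (i + 1 + k * N))
    (g (i + 1 + (k + 1) * N)) s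
    (by have := h.ne (i + k * N); rwa [show i + k * N + N = i + (k + 1) * N by ring] at this)
    (by have := h.ne (i + 1 + k * N)
        rwa [show i + 1 + k * N + N = i + 1 + (k + 1) * N by ring] at this)
    (by have := h.noswap (i + k * N)
        rwa [show i + k * N + N = i + (k + 1) * N by ring,
          show i + k * N + 1 = i + 1 + k * N by ring,
          show i + 1 + k * N + N = i + 1 + (k + 1) * N by ring] at this)
    (by rw [hi k, hi (k + 1)]; push_cast; ring)
  set d : ℕ → ZMod 3 := fun k => g (i + 1 + k * N) - g (i + k * N) with hd
  have dper : ∀ k j, d (k + j * 6) = d k := by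
    intro k j
    have e1 : i + (k + j * 6) * N = i + k * N + j * (6 * N) := by ring
    have e2 : i + 1 + (k + j * 6) * N = i + 1 + k * N + j * (6 * N) := by ring
    simp only [hd]
    rw [e1, e2, h.per', h.per']
  have prop : ∀ v, (∀ k, d k = v → d (k + 1) = v) → ∀ k0, d k0 = v → ∀ k, d k = v := by
    intro v hv k0 h0 k
    have : ∀ j, d (k0 + j) = v := by
      intro j
      induction j with
      | zero => exact h0
      | succ j ih => exact hv _ ih
    have h1 := this (k + k0 * 5)
    rw [show k0 + (k + k0 * 5) = k + k0 * 6 by ring, dper] at h1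
    exact h1
  have three : ∀ t s : ZMod 3, s ≠ 0 → t = 0 ∨ t = s ∨ t = - s := by decide
  have c1 : ∀ k, d k ≠ s := by
    intro k0 h0
    have := prop s (fun k hk => (key k).2.1 hk) k0 h0
    refine h.nofwd i s hs hi fun k => ?_
    have h1 := this k
    simp only [hd] at h1
    rw [sub_eq_iff_eq_add.1 h1, hi k]; ring
  have c2 : ∀ k, d k ≠ - s := by
    by_contra hc
    push Not at hc
    obtain ⟨k0, h0⟩ := hc
    have h00 : ∀ k, d k ≠ 0 := by
      intro k hk
      have := prop 0 (fun k hk => by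
        rcases three (d (k + 1)) s hs with h1 | h1 | h1
        · exact h1
        · exact (c1 _ h1).elim
        · exact ((key k).1 hk h1).elim) k hk
      rw [this] at h0
      exact hs (by rw [eq_comm, neg_eq_zero] at h0; exact h0)
    refine h.noback i s hs hi fun k => ?_
    have h1 : d k = - s := by
      rcases three (d k) s hs with h1 | h1 | h1
      · exact (h00 _ h1).elim
      · exact (c1 _ h1).elim
      · exact h1
    simp only [hd] at h1
    rw [sub_eq_iff_eq_add.1 h1, hi k]
    have h3 : (3 : ZMod 3) = 0 := by decide
    linear_combination - s * h3
  intro k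
  rcases three (d k) s hs with h1 | h1 | h1
  · exact sub_eq_zero.1 h1
  · exact (c1 _ h1).elim
  · exact (c2 _ h1).elim

theorem Cyc.not_frozen (h : Cyc g N) {s : ZMod 3} (hs : s ≠ 0)
    (hi : ∀ k : ℕ, g (k * N) = g 0 + k * s) : False := by
  have : ∀ i k : ℕ, g (i + k * N) = g (k * N) := by
    intro i
    induction i with
    | zero => simp
    | succ i ih =>
      intro k
      rw [h.frozen_step hs (i := i) (fun k => by
        have := ih 0
        simp only [zero_mul, add_zero] at this
        rw [ih k, this, hi k]) k, ih k]
  have h1 := this N 0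
  simp only [zero_mul, add_zero] at h1
  exact h.ne 0 (by rw [zero_add, h1])

theorem Cyc.J_odd (h : Cyc g N) :
    ∑ i ∈ Finset.range (6 * N), (if g i ≠ g (i + 1) then 1 else 0 : ZMod 2) = 1 := by
  set m : ℕ → ZMod 2 := fun i => if g (i + N) - g i = 2 then 1 else 0 with hm
  set ch : ℕ → ZMod 2 := fun i => if g i ≠ g (i + 1) then 1 else 0 with hch
  have st : ∀ i, m (i + 1) + m i = ch i + ch (i + N) := by
    intro i
    have := step_dec (g i) (g (i + N)) (g (i + 1)) (g (i + 1 + N)) (h.ne i) (h.ne (i + 1))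
      (h.noswap i)
    simp only [hm, hch]
    rw [this, show i + N + 1 = i + 1 + N by ring]
  set A : ℕ → ZMod 2 := fun k => ∑ i ∈ Finset.range N, ch (i + k * N) with hA
  have hAm : ∀ k, A k + A (k + 1) = m ((k + 1) * N) + m (k * N) := by
    intro k
    have := tele (fun i => m (i + k * N)) N
    simp only [zero_add] at this
    rw [show (k + 1) * N = N + k * N by ring, ← this]
    simp only [hA]
    rw [← Finset.sum_add_distrib]
    refine Finset.sum_congr rfl fun i _ => ?_
    rw [show i + 1 + k * N = i + k * N + 1 by ring, st,
      show i + (k + 1) * N = i + k * N + N by ring]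
  have hJ : ∀ k, ∑ i ∈ Finset.range (k * N), ch i = ∑ j ∈ Finset.range k, A j := by
    intro k
    induction k with
    | zero => simp
    | succ k ih =>
      rw [Finset.sum_range_succ, ← ih, show (k + 1) * N = k * N + N by ring, Finset.sum_range_add]
      simp only [hA]
      congr 1
      exact Finset.sum_congr rfl fun i _ => by rw [add_comm]
  rw [hJ 6]
  have hs : ∀ k, g ((k + 1) * N) - g (k * N) ≠ 0 := by
    intro k hk
    apply h.ne (k * N)
    rw [show k * N + N = (k + 1) * N by ring]
    exact (sub_eq_zero.1 hk).symm
  have g6 : g ((5 + 1) * N) = g (0 * N) := by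
    have := h.per 0
    rw [zero_add] at this
    rw [zero_mul]; exact this
  have := sum_dec _ _ _ _ _ _ (hs 0) (hs 1) (hs 2) (hs 3) (hs 4) (hs 5)
    (by linear_combination g6)
  have mm : ∀ k, m (k * N) = if g ((k + 1) * N) - g (k * N) = 2 then 1 else 0 := by
    intro k; simp only [hm]; rw [show k * N + N = (k + 1) * N by ring]
  rcases this with h1 | h1
  · rw [← mm, ← mm, ← mm, ← mm, ← mm, ← mm] at h1
    simp only [Finset.sum_range_succ, Finset.sum_range_zero]
    have a0 := hAm 0
    have a1 := hAm 2
    have a2 := hAm 4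
    norm_num at a0 a1 a2 h1 ⊢
    linear_combination a0 + a1 + a2 + h1
  · exfalso
    obtain ⟨h1, h2, h3, h4, h5⟩ := h1
    have st : ∀ k, k < 6 → g ((k + 1) * N) = g (k * N) + (g ((0 + 1) * N) - g (0 * N)) := by
      intro k hk
      interval_cases k
      · ring
      · rw [h1]; ring
      · rw [h1, h2]; ring
      · rw [h1, h2, h3]; ring
      · rw [h1, h2, h3, h4]; ring
      · rw [h1, h2, h3, h4, h5]; ring
    have st' : ∀ k : ℕ, g ((k + 1) * N) = g (k * N) + (g ((0 + 1) * N) - g (0 * N)) := by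
      intro k
      have := st (k % 6) (Nat.mod_lt _ (by norm_num))
      have e := Nat.mod_add_div k 6
      have e1 : (k + 1) * N = (k % 6 + 1) * N + (k / 6) * (6 * N) := by
        conv_lhs => rw [← e]
        ring
      have e2 : k * N = (k % 6) * N + (k / 6) * (6 * N) := by
        conv_lhs => rw [← e]
        ring
      rw [e1, e2, h.per', h.per', this]
    refine h.not_frozen (hs 0) fun k => ?_
    induction k with
    | zero => simp
    | succ k ih => rw [st', ih]; push_cast; ring

theorem pair_dec : ∀ a b r p q : ZMod 3, a ≠ b → r ≠ a → r ≠ b →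
   (if (p = a ∧ q = b) ∨ (p = b ∧ q = a) then 1 else 0 : ZMod 2) = (if p ≠ q then 1 else 0) +
    ((if q = r then 1 else 0) + (if p = r then 1 else 0)) := by decide

theorem Cyc.J_pair (h : Cyc g N) {a b : ZMod 3} (hab : a ≠ b) :
    ∑ i ∈ Finset.range (6 * N),
      (if (g i = a ∧ g (i + 1) = b) ∨ (g i = b ∧ g (i + 1) = a) then 1 else 0 : ZMod 2) = 1 := by
  obtain ⟨r, h1, h2⟩ : ∃ r : ZMod 3, r ≠ a ∧ r ≠ b := by revert a b; decide
  rw [Finset.sum_congr rfl (fun i _ => pair_dec a b r (g i) (g (i + 1)) hab h1 h2),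
    Finset.sum_add_distrib, h.J_odd, tele (fun i => if g i = r then 1 else 0)]
  have := h.per 0
  rw [zero_add] at this
  rw [this, z2_add_self, add_zero]

end comb

end Hx


open Set Metric Filter Topology

namespace Hx

variable {c : ℂ → Fin 6} {F : Set (Set ℂ)}

theorem leb {K : Set ℂ} (hK : IsCompact K) {R : ℂ → ℂ → Prop}
    (hR : ∀ v ∈ K, ∀ᶠ u in 𝓝 v, R u v) :
    ∃ L : Finset ℂ, (∀ w ∈ L, w ∈ K) ∧ ∃ η > 0, ∀ v ∈ K, ∃ w ∈ L, ∀ u, dist u v < η → R u w := by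
  obtain ⟨t, htK, ht⟩ := hK.elim_nhds_subcover (fun v => interior {u | R u v})
    (fun v hv => interior_mem_nhds.2 (hR v hv))
  refine ⟨t, htK, ?_⟩
  obtain ⟨η, hη, hl⟩ := lebesgue_number_lemma_of_metric (s := K)
    (c := fun w : t => interior {u | R u w.1}) hK (fun w => isOpen_interior) (by
      intro v hv
      have := ht hv
      simp only [mem_iUnion] at this ⊢
      obtain ⟨w, hw, h1⟩ := this
      exact ⟨⟨w, hw⟩, h1⟩)
  refine ⟨η, hη, fun v hv => ?_⟩
  obtain ⟨w, hw⟩ := hl v hv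
  exact ⟨w.1, w.2, fun u hu => interior_subset (s := {u | R u w.1}) (hw hu)⟩

/-- tiles at `u` are tiles at `w` -/
def Sub (c : ℂ → Fin 6) (F : Set (Set ℂ)) (u w : ℂ) : Prop :=
  ∀ i P, At c F u i P → At c F w i P

theorem sub_ev (h : Col c F) (z : ℂ) : ∀ᶠ p in 𝓝 z, Sub c F p z := by
  obtain ⟨ε, hε, hl⟩ := loc h z
  exact Metric.eventually_nhds_iff.2 ⟨ε, hε, fun p hp => hl p hp⟩

theorem Sub.cmem (h : Col c F) {u w : ℂ} (hs : Sub c F u w) : c u ∈ CC c F w := by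
  obtain ⟨P, hP⟩ := exists_at h u
  exact (hs _ _ hP).mem

theorem om_per (k : ℕ) : om ^ (k % 6) = om ^ k := by
  conv_rhs => rw [← Nat.div_add_mod k 6, pow_add, pow_mul, om_six, one_pow, one_mul]

theorem leb_circle (h : Col c F) (x : ℂ) : ∃ η > 0, ∀ v : ℂ, ‖v‖ = 1 → ∃ w : ℂ, ‖w‖ = 1 ∧
    ∀ u, dist u v < η → ∀ k : ℕ, Sub c F (x + u * om ^ k) (x + w * om ^ k) := by
  obtain ⟨L, hL, η, hη, hl⟩ := leb (isCompact_sphere (0 : ℂ) 1)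
    (R := fun u w => ∀ k ∈ Finset.range 6, Sub c F (x + u * om ^ k) (x + w * om ^ k)) (by
      intro v _
      refine (Finset.eventually_all _).2 fun k _ => ?_
      have : ContinuousAt (fun u : ℂ => x + u * om ^ k) v := by fun_prop
      exact this.eventually (sub_ev h _))
  refine ⟨η, hη, fun v hv => ?_⟩
  obtain ⟨w, hw, h1⟩ := hl v (by simpa using hv)
  refine ⟨w, by simpa using hL w hw, fun u hu k => ?_⟩
  have := h1 u hu (k % 6) (Finset.mem_range.2 (Nat.mod_lt _ (by norm_num)))
  rwa [om_per] at this

theorem third_color (h : Col c F) {x y : ℂ} (hx : (CC c F x).card = 3) (hd : dist y x = 1)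
    {e f a : Fin 6} (he : e ∉ CC c F x) (hf : f ∉ CC c F x) (hef : e ≠ f)
    (hey : e ∈ CC c F y) (hfy : f ∈ CC c F y) (hae : a ≠ e) (haf : a ≠ f) (hay : a ∈ CC c F y) :
    a ∈ CC c F x := by
  by_contra ha
  have hs : ({e, f, a} : Finset (Fin 6)) ⊆ (CC c F x)ᶜ := by
    intro i hi
    simp only [Finset.mem_insert, Finset.mem_singleton] at hi
    rw [Finset.mem_compl]
    rcases hi with rfl | rfl | rfl <;> assumption
  have h3 : ({e, f, a} : Finset (Fin 6)).card = 3 := by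
    rw [Finset.card_insert_of_notMem, Finset.card_pair haf.symm]
    simp only [Finset.mem_insert, Finset.mem_singleton]; tauto
  have heq := Finset.eq_of_subset_of_card_le hs (by rw [Finset.card_compl, hx, h3]; rfl)
  have := E3 h (v := y) (w := x) (by
    intro i
    by_cases hi : i ∈ CC c F x
    · right; exact hi
    · left
      rw [← Finset.mem_compl, ← heq] at hi
      simp only [Finset.mem_insert, Finset.mem_singleton] at hi
      rcases hi with rfl | rfl | rfl <;> assumption) (by rintro rfl; simp at hd)
  linarith

theorem no_swap (h : Col c F) {x v v' w : ℂ} (hx : (CC c F x).card = 3) (hv : ‖v‖ = 1)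
    (hv' : ‖v'‖ = 1) (hw : ‖w‖ = 1)
    (s1 : ∀ k : ℕ, Sub c F (x + v * om ^ k) (x + w * om ^ k))
    (s2 : ∀ k : ℕ, Sub c F (x + v' * om ^ k) (x + w * om ^ k))
    (g1 : Gn F (x + v)) (g2 : Gn F (x + v'))
    (hne : c (x + v) ≠ c (x + v')) (e1 : c (x + v * om) = c (x + v'))
    (e2 : c (x + v' * om) = c (x + v)) : False := by
  have n1 := gn_not_mem h g1 (dist_cen hv)
  have n2 := gn_not_mem h g2 (dist_cen hv')
  have m1 := (s1 0).cmem h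
  have m2 := (s2 0).cmem h
  have m3 := (s1 1).cmem h
  have m4 := (s2 1).cmem h
  simp only [pow_zero, pow_one, mul_one, e1, e2] at m1 m2 m3 m4
  obtain ⟨a, b, ha, hb, ha', hb', na, fb⟩ := two_sides h (dist_hex (x := x) hw) (dist_cen hw)
    (by rw [orn_hex hw]; have := sqrt3_pos; linarith)
  have ae : a ≠ c (x + v) := fun q => ha' (q ▸ m4)
  have af : a ≠ c (x + v') := fun q => ha' (q ▸ m3)
  have be : b ≠ c (x + v) := fun q => hb' (q ▸ m4)
  have bf : b ≠ c (x + v') := fun q => hb' (q ▸ m3)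
  have aT := third_color h hx (dist_cen hw) n1 n2 hne m1 m2 ae af ha
  have hab : a ≠ b := by rintro rfl; exact nr_fa_false h na fb ha aT
  have hE := E1 h (x + w)
  have hsub : ({c (x + v), c (x + v'), a, b} : Finset (Fin 6)) ⊆ CC c F (x + w) := by
    intro i hi
    simp only [Finset.mem_insert, Finset.mem_singleton] at hi
    rcases hi with rfl | rfl | rfl | rfl <;> assumption
  have := Finset.card_le_card hsub
  rw [Finset.card_insert_of_notMem, Finset.card_insert_of_notMem,
          Finset.card_insert_of_notMem, Finset.card_singleton] at this
  · omega
  · simpa using hab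
  · simp only [Finset.mem_insert, Finset.mem_singleton]; tauto
  · simp only [Finset.mem_insert, Finset.mem_singleton]; tauto

/-- determinant -/
def dt (a b : ℂ) : ℝ := a.re * b.im - a.im * b.re

theorem avoid_lines (x : ℂ) (D : Finset ℂ) (hD : ∀ d ∈ D, d ≠ 0) (O : Set ℂ) (hO : IsOpen O)
    (hne : O.Nonempty) : ∃ O' ⊆ O, IsOpen O' ∧ O'.Nonempty ∧ ∀ q ∈ O', ∀ d ∈ D, dt d (q - x) ≠ 0 := by
  classical
  induction D using Finset.induction_on with
  | empty => exact ⟨O, subset_rfl, hO, hne, by simp⟩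
  | insert d D hd ih =>
    obtain ⟨O', hO', ho, ⟨q, hq⟩, hh⟩ := ih (fun d hd => hD d (Finset.mem_insert_of_mem hd))
    have hd0 := hD d (Finset.mem_insert_self _ _)
    have hcont : Continuous fun q : ℂ => dt d (q - x) := by
      unfold dt
      exact (continuous_const.mul (Complex.continuous_im.comp (by fun_prop))).sub
        (continuous_const.mul (Complex.continuous_re.comp (by fun_prop)))
    refine ⟨O' ∩ {q | dt d (q - x) ≠ 0}, inter_subset_left.trans hO',
      ho.inter (isOpen_ne.preimage hcont), ?_, ?_⟩
    · by_cases h0 : dt d (q - x) = 0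
      · obtain ⟨ε, hε, hb⟩ := Metric.isOpen_iff.1 ho q hq
        have hdn : 0 < ‖d‖ := norm_pos_iff.2 hd0
        set s : ℝ := ε / 2 / ‖d‖ with hs
        have hs0 : 0 < s := by positivity
        refine ⟨q + s * (d * Complex.I), hb ?_, ?_⟩
        · rw [mem_ball, Complex.dist_eq, add_sub_cancel_left, norm_mul, norm_mul, Complex.norm_I,
            Complex.norm_real, Real.norm_of_nonneg hs0.le, hs]
          field_simp; linarith
        · have : dt d (q + s * (d * Complex.I) - x) = dt d (q - x) + s * Complex.normSq d := by
            simp [dt, Complex.normSq_apply]; ring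
          show dt d (q + s * (d * Complex.I) - x) ≠ 0
          rw [this, h0, zero_add]
          exact (mul_pos hs0 (Complex.normSq_pos.2 hd0)).ne'
      · exact ⟨q, hq, h0⟩
    · intro q hq d' hd'
      rcases Finset.mem_insert.1 hd' with rfl | h1
      · exact hq.2
      · exact hh q hq.1 d' h1

theorem seg_dt {a b p x : ℂ} (hp : p ∈ segment ℝ a b) (hx : x ∈ segment ℝ a b) :
    dt (b - a) (p - x) = 0 := by
  rw [segment_eq_image'] at hp hx
  obtain ⟨t, -, rfl⟩ := hp
  obtain ⟨s, -, rfl⟩ := hx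
  simp [dt]; ring

theorem ray (h : Col c F) {Q : Set ℂ} (hQ : Q ∈ F) {x u : ℂ} (hx : x ∈ closure Q) (hu : u ≠ 0) :
    ∃ w, dt u w ≠ 0 ∧ ∀ t : ℝ, 0 < t → t ≤ 1 → x + t * w ∈ Q := by
  classical
  obtain ⟨S, hS⟩ := h.seg Q hQ
  have hcl : IsClosed (⋃ e ∈ S.filter (fun e => x ∉ segment ℝ e.1 e.2), segment ℝ e.1 e.2) := by
    refine (Finset.finite_toSet _).isClosed_biUnion fun e _ => ?_
    rw [segment_eq_image ℝ]
    exact (isCompact_Icc.image (by fun_prop)).isClosed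
  obtain ⟨ε, hε, hb⟩ := Metric.isOpen_iff.1 hcl.isOpen_compl x (by
    simp only [mem_compl_iff, mem_iUnion, Finset.mem_filter, not_exists]
    rintro e ⟨-, he⟩ hx'; exact he hx')
  set D : Finset ℂ := insert u ((S.filter fun e => e.1 ≠ e.2).image fun e => e.2 - e.1) with hD
  obtain ⟨O', hO', -, ⟨q, hq⟩, hh⟩ := avoid_lines x D (by
    intro d hd
    rw [hD, Finset.mem_insert, Finset.mem_image] at hd
    rcases hd with rfl | ⟨e, he, rfl⟩
    · exact hu
    · rw [Finset.mem_filter] at he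
      exact sub_ne_zero.2 he.2.symm) (Q ∩ ball x ε) ((h.opn Q hQ).inter isOpen_ball) (by
    obtain ⟨q, hq⟩ := mem_closure_iff.1 hx (ball x ε) isOpen_ball (mem_ball_self hε)
    exact ⟨q, hq.2, hq.1⟩)
  have hqu := hh q hq u (by simp [hD])
  have hq0 : q - x ≠ 0 := by
    intro h0; rw [h0] at hqu; simp [dt] at hqu
  refine ⟨q - x, hqu, ?_⟩
  have hfr : ∀ t : ℝ, 0 < t → t ≤ 1 → x + t * (q - x) ∉ frontier Q := by
    intro t ht ht1 hf
    have := hS hf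
    simp only [mem_iUnion] at this
    obtain ⟨e, he, hp⟩ := this
    by_cases hxe : x ∈ segment ℝ e.1 e.2
    · by_cases hne : e.1 = e.2
      · rw [hne, segment_same, mem_singleton_iff] at hp hxe
        rw [← hxe] at hp
        have : (t : ℂ) * (q - x) = 0 := by linear_combination hp
        rcases mul_eq_zero.1 this with h1 | h1
        · exact ht.ne' (by exact_mod_cast h1)
        · exact hq0 h1
      · have h1 := seg_dt hp hxe
        have h2 := hh q hq (e.2 - e.1) (by
          rw [hD, Finset.mem_insert, Finset.mem_image]
          right; exact ⟨e, Finset.mem_filter.2 ⟨he, hne⟩, rfl⟩)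
        apply h2
        have : dt (e.2 - e.1) (x + t * (q - x) - x) = t * dt (e.2 - e.1) (q - x) := by
          simp [dt]; ring
        rw [this] at h1
        exact (mul_eq_zero.1 h1).resolve_left ht.ne'
    · have h1 : x + t * (q - x) ∈ ball x ε := by
        rw [mem_ball, Complex.dist_eq, add_sub_cancel_left, norm_mul, Complex.norm_real,
          Real.norm_of_nonneg ht.le]
        have h2 := (hO' hq).2
        rw [mem_ball, Complex.dist_eq] at h2
        nlinarith [norm_nonneg (q - x)]
      apply hb h1
      simp only [mem_iUnion, Finset.mem_filter]
      exact ⟨e, ⟨he, hxe⟩, hp⟩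
  have hpc : IsPreconnected ((fun t : ℝ => x + t * (q - x)) '' Ioc 0 1) :=
    isPreconnected_Ioc.image _ (by fun_prop)
  intro t ht ht1
  by_contra hc
  obtain ⟨p, -, hp1, hp2⟩ := hpc Q (closure Q)ᶜ (h.opn Q hQ) isClosed_closure.isOpen_compl (by
      rintro _ ⟨s, hs, rfl⟩
      by_cases hm : x + s * (q - x) ∈ Q
      · left; exact hm
      · right
        intro hcl
        refine hfr s hs.1 hs.2 ?_
        rw [(h.opn Q hQ).frontier_eq]
        exact ⟨hcl, hm⟩)
    ⟨q, ⟨1, by simp, by simp⟩, (hO' hq).1⟩ ⟨_, ⟨t, ⟨ht, ht1⟩, rfl⟩, by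
      intro hcl
      refine hfr t ht ht1 ?_
      rw [(h.opn Q hQ).frontier_eq]
      exact ⟨hcl, hc⟩⟩
  exact hp2 (subset_closure hp1)

/-- cusp lemma -/
theorem cusp (h : Col c F) {Q : Set ℂ} (hQ : Q ∈ F) {x u : ℂ} (hx : x ∈ closure Q) (hu : ‖u‖ = 1) :
    ∃ q ∈ Q, dist q (x + u) < 1 ∨ dist q (x - u) < 1 := by
  have hu0 : u * Complex.I ≠ 0 := by
    intro h0
    have := congrArg norm h0
    rw [norm_mul, hu, Complex.norm_I] at this; simp at this
  obtain ⟨w, hw, hr⟩ := ray h hQ hx hu0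
  have hnu : u.re ^ 2 + u.im ^ 2 = 1 := by
    have := Complex.normSq_eq_norm_sq u
    rw [hu, Complex.normSq_apply] at this; linarith
  set B : ℝ := u.re * w.re + u.im * w.im with hB
  have hwB : dt (u * Complex.I) w = - B := by simp [dt, hB]; ring
  have hB0 : B ≠ 0 := by
    intro h0; rw [hwB, h0] at hw; simp at hw
  set n := Complex.normSq w with hn
  have hn0 : 0 ≤ n := Complex.normSq_nonneg w
  have hBpos : 0 < |B| := abs_pos.2 hB0
  set t : ℝ := min 1 (|B| / (n + 1)) with ht
  have ht0 : 0 < t := lt_min one_pos (by positivity)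
  have ht1 : t ≤ 1 := min_le_left _ _
  have ht2 : t * (n + 1) ≤ |B| := by
    have : t ≤ |B| / (n + 1) := min_le_right _ _
    rwa [le_div_iff₀ (by positivity)] at this
  refine ⟨x + t * w, hr t ht0 ht1, ?_⟩
  have e1 : ∀ σ : ℝ, dist (x + t * w) (x + σ * u) ^ 2 = t ^ 2 * n - 2 * t * σ * B + σ ^ 2 := by
    intro σ
    rw [Complex.dist_eq, ← Complex.normSq_eq_norm_sq, hn, Complex.normSq_apply, Complex.normSq_apply]
    simp
    linear_combination σ ^ 2 * hnu
  rcases lt_or_gt_of_ne hB0 with h1 | h1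
  · right
    apply lt_one_of_sq
    have := e1 (-1)
    rw [show x + ((-1 : ℝ) : ℂ) * u = x - u by push_cast; ring] at this
    rw [this, abs_of_neg h1] at *
    nlinarith
  · left
    apply lt_one_of_sq
    have := e1 1
    rw [show x + ((1 : ℝ) : ℂ) * u = x + u by push_cast; ring] at this
    rw [this]
    rw [abs_of_pos h1] at ht2
    nlinarith

/-- `|x + p - (x+w)|²` -/
theorem dist_sq_inner {p w : ℂ} (hw : ‖w‖ = 1) (x : ℂ) : dist (x + p) (x + w) ^ 2 =
    1 - 2 * (p.re * w.re + p.im * w.im) + (p.re ^ 2 + p.im ^ 2) := by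
  have hnu : w.re ^ 2 + w.im ^ 2 = 1 := by
    have := Complex.normSq_eq_norm_sq w
    rw [hw, Complex.normSq_apply] at this; linarith
  rw [Complex.dist_eq, ← Complex.normSq_eq_norm_sq, Complex.normSq_apply]
  simp
  linear_combination hnu

theorem om3 (w : ℂ) (k : ℕ) : w * om ^ (k + 3) = - (w * om ^ k) := by
  rw [pow_add, om_cube]; ring

theorem om_tri (w : ℂ) (k : ℕ) : w * om ^ k + w * om ^ (k + 2) + w * om ^ (k + 4) = 0 := by
  have h4 : om ^ 4 = - om := by linear_combination om * om_cube
  rw [pow_add, pow_add, h4, om_sq]; ring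

/-- three discs cover a punctured neighbourhood -/
theorem discs_cover {w p : ℂ} (hw : ‖w‖ = 1) (x : ℂ) (k : ℕ) (hp : p ≠ 0) (hp1 : ‖p‖ < 1)
    (h0 : 1 ≤ dist (x + p) (x + w * om ^ k)) (h2 : 1 ≤ dist (x + p) (x + w * om ^ (k + 2)))
    (h4 : 1 ≤ dist (x + p) (x + w * om ^ (k + 4))) : False := by
  have n0 := norm_vom hw k
  set a := w * om ^ k with ha
  have e2 : w * om ^ (k + 2) = a * (om - 1) := by rw [ha, pow_add, om_sq]; ring
  have e4 : w * om ^ (k + 4) = - (a * om) := by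
    rw [ha, pow_add]; linear_combination w * om ^ k * om * om_cube
  have n2 : ‖a * (om - 1)‖ = 1 := by rw [norm_mul, n0, om_sub_norm]; norm_num
  have n4 : ‖-(a * om)‖ = 1 := by rw [norm_neg, norm_mul, n0, om_norm]; norm_num
  rw [e2] at h2
  rw [e4] at h4
  have d0 := dist_sq_inner (p := p) n0 x
  have d2 := dist_sq_inner (p := p) n2 x
  have d4 := dist_sq_inner (p := p) n4 x
  have s0 : 1 ≤ dist (x + p) (x + a) ^ 2 := by nlinarith
  have s2 : 1 ≤ dist (x + p) (x + a * (om - 1)) ^ 2 := by nlinarith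
  have s4 : 1 ≤ dist (x + p) (x + -(a * om)) ^ 2 := by nlinarith
  rw [d0] at s0
  rw [d2] at s2
  rw [d4] at s4
  have han : a.re ^ 2 + a.im ^ 2 = 1 := by
    have := Complex.normSq_eq_norm_sq a
    rw [n0, Complex.normSq_apply] at this; linarith
  have hpn : p.re ^ 2 + p.im ^ 2 < 1 := by
    have := Complex.normSq_eq_norm_sq p
    rw [Complex.normSq_apply] at this; nlinarith [norm_nonneg p]
  have hp0 : 0 < p.re ^ 2 + p.im ^ 2 := by
    have := Complex.normSq_pos.2 hp
    rw [Complex.normSq_apply] at this; linarith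
  have h3 : (√3 : ℝ) ^ 2 = 3 := Real.sq_sqrt (by norm_num)
  simp [om] at s2 s4
  set A := p.re * a.re + p.im * a.im with hA
  set B := p.im * a.re - p.re * a.im with hB
  have hAB : A ^ 2 + B ^ 2 = p.re ^ 2 + p.im ^ 2 := by
    rw [hA, hB]; linear_combination (p.re ^ 2 + p.im ^ 2) * han
  set n := p.re ^ 2 + p.im ^ 2 with hn
  have t0 : 2 * A ≤ n := by linarith
  have t2 : - A + √3 * B ≤ n := by
    rw [hA, hB]; linarith
  have t4 : - A - √3 * B ≤ n := by
    rw [hA, hB]; linarith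
  -- A ≥ -n, |√3 B| ≤ n + A, |A| ≤ n
  have hA1 : -n ≤ A := by linarith
  have hB2 : 3 * B ^ 2 ≤ (n + A) ^ 2 := by
    have : (√3 * B) ^ 2 ≤ (n + A) ^ 2 := by
      apply sq_le_sq' <;> linarith
    rw [mul_pow, h3] at this; exact this
  nlinarith [mul_nonneg (by linarith : 0 ≤ A + n) (by linarith : 0 ≤ n - 2 * A),
    mul_pos hp0 (by linarith : 0 < 1 - n)]

end Hx


open Set Metric Filter Topology

namespace Hx

variable {c : ℂ → Fin 6} {F : Set (Set ℂ)}

theorem hexT_dec : ∀ a0 a1 a2 a3 a4 a5 : Fin 3, a0 ≠ a1 → a1 ≠ a2 → a2 ≠ a3 → a3 ≠ a4 → a4 ≠ a5 →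
    a5 ≠ a0 → a0 ≠ a3 → a1 ≠ a4 → a2 ≠ a5 → (a0 = a2 ∧ a2 = a4) ∨ (a1 = a3 ∧ a3 = a5) := by
  decide

theorem hexT {T : Finset (Fin 6)} (hT : T.card = 3) {s : ℕ → Fin 6} (hs : ∀ k, s k ∈ T)
    (h1 : ∀ k, s k ≠ s (k + 1)) (h5 : s 5 ≠ s 0) (h3 : ∀ k, s k ≠ s (k + 3))
    (he : ∀ k, ¬ (s k = s (k + 2) ∧ s (k + 2) = s (k + 4))) : False := by
  have e := T.equivFinOfCardEq hT
  have hi : ∀ k l, s k ≠ s l → e ⟨s k, hs k⟩ ≠ e ⟨s l, hs l⟩ := by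
    intro k l hkl heq
    exact hkl (congrArg Subtype.val (e.injective heq))
  have hi' : ∀ k l, e ⟨s k, hs k⟩ = e ⟨s l, hs l⟩ → s k = s l := by
    intro k l heq
    exact congrArg Subtype.val (e.injective heq)
  rcases hexT_dec _ _ _ _ _ _ (hi 0 1 (h1 0)) (hi 1 2 (h1 1)) (hi 2 3 (h1 2)) (hi 3 4 (h1 3))
    (hi 4 5 (h1 4)) (hi 5 0 h5) (hi 0 3 (h3 0)) (hi 1 4 (h3 1)) (hi 2 5 (h3 2)) with h | h
  · exact he 0 ⟨hi' _ _ h.1, hi' _ _ h.2⟩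
  · exact he 1 ⟨hi' _ _ h.1, hi' _ _ h.2⟩

theorem in_T {T : Finset (Fin 6)} (hT : T.card = 3) {a b d s : Fin 6} (ha : a ∉ T) (hb : b ∉ T)
    (hd : d ∉ T) (hab : a ≠ b) (had : a ≠ d) (hbd : b ≠ d) (h1 : s ≠ a) (h2 : s ≠ b) (h3 : s ≠ d) :
    s ∈ T := by
  by_contra hs
  have hsub : ({a, b, d, s} : Finset (Fin 6)) ⊆ Tᶜ := by
    intro i hi
    simp only [Finset.mem_insert, Finset.mem_singleton] at hi
    rw [Finset.mem_compl]
    rcases hi with rfl | rfl | rfl | rfl <;> assumption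
  have := Finset.card_le_card hsub
  rw [Finset.card_compl, hT, Fintype.card_fin, Finset.card_insert_of_notMem,
    Finset.card_insert_of_notMem, Finset.card_insert_of_notMem, Finset.card_singleton] at this
  · omega
  · simpa using h3.symm
  · simp only [Finset.mem_insert, Finset.mem_singleton]; tauto
  · simp only [Finset.mem_insert, Finset.mem_singleton]; tauto

theorem s_distinct {s : ℕ → Fin 6} {y : ℕ → ℂ} (hy : y 6 = y 0) (hs : ∀ k, s k ∈ CC c F (y k))
    (hs' : ∀ k, s k ∉ CC c F (y (k + 1))) : (∀ k, s k ≠ s (k + 1)) ∧ s 5 ≠ s 0 := by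
  refine ⟨fun k hk => hs' k (hk ▸ hs (k + 1)), fun hk => hs' 5 ?_⟩
  show s 5 ∈ CC c F (y 6)
  rw [hy, hk]; exact hs 0

section
variable {x v v' w : ℂ} {g : ℕ → Fin 6}

theorem no_fwd (h : Col c F) (hx : (CC c F x).card = 3) (hw : ‖w‖ = 1)
    (s1 : ∀ k : ℕ, Sub c F (x + v * om ^ k) (x + w * om ^ k))
    (s2 : ∀ k : ℕ, Sub c F (x + v' * om ^ k) (x + w * om ^ k))
    (hd : dist v' (v * om) < 1) (hgx : ∀ k, g k ∉ CC c F x) (hg3 : ∀ k, g (k + 3) = g k)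
    (hne : ∀ k, g k ≠ g (k + 1))
    (c1 : ∀ k, c (x + v * om ^ k) = g k) (c2 : ∀ k, c (x + v' * om ^ k) = g (k + 1)) : False := by
  have hy1 : ∀ k, x + w * om ^ (k + 1) = x + w * om ^ k * om := fun k => by ring
  have hnr : ∀ k, Nr c F (g (k + 1)) (x + w * om ^ k) (x + w * om ^ (k + 1)) := by
    intro k
    obtain ⟨P, hP⟩ := exists_at h (x + v' * om ^ k)
    obtain ⟨Q, hQ⟩ := exists_at h (x + v * om ^ (k + 1))
    have hP2 := s2 k _ _ hP
    have hQ2 := s1 (k + 1) _ _ hQ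
    rw [c2] at hP2
    rw [c1] at hQ2
    refine nr_of_lt h hP2 hQ2 hP.2.1 hQ.2.1 ?_
    have : x + v' * om ^ k - (x + v * om ^ (k + 1)) = (v' - v * om) * om ^ k := by ring
    rw [Complex.dist_eq, this, norm_mul, norm_pow, om_norm, one_pow, mul_one, ← Complex.dist_eq]
    exact hd
  have hm1 : ∀ k, g k ∈ CC c F (x + w * om ^ k) := fun k => c1 k ▸ (s1 k).cmem h
  have hm2 : ∀ k, g (k + 1) ∈ CC c F (x + w * om ^ k) := fun k => c2 k ▸ (s2 k).cmem h
  have key : ∀ k, ∃ s ∈ CC c F x, s ∈ CC c F (x + w * om ^ k) ∧ s ∉ CC c F (x + w * om ^ (k + 1)) ∧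
      Fa c F s (x + w * om ^ k) x := by
    intro k
    have hwk := norm_vom hw k
    have hz5 : dist (x + w * om ^ k) (x + w * om ^ k * om ^ 5) = 1 := by
      have := dist_hex (x := x) (norm_vom hwk 5)
      rw [mul_assoc (w * om ^ k) (om ^ 5) om, ← pow_succ, om_six, mul_one] at this
      rw [dist_comm]; exact this
    obtain ⟨ε, hε, hl⟩ := loc h (x + w * om ^ k)
    have h3 := sqrt3_pos
    obtain ⟨s, hs, hs1, hs2, hs3, hs4⟩ := arc_pos h (dist_hex (x := x) hwk) hε
      (p := fun s => 1 < dist s x ∧ 1 < dist s (x + w * om ^ k * om ^ 5))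
      ((neg_out (dist_cen hwk) (by rw [orn_hex hwk]; linarith)).and
        (neg_out hz5 (by rw [orn_hex' hwk]; linarith)))
    obtain ⟨P, hP, hsP⟩ := gn_near h hl hs hs2
    have hn := gn_not_mem h hs hs1
    rw [← hy1] at hn
    have n1 : c s ≠ g (k + 1) := fun q => hn (q ▸ hm1 (k + 1))
    have n2 : c s ≠ g (k + 1 + 1) := fun q => hn (q ▸ hm2 (k + 1))
    have n0 : c s ≠ g k := by
      intro q
      have e5 : x + w * om ^ k * om ^ 5 = x + w * om ^ (k + 5) := by ring
      have e6 : x + w * om ^ (k + 5 + 1) = x + w * om ^ k := by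
        rw [show k + 5 + 1 = k + 6 by ring, pow_add, om_six, mul_one]
      have hn5 := hnr (k + 5)
      rw [e6, show k + 5 + 1 = k + 3 + 3 by ring, hg3, hg3] at hn5
      have hm5 := hm2 (k + 5)
      rw [show k + 5 + 1 = k + 3 + 3 by ring, hg3, hg3] at hm5
      obtain ⟨Q, hQ⟩ := mem_CC.1 hm5
      rw [q] at hP
      have := hn5 Q P hQ hP _ hQ.2.1 s (subset_closure hsP)
      rw [e5, dist_comm] at hs4
      linarith
    have hT : c s ∈ CC c F x := in_T hx (hgx k) (hgx (k + 1)) (hgx (k + 1 + 1)) (hne k)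
      (by have := hne (k + 1 + 1); rw [show k + 1 + 1 + 1 = k + 3 by ring, hg3] at this
          exact this.symm) (hne (k + 1)) n0 n1 n2
    refine ⟨c s, hT, hP.mem, hn, ?_⟩
    obtain ⟨Q, hQ⟩ := mem_CC.1 hT
    exact fa_of_gt h hP hQ (subset_closure hsP) hQ.2.1 hs3
  choose s hsT hsy hsy' hsF using key
  have hsd := s_distinct (s := s) (y := fun k => x + w * om ^ k) (by simp [om_six]) hsy hsy'
  have far : ∀ k, ∀ Q, At c F x (s k) Q → ∀ q ∈ Q, 1 < dist q (x + w * om ^ k) := by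
    intro k Q hQ q hq
    obtain ⟨P, hP⟩ := mem_CC.1 (hsy k)
    exact ((hsF k P Q hP hQ).symm).gt (h.opn Q hQ.1) hq hP.2.1
  refine hexT hx hsT hsd.1 hsd.2 ?_ ?_
  · intro k hk
    obtain ⟨Q, hQ⟩ := mem_CC.1 (hsT k)
    obtain ⟨q, hq, hq1⟩ := cusp h hQ.1 hQ.2.1 (norm_vom hw k)
    have f1 := far k Q hQ q hq
    have f2 := far (k + 3) Q (hk ▸ hQ) q hq
    rw [om3, ← sub_eq_add_neg] at f2
    rcases hq1 with h1 | h1 <;> linarith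
  · rintro k ⟨hk1, hk2⟩
    obtain ⟨Q, hQ⟩ := mem_CC.1 (hsT k)
    obtain ⟨q, hqb, hq⟩ := mem_closure_iff.1 hQ.2.1 (ball x 1) isOpen_ball (mem_ball_self one_pos)
    obtain ⟨ε, hε, hb⟩ := Metric.isOpen_iff.1 ((h.opn Q hQ.1).inter isOpen_ball) q ⟨hq, hqb⟩
    obtain ⟨q', hq', hne⟩ : ∃ q' ∈ Q ∩ ball x 1, q' ≠ x := by
      by_cases hqx : q = x
      · refine ⟨q + (ε / 2 : ℝ), hb ?_, ?_⟩
        · rw [mem_ball, Complex.dist_eq, add_sub_cancel_left, Complex.norm_real,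
            Real.norm_of_nonneg (by positivity)]; linarith
        · rw [hqx]; intro h0
          have : ((ε / 2 : ℝ) : ℂ) = 0 := by linear_combination h0
          have : ε / 2 = 0 := by exact_mod_cast this
          linarith
      · exact ⟨q, ⟨hq, hqb⟩, hqx⟩
    have ex : q' = x + (q' - x) := by ring
    have f0 := far k Q hQ q' hq'.1
    have f2 := far (k + 2) Q (hk1 ▸ hQ) q' hq'.1
    have f4 := far (k + 4) Q (hk2 ▸ hk1 ▸ hQ) q' hq'.1
    rw [ex] at f0 f2 f4
    refine discs_cover hw x k (sub_ne_zero.2 hne) ?_ f0.le f2.le f4.le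
    rw [← Complex.dist_eq]; exact hq'.2

theorem no_back (h : Col c F) (hx : (CC c F x).card = 3) (hw : ‖w‖ = 1)
    (s1 : ∀ k : ℕ, Sub c F (x + v * om ^ k) (x + w * om ^ k))
    (s2 : ∀ k : ℕ, Sub c F (x + v' * om ^ k) (x + w * om ^ k))
    (hd : 1 < dist v (v' * om)) (hgx : ∀ k, g k ∉ CC c F x) (hg3 : ∀ k, g (k + 3) = g k)
    (hne : ∀ k, g k ≠ g (k + 1))
    (c1 : ∀ k, c (x + v * om ^ k) = g k) (c2 : ∀ k, c (x + v' * om ^ k) = g (k + 2)) : False := by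
  have hy1 : ∀ k, x + w * om ^ (k + 1) = x + w * om ^ k * om := fun k => by ring
  have hfa : ∀ k, Fa c F (g k) (x + w * om ^ k) (x + w * om ^ (k + 1)) := by
    intro k
    obtain ⟨P, hP⟩ := exists_at h (x + v * om ^ k)
    obtain ⟨Q, hQ⟩ := exists_at h (x + v' * om ^ (k + 1))
    have hP2 := s1 k _ _ hP
    have hQ2 := s2 (k + 1) _ _ hQ
    rw [c1] at hP2
    rw [c2, show k + 1 + 2 = k + 3 by ring, hg3] at hQ2
    refine fa_of_gt h hP2 hQ2 hP.2.1 hQ.2.1 ?_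
    have : x + v * om ^ k - (x + v' * om ^ (k + 1)) = (v - v' * om) * om ^ k := by ring
    rw [Complex.dist_eq, this, norm_mul, norm_pow, om_norm, one_pow, mul_one, ← Complex.dist_eq]
    exact hd
  have hm1 : ∀ k, g k ∈ CC c F (x + w * om ^ k) := fun k => c1 k ▸ (s1 k).cmem h
  have hm2 : ∀ k, g (k + 2) ∈ CC c F (x + w * om ^ k) := fun k => c2 k ▸ (s2 k).cmem h
  have key : ∀ k, ∃ s ∈ CC c F x, s ∈ CC c F (x + w * om ^ k) ∧ s ∉ CC c F (x + w * om ^ (k + 1)) ∧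
      Nr c F s (x + w * om ^ k) x := by
    intro k
    have hwk := norm_vom hw k
    have hz5 : dist (x + w * om ^ k) (x + w * om ^ k * om ^ 5) = 1 := by
      have := dist_hex (x := x) (norm_vom hwk 5)
      rw [mul_assoc (w * om ^ k) (om ^ 5) om, ← pow_succ, om_six, mul_one] at this
      rw [dist_comm]; exact this
    obtain ⟨ε, hε, hl⟩ := loc h (x + w * om ^ k)
    have h3 := sqrt3_pos
    obtain ⟨s, hs, hs1, hs2, hs3, hs4⟩ := arc_neg h (dist_hex (x := x) hwk) hε
      (p := fun s => dist s x < 1 ∧ dist s (x + w * om ^ k * om ^ 5) < 1)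
      ((neg_in (dist_cen hwk) (by rw [orn_hex hwk]; linarith)).and
        (neg_in hz5 (by rw [orn_hex' hwk]; linarith)))
    obtain ⟨P, hP, hsP⟩ := gn_near h hl hs hs2
    have hn := gn_not_mem h hs hs1
    rw [← hy1] at hn
    have n1 : c s ≠ g (k + 1) := fun q => hn (q ▸ hm1 (k + 1))
    have n0 : c s ≠ g k := by
      intro q
      have := hm2 (k + 1)
      rw [show k + 1 + 2 = k + 3 by ring, hg3] at this
      exact hn (q ▸ this)
    have n2 : c s ≠ g (k + 1 + 1) := by
      intro q
      have e5 : x + w * om ^ k * om ^ 5 = x + w * om ^ (k + 5) := by ring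
      have e6 : x + w * om ^ (k + 5 + 1) = x + w * om ^ k := by
        rw [show k + 5 + 1 = k + 6 by ring, pow_add, om_six, mul_one]
      have hn5 := hfa (k + 5)
      rw [e6, show k + 5 = k + 2 + 3 by ring, hg3] at hn5
      have hm5 := hm1 (k + 5)
      rw [show k + 5 = k + 2 + 3 by ring, hg3] at hm5
      obtain ⟨Q, hQ⟩ := mem_CC.1 hm5
      rw [q] at hP
      have := hn5 Q P hQ hP _ hQ.2.1 s (subset_closure hsP)
      rw [e5, dist_comm, show k + 5 = k + 2 + 3 by ring] at hs4
      linarith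
    have hT : c s ∈ CC c F x := in_T hx (hgx k) (hgx (k + 1)) (hgx (k + 1 + 1)) (hne k)
      (by have := hne (k + 1 + 1); rw [show k + 1 + 1 + 1 = k + 3 by ring, hg3] at this
          exact this.symm) (hne (k + 1)) n0 n1 n2
    refine ⟨c s, hT, hP.mem, hn, ?_⟩
    obtain ⟨Q, hQ⟩ := mem_CC.1 hT
    exact nr_of_lt h hP hQ (subset_closure hsP) hQ.2.1 hs3
  choose s hsT hsy hsy' hsF using key
  have hsd := s_distinct (s := s) (y := fun k => x + w * om ^ k) (by simp [om_six]) hsy hsy'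
  have near : ∀ k, ∀ Q, At c F x (s k) Q → ∀ q ∈ Q, 0 < q.re * (w * om ^ k).re + q.im * (w * om ^ k).im -
      (x.re * (w * om ^ k).re + x.im * (w * om ^ k).im) := by
    intro k Q hQ q hq
    obtain ⟨P, hP⟩ := mem_CC.1 (hsy k)
    have h1 := ((hsF k P Q hP hQ).symm).lt (h.opn Q hQ.1) hq hP.2.1
    have h2 := dist_sq_inner (p := q - x) (norm_vom hw k) x
    rw [show x + (q - x) = q by ring] at h2
    have h3 : dist q (x + w * om ^ k) ^ 2 < 1 := by
      have := dist_nonneg (x := q) (y := x + w * om ^ k); nlinarith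
    rw [h2, Complex.sub_re, Complex.sub_im] at h3
    nlinarith [sq_nonneg (q.re - x.re), sq_nonneg (q.im - x.im)]
  refine hexT hx hsT hsd.1 hsd.2 ?_ ?_
  · intro k hk
    obtain ⟨Q, hQ⟩ := mem_CC.1 (hsT k)
    obtain ⟨q, hq⟩ := h.ne Q hQ.1
    have f1 := near k Q hQ q hq
    have f2 := near (k + 3) Q (hk ▸ hQ) q hq
    rw [om3, Complex.neg_re, Complex.neg_im] at f2
    linarith
  · rintro k ⟨hk1, hk2⟩
    obtain ⟨Q, hQ⟩ := mem_CC.1 (hsT k)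
    obtain ⟨q, hq⟩ := h.ne Q hQ.1
    have f0 := near k Q hQ q hq
    have f2 := near (k + 2) Q (hk1 ▸ hQ) q hq
    have f4 := near (k + 4) Q (hk2 ▸ hk1 ▸ hQ) q hq
    have e := om_tri w k
    have er := congrArg Complex.re e
    have ei := congrArg Complex.im e
    simp only [Complex.add_re, Complex.add_im, Complex.zero_re, Complex.zero_im] at er ei
    have t1 : (q.re - x.re) * ((w * om ^ k).re + (w * om ^ (k + 2)).re + (w * om ^ (k + 4)).re) = 0 := by
      rw [er, mul_zero]
    have t2 : (q.im - x.im) * ((w * om ^ k).im + (w * om ^ (k + 2)).im + (w * om ^ (k + 4)).im) = 0 := by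
      rw [ei, mul_zero]
    linarith
end

/-- sample points -/
noncomputable def pt (x : ℂ) (θ : ℝ) : ℂ := x + Complex.exp (θ * Complex.I)

theorem om_exp : Complex.exp ((Real.pi / 3 : ℝ) * Complex.I) = om := by
  rw [Complex.exp_mul_I, ← Complex.ofReal_cos, ← Complex.ofReal_sin, Real.cos_pi_div_three,
    Real.sin_pi_div_three]
  apply Complex.ext <;> simp [om]

theorem pt_rot (x : ℂ) (θ : ℝ) (k : ℕ) :
    pt x (θ + k * (Real.pi / 3)) = x + Complex.exp (θ * Complex.I) * om ^ k := by
  rw [pt, ← om_exp, ← Complex.exp_nat_mul, ← Complex.exp_add]; congr 2; push_cast; ring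

theorem dist_exp (a b : ℝ) : dist (Complex.exp (a * Complex.I)) (Complex.exp (b * Complex.I)) ^ 2 =
    2 - 2 * Real.cos (a - b) := by
  rw [Complex.dist_eq, ← Complex.normSq_eq_norm_sq, Complex.normSq_apply, Real.cos_sub]
  simp only [Complex.sub_re, Complex.sub_im, Complex.exp_ofReal_mul_I_re, Complex.exp_ofReal_mul_I_im]
  nlinarith [Real.sin_sq_add_cos_sq a, Real.sin_sq_add_cos_sq b]

theorem dist_exp_le (a b : ℝ) : dist (Complex.exp (a * Complex.I)) (Complex.exp (b * Complex.I)) ≤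
    |a - b| := by
  have h1 := dist_exp a b
  have h2 := Real.one_sub_sq_div_two_le_cos (x := a - b)
  refine abs_le_of_sq_le_sq' ?_ (abs_nonneg _) |>.2
  rw [sq_abs]; linarith


theorem pt_cen (x : ℂ) (θ : ℝ) : dist (pt x θ) x = 1 := dist_cen (expI_norm θ)

theorem mul_om_exp (θ : ℝ) : Complex.exp (θ * Complex.I) * om =
    Complex.exp ((θ + Real.pi / 3 : ℝ) * Complex.I) := by
  rw [← om_exp, ← Complex.exp_add]; congr 1; push_cast; ring

/-- color code -/
theorem code {T : Finset (Fin 6)} (hT : T.card = 3) : ∃ e : Fin 6 → ZMod 3,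
    ∀ i j, i ∉ T → j ∉ T → e i = e j → i = j := by
  have hc : (Tᶜ).card = 3 := by rw [Finset.card_compl, hT]; rfl
  have E : {i // i ∈ Tᶜ} ≃ ZMod 3 := (Tᶜ).equivFinOfCardEq hc
  refine ⟨fun i => if h : i ∈ Tᶜ then E ⟨i, h⟩ else 0, fun i j hi hj hij => ?_⟩
  rw [← Finset.mem_compl] at hi hj
  simp only [hi, hj, dif_pos] at hij
  exact congrArg Subtype.val (E.injective hij)

theorem E2 (h : Col c F) {x : ℂ} (hx : (CC c F x).card = 3) : ∃ N0 : ℕ, ∀ N ≥ N0, 0 < N → ∀ α : ℝ,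
    (∀ i : ℕ, Gn F (pt x (α + i * (Real.pi / (3 * N))))) → ∀ a b, a ∉ CC c F x → b ∉ CC c F x → a ≠ b →
    ∑ i ∈ Finset.range (6 * N),
      I2 ((c (pt x (α + i * (Real.pi / (3 * N)))) = a ∧
            c (pt x (α + (i + 1 : ℕ) * (Real.pi / (3 * N)))) = b) ∨
          (c (pt x (α + i * (Real.pi / (3 * N)))) = b ∧
            c (pt x (α + (i + 1 : ℕ) * (Real.pi / (3 * N)))) = a)) = 1 := by
  obtain ⟨η, hη, hl⟩ := leb_circle h x
  obtain ⟨e, he⟩ := code hx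
  obtain ⟨N0, hN0⟩ := exists_nat_gt (Real.pi / η)
  refine ⟨N0 + 2, fun N hN hNp α hgn a b ha hb hab => ?_⟩
  have hpi := Real.pi_pos
  have hNr : (0 : ℝ) < N := by exact_mod_cast hNp
  have hN2 : (2 : ℝ) ≤ N := by exact_mod_cast (by omega : 2 ≤ N)
  set D := Real.pi / (3 * N) with hD
  have hD0 : 0 < D := by positivity
  have hDN : N * D = Real.pi / 3 := by rw [hD]; field_simp
  have hD3 : D < Real.pi / 3 := by nlinarith
  have hDη : D < η := by
    rw [hD, div_lt_iff₀ (by positivity)]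
    rw [div_lt_iff₀ hη] at hN0
    have : (N0 : ℝ) ≤ N := by exact_mod_cast (by omega : N0 ≤ N)
    nlinarith
  set f : ℕ → Fin 6 := fun i => c (pt x (α + i * D)) with hf
  have hfT : ∀ i, f i ∉ CC c F x := fun i => gn_not_mem h (hgn i) (pt_cen _ _)
  set V : ℕ → ℂ := fun i => Complex.exp ((α + i * D : ℝ) * Complex.I) with hV
  have hVn : ∀ i, ‖V i‖ = 1 := fun i => expI_norm _
  have hrot : ∀ i k : ℕ, pt x (α + (i + k * N : ℕ) * D) = x + V i * om ^ k := by
    intro i k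
    rw [← pt_rot]; congr 1; push_cast; linear_combination (k : ℝ) * hDN
  have hfV : ∀ i k, f (i + k * N) = c (x + V i * om ^ k) := by
    intro i k; simp only [hf]; rw [hrot]
  have hVd : ∀ i, dist (V (i + 1)) (V i) < η := by
    intro i
    refine lt_of_le_of_lt (dist_exp_le _ _) ?_
    have : α + (i + 1 : ℕ) * D - (α + i * D) = D := by push_cast; ring
    rw [this, abs_of_pos hD0]; exact hDη
  have inj : ∀ i j, e (f i) = e (f j) → f i = f j := fun i j hij => he _ _ (hfT i) (hfT j) hij
  have three : (3 : ZMod 3) = 0 := by decide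
  have cyc : Cyc (fun i => e (f i)) N := by
    refine ⟨hNp, ?_, ?_, ?_, ?_, ?_⟩
    · intro i
      show e (f (i + 6 * N)) = e (f i)
      rw [hfV i 6, om_six, ← pow_zero om, ← hfV i 0]; simp
    · intro i hi
      have := inj _ _ hi
      have h2 := rot_color h (z := x) (hVn i) 0
      rw [← hfV, ← hfV] at h2
      simp only [zero_mul, add_zero, zero_add, one_mul] at h2
      exact h2 this
    · rintro i ⟨h1, h2, h3⟩
      obtain ⟨w, hw, hs⟩ := hl (V i) (hVn i)
      have e0 := hfV i 0
      have e1 := hfV i 1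
      have e2 := hfV (i + 1) 0
      have e3 := hfV (i + 1) 1
      have g0 := hgn i
      have g1 := hgn (i + 1)
      have r0 := hrot i 0
      have r1 := hrot (i + 1) 0
      simp only [zero_mul, add_zero, one_mul, pow_zero, mul_one, pow_one] at e0 e1 e2 e3 r0 r1
      rw [r0] at g0
      rw [r1] at g1
      refine no_swap h hx (hVn i) (hVn (i + 1)) hw (hs _ (by simpa using hη)) (hs _ (hVd i))
        g0 g1 ?_ ?_ ?_
      · rw [← e0, ← e2]; intro h4; exact h1 (by rw [h4])
      · rw [← e1, ← e2]; exact inj _ _ h2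
      · rw [← e3, ← e0]; exact inj _ _ h3
    · intro i s hs hi hh
      obtain ⟨w, hw, hsub⟩ := hl (V i) (hVn i)
      refine no_fwd h hx (v := V i) (v' := V (i + 1)) (g := fun k => f (i + k * N)) hw
        (hsub _ (by simpa using hη)) (hsub _ (hVd i)) ?_ (fun k => hfT _) ?_ ?_ ?_ ?_
      · apply lt_one_of_sq
        simp only [hV]
        rw [mul_om_exp, dist_exp]
        have e1 : α + (i + 1 : ℕ) * D - (α + i * D + Real.pi / 3) = - (Real.pi / 3 - D) := by
          push_cast; ring
        rw [e1, Real.cos_neg]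
        have := Real.cos_lt_cos_of_nonneg_of_le_pi (x := Real.pi / 3 - D) (y := Real.pi / 3)
          (by linarith) (by linarith) (by linarith)
        rw [Real.cos_pi_div_three] at this
        linarith
      · intro k
        apply inj
        rw [hi, hi]; push_cast; linear_combination s * three
      · intro k hk
        have : e (f (i + k * N)) = e (f (i + (k + 1) * N)) := congrArg e hk
        rw [hi, hi] at this
        push_cast at this
        exact hs (by linear_combination - this)
      · intro k; rw [← hfV]
      · intro k
        rw [← hfV]
        apply inj
        rw [hh, hi]; push_cast; ring
    · intro i s hs hi hh
      obtain ⟨w, hw, hsub⟩ := hl (V i) (hVn i)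
      refine no_back h hx (v := V i) (v' := V (i + 1)) (g := fun k => f (i + k * N)) hw
        (hsub _ (by simpa using hη)) (hsub _ (hVd i)) ?_ (fun k => hfT _) ?_ ?_ ?_ ?_
      · apply gt_one_of_sq dist_nonneg
        simp only [hV]
        rw [mul_om_exp, dist_exp]
        have e1 : α + i * D - (α + (i + 1 : ℕ) * D + Real.pi / 3) = - (Real.pi / 3 + D) := by
          push_cast; ring
        rw [e1, Real.cos_neg]
        have := Real.cos_lt_cos_of_nonneg_of_le_pi (x := Real.pi / 3) (y := Real.pi / 3 + D)
          (by linarith) (by linarith) (by linarith)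
        rw [Real.cos_pi_div_three] at this
        linarith
      · intro k
        apply inj
        rw [hi, hi]; push_cast; linear_combination s * three
      · intro k hk
        have : e (f (i + k * N)) = e (f (i + (k + 1) * N)) := congrArg e hk
        rw [hi, hi] at this
        push_cast at this
        exact hs (by linear_combination - this)
      · intro k; rw [← hfV]
      · intro k
        rw [← hfV]
        apply inj
        rw [hh, hi]; push_cast; ring
  have hJ := cyc.J_pair (a := e a) (b := e b) (fun q => hab (he _ _ ha hb q))
  rw [← hJ]
  refine Finset.sum_congr rfl fun i _ => ?_
  have iff : ∀ i d, d ∉ CC c F x → (f i = d ↔ e (f i) = e d) := fun i d hd =>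
    ⟨fun q => by rw [q], fun q => he _ _ (hfT i) hd q⟩
  have e1 := iff i a ha
  have e2 := iff i b hb
  have e3 := iff (i + 1) a ha
  have e4 := iff (i + 1) b hb
  simp only [hf] at e1 e2 e3 e4 ⊢
  rw [e1, e2, e3, e4]
  unfold I2
  congr

end Hx


open Set Metric Filter Topology

namespace Hx

abbrev L := ℤ × ℤ

noncomputable def bx (M : ℕ) : Finset L := Finset.Icc (-(M : ℤ)) M ×ˢ Finset.Icc (-(M : ℤ)) M

/-- inner box -/
def inb (M : ℕ) (q : L) : Prop := |q.1| + 2 ≤ M ∧ |q.2| + 2 ≤ M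

def adj (u v : L) : Prop := |u.1 - v.1| ≤ 1 ∧ |u.2 - v.2| ≤ 1

theorem adj_comm {u v : L} : adj u v ↔ adj v u := by
  unfold adj; rw [abs_sub_comm, abs_sub_comm u.2]

theorem adj.symm {u v : L} (h : adj u v) : adj v u := adj_comm.1 h

theorem adj_refl (u : L) : adj u u := by simp [adj]

def sy (G : L → L → L → ZMod 2) (u v w : L) : ZMod 2 :=
  G u v w + G u w v + G v u w + G v w u + G w u v + G w v u

noncomputable def Tg (M : ℕ) (G : L → L → L → ZMod 2) : ZMod 2 :=
  ∑ q ∈ bx M, (sy G q (q + (1, 0)) (q + (1, 1)) + sy G q (q + (0, 1)) (q + (1, 1)))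

theorem mem_bx {M : ℕ} {q : L} : q ∈ bx M ↔ |q.1| ≤ M ∧ |q.2| ≤ M := by
  simp only [bx, Finset.mem_product, Finset.mem_Icc, abs_le]

theorem shift {M : ℕ} {φ : L → ZMod 2} (h : ∀ q, φ q ≠ 0 → |q.1| + 1 ≤ M ∧ |q.2| + 1 ≤ M) (e : L)
    (he : adj e 0) : ∑ q ∈ bx M, φ (q + e) = ∑ q ∈ bx M, φ q := by
  have h1 : ∑ᶠ q, φ q = ∑ q ∈ bx M, φ q := by
    apply finsum_eq_sum_of_support_subset
    intro q hq
    have := h q hq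
    simp only [Finset.mem_coe, mem_bx]; omega
  have h2 : ∑ᶠ q, φ (q + e) = ∑ q ∈ bx M, φ (q + e) := by
    apply finsum_eq_sum_of_support_subset
    intro q hq
    have := h (q + e) hq
    simp only [adj, Prod.fst_zero, Prod.snd_zero, sub_zero, Prod.fst_add, Prod.snd_add, abs_le] at *
    simp only [Finset.mem_coe, mem_bx, abs_le]
    have a1 := abs_le.1 (show |q.1 + e.1| ≤ M - 1 by omega)
    have a2 := abs_le.1 (show |q.2 + e.2| ≤ M - 1 by omega)
    omega
  rw [← h1, ← h2]
  exact finsum_comp_equiv (Equiv.addRight e) (f := φ)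

variable {M : ℕ} {G G' : L → L → L → ZMod 2}

theorem adj_tri (q : L) : (adj q (q + (1, 0)) ∧ adj q (q + (1, 1)) ∧ adj (q + (1, 0)) (q + (1, 1))) ∧
    (adj q (q + (0, 1)) ∧ adj q (q + (1, 1)) ∧ adj (q + (0, 1)) (q + (1, 1))) := by
  simp [adj]

theorem sy_congr {u v w : L} (h1 : adj u v) (h2 : adj u w) (h3 : adj v w)
    (h : ∀ u v w, adj u v → adj u w → adj v w → G u v w = G' u v w) : sy G u v w = sy G' u v w := by
  unfold sy
  rw [h u v w h1 h2 h3, h u w v h2 h1 h3.symm, h v u w h1.symm h3 h2, h v w u h3 h1.symm h2.symm,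
    h w u v h2.symm h3.symm h1, h w v u h3.symm h2.symm h1.symm]

theorem T_congr (h : ∀ u v w, adj u v → adj u w → adj v w → G u v w = G' u v w) :
    Tg M G = Tg M G' := by
  unfold Tg
  refine Finset.sum_congr rfl fun q _ => ?_
  obtain ⟨⟨a1, a2, a3⟩, b1, b2, b3⟩ := adj_tri q
  rw [sy_congr a1 a2 a3 h, sy_congr b1 b2 b3 h]

theorem T_add : Tg M (fun u v w => G u v w + G' u v w) = Tg M G + Tg M G' := by
  unfold Tg
  rw [← Finset.sum_add_distrib]
  refine Finset.sum_congr rfl fun q _ => ?_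
  unfold sy; ring

theorem T_zero : Tg M (fun _ _ _ => 0) = 0 := by simp [Tg, sy]

theorem T_sum {ι : Type*} (s : Finset ι) (G : ι → L → L → L → ZMod 2) :
    Tg M (fun u v w => ∑ i ∈ s, G i u v w) = ∑ i ∈ s, Tg M (G i) := by
  classical
  induction s using Finset.induction_on with
  | empty => simpa using T_zero
  | insert i s hi ih =>
    simp only [Finset.sum_insert hi]
    rw [T_add, ih]

theorem T_swap12 : Tg M (fun u v w => G v u w) = Tg M G := by
  unfold Tg
  refine Finset.sum_congr rfl fun q _ => ?_
  unfold sy; ring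

theorem T_swap23 : Tg M (fun u v w => G u w v) = Tg M G := by
  unfold Tg
  refine Finset.sum_congr rfl fun q _ => ?_
  unfold sy; ring

theorem T_swap13 : Tg M (fun u v w => G w v u) = Tg M G := by
  unfold Tg
  refine Finset.sum_congr rfl fun q _ => ?_
  unfold sy; ring

theorem sy_sym0 {u v w : L} (h1 : adj u v) (h2 : adj u w) (h3 : adj v w)
    (h : ∀ u v w, adj u v → adj u w → adj v w → G u v w = G w v u) : sy G u v w = 0 := by
  unfold sy
  rw [h u v w h1 h2 h3, h u w v h2 h1 h3.symm, h v u w h1.symm h3 h2]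
  linear_combination (G w v u + G v w u + G w u v) * z2_two

theorem T_sym0 (h : ∀ u v w, adj u v → adj u w → adj v w → G u v w = G w v u) : Tg M G = 0 := by
  unfold Tg
  refine Finset.sum_eq_zero fun q _ => ?_
  obtain ⟨⟨a1, a2, a3⟩, b1, b2, b3⟩ := adj_tri q
  rw [sy_sym0 a1 a2 a3 h, sy_sym0 b1 b2 b3 h, add_zero]

theorem T_ne (h : Tg M G ≠ 0) : ∃ u v w, adj u v ∧ adj u w ∧ adj v w ∧ G u v w ≠ 0 := by
  by_contra hc
  push Not at hc
  apply h
  rw [T_congr (G' := fun _ _ _ => 0) hc, T_zero]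

theorem T_stokes {E : L → L → ZMod 2} (h : ∀ u v, adj u v → E u v ≠ 0 → inb M u) :
    Tg M (fun u v _ => E u v) = 0 := by
  have hS : ∀ e : L, adj e 0 → ∀ q : L, E q (q + e) + E (q + e) q ≠ 0 → |q.1| + 1 ≤ M ∧ |q.2| + 1 ≤ M := by
    intro e he q hq
    have ha : adj q (q + e) := by
      simp only [adj, Prod.fst_zero, Prod.snd_zero, sub_zero, Prod.fst_add, Prod.snd_add] at *
      rw [show q.1 - (q.1 + e.1) = - e.1 by ring, show q.2 - (q.2 + e.2) = - e.2 by ring, abs_neg,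
        abs_neg]
      exact he
    by_cases h1 : E q (q + e) = 0
    · have h2 : E (q + e) q ≠ 0 := by intro h2; rw [h1, h2] at hq; simp at hq
      have := h _ _ ha.symm h2
      simp only [adj, inb, Prod.fst_zero, Prod.snd_zero, sub_zero, Prod.fst_add, Prod.snd_add] at *
      have a1 := abs_le.1 (show |q.1 + e.1| ≤ M - 2 by omega)
      have a2 := abs_le.1 (show |q.2 + e.2| ≤ M - 2 by omega)
      have b1 := abs_le.1 he.1
      have b2 := abs_le.1 he.2
      have c1 : |q.1| ≤ M - 1 := abs_le.2 (by omega)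
      have c2 : |q.2| ≤ M - 1 := abs_le.2 (by omega)
      omega
    · have := h _ _ ha h1
      unfold inb at this; omega
  have s1 := shift (M := M) (φ := fun q => E q (q + (0, 1)) + E (q + (0, 1)) q)
    (hS (0, 1) (by simp [adj])) (1, 0) (by simp [adj])
  have s2 := shift (M := M) (φ := fun q => E q (q + (1, 0)) + E (q + (1, 0)) q)
    (hS (1, 0) (by simp [adj])) (0, 1) (by simp [adj])
  have e1 : ∀ q : L, q + (1, 0) + (0, 1) = q + (1, 1) := fun q => by simp [add_assoc]
  have e2 : ∀ q : L, q + (0, 1) + (1, 0) = q + (1, 1) := fun q => by simp [add_assoc]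
  simp only [e1, e2] at s1 s2
  have : Tg M (fun u v _ => E u v) =
      (∑ q ∈ bx M, (E (q + (1, 0)) (q + (1, 1)) + E (q + (1, 1)) (q + (1, 0))) +
        ∑ q ∈ bx M, (E q (q + (0, 1)) + E (q + (0, 1)) q)) +
      (∑ q ∈ bx M, (E (q + (0, 1)) (q + (1, 1)) + E (q + (1, 1)) (q + (0, 1))) +
        ∑ q ∈ bx M, (E q (q + (1, 0)) + E (q + (1, 0)) q)) := by
    unfold Tg
    rw [← Finset.sum_add_distrib, ← Finset.sum_add_distrib, ← Finset.sum_add_distrib]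
    refine Finset.sum_congr rfl fun q _ => ?_
    unfold sy
    linear_combination (E q (q + (1, 1)) + E (q + (1, 1)) q) * z2_two
  rw [this, s1, s2, z2_add_self, z2_add_self, add_zero]

theorem I2_and {p q : Prop} : I2 (p ∧ q) = I2 p * I2 q := by
  by_cases hp : p <;> by_cases hq : q <;> simp [I2, hp, hq]

theorem I2_xor {p q r : Prop} : I2 (p ∧ r) + I2 (q ∧ r) = I2 (¬ (p ↔ q) ∧ r) := by
  by_cases hp : p <;> by_cases hq : q <;> by_cases hr : r <;> simp [I2, hp, hq, hr, z2_add_self]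

/-- HSK -/
theorem HSK {κ : L → Fin 6} {i j : Fin 6} (hij : i ≠ j) {E : L → L → Prop}
    (hE : ∀ u v, adj u v → E u v → inb M u ∧ κ u = i ∧ κ v = j)
    (h1 : ∀ u v w, adj u v → adj u w → adj v w → E u v → κ w = i → E w v)
    (h2 : ∀ u v w, adj u v → adj u w → adj v w → E u v → κ w = j → E u w) :
    ∑ k ∈ (Finset.univ.erase i).erase j, Tg M (fun u v w => I2 (E u v ∧ κ w = k)) = 0 := by
  have hst : Tg M (fun u v _ => I2 (E u v)) = 0 := by
    apply T_stokes
    intro u v huv hne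
    have : E u v := by by_contra hc; exact hne (I2_false hc)
    exact (hE u v huv this).1
  have hsum : Tg M (fun u v _ => I2 (E u v)) =
      ∑ k, Tg M (fun u v w => I2 (E u v ∧ κ w = k)) := by
    rw [← T_sum]
    apply T_congr
    intro u v w _ _ _
    rw [Finset.sum_eq_single (κ w)]
    · exact I2_congr (by simp)
    · intro b _ hb; exact I2_false (fun hh => hb hh.2.symm)
    · simp
  rw [hst] at hsum
  rw [← Finset.add_sum_erase _ _ (Finset.mem_univ i),
    ← Finset.add_sum_erase _ _ (Finset.mem_erase.2 ⟨hij.symm, Finset.mem_univ j⟩)] at hsum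
  have hi : Tg M (fun u v w => I2 (E u v ∧ κ w = i)) = 0 := by
    apply T_sym0
    intro u v w a1 a2 a3
    apply I2_congr
    constructor
    · rintro ⟨e, hk⟩; exact ⟨h1 u v w a1 a2 a3 e hk, (hE _ _ a1 e).2.1⟩
    · rintro ⟨e, hk⟩; exact ⟨h1 w v u a3.symm a2.symm a1.symm e hk, (hE _ _ a3.symm e).2.1⟩
  have hj : Tg M (fun u v w => I2 (E u v ∧ κ w = j)) = 0 := by
    rw [← T_swap12]
    apply T_sym0
    intro u v w a1 a2 a3
    apply I2_congr
    constructor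
    · rintro ⟨e, hk⟩; exact ⟨h2 v u w a1.symm a3 a2 e hk, (hE _ _ a1.symm e).2.2⟩
    · rintro ⟨e, hk⟩; exact ⟨h2 v w u a3 a1.symm a2.symm e hk, (hE _ _ a3 e).2.2⟩
  rw [hi, hj, zero_add, zero_add] at hsum
  exact hsum.symm

end Hx


open Set Metric Filter Topology

namespace Hx

variable {c : ℂ → Fin 6} {F : Set (Set ℂ)}

/-- position of a lattice point -/
noncomputable def ps (δ : ℝ) (q : L) : ℂ := ⟨δ * q.1, δ * q.2⟩

theorem ps_adj {δ : ℝ} (hδ : 0 < δ) {u v : L} (h : adj u v) : dist (ps δ u) (ps δ v) ≤ 2 * δ := by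
  rw [Complex.dist_eq]
  refine (Complex.norm_le_abs_re_add_abs_im _).trans ?_
  have h1 : |((u.1 - v.1 : ℤ) : ℝ)| ≤ 1 := by exact_mod_cast h.1
  have h2 : |((u.2 - v.2 : ℤ) : ℝ)| ≤ 1 := by exact_mod_cast h.2
  have e1 : (ps δ u - ps δ v).re = δ * ((u.1 - v.1 : ℤ) : ℝ) := by simp [ps]; ring
  have e2 : (ps δ u - ps δ v).im = δ * ((u.2 - v.2 : ℤ) : ℝ) := by simp [ps]; ring
  rw [e1, e2, abs_mul, abs_mul, abs_of_pos hδ]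
  nlinarith

theorem ps_inb {δ : ℝ} (hδ : 0 < δ) {M : ℕ} (hM : 40 ≤ δ * (M - 2)) {u : L}
    (hu : ‖ps δ u‖ ≤ 39) : inb M u := by
  have h1 := (Complex.abs_re_le_norm (ps δ u)).trans hu
  have h2 := (Complex.abs_im_le_norm (ps δ u)).trans hu
  have e1 : (ps δ u).re = δ * u.1 := rfl
  have e2 : (ps δ u).im = δ * u.2 := rfl
  rw [e1, abs_mul, abs_of_pos hδ] at h1
  rw [e2, abs_mul, abs_of_pos hδ] at h2
  have g1 : |(u.1 : ℝ)| ≤ M - 2 := by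
    by_contra hc; push Not at hc; nlinarith
  have g2 : |(u.2 : ℝ)| ≤ M - 2 := by
    by_contra hc; push Not at hc; nlinarith
  have g1' : |u.1| ≤ (M : ℤ) - 2 := by exact_mod_cast g1
  have g2' : |u.2| ≤ (M : ℤ) - 2 := by exact_mod_cast g2
  exact ⟨by omega, by omega⟩

/-- global centers -/
theorem centers (h : Col c F) : ∃ Λ : Finset ℂ, (∀ x ∈ Λ, ‖x‖ ≤ 20) ∧ ∃ ε > 0, ∀ p : ℂ, ‖p‖ ≤ 20 →
    ∃ x ∈ Λ, ∀ p', dist p' p < ε → Sub c F p' x := by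
  obtain ⟨Λ, hΛ, ε, hε, H⟩ := leb (R := fun u v => Sub c F u v) (isCompact_closedBall (0 : ℂ) 20)
    (fun v _ => sub_ev h v)
  refine ⟨Λ, fun x hx => by simpa using hΛ x hx, ε, hε, fun p hp => H p (by simpa using hp)⟩

/-- M1 with a common center -/
theorem M1 (h : Col c F) {y u w p : ℂ} (hu : Sub c F u y) (hw : Sub c F w y) (e : c u = c p)
    (e' : c w = c p) : dist p u < 1 ↔ dist p w < 1 := by
  obtain ⟨P, hP⟩ := exists_at h u
  obtain ⟨Q, hQ⟩ := exists_at h w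
  rw [e] at hP; rw [e'] at hQ
  rw [dist_comm p, dist_comm p]
  exact ⟨same_side h (hu _ _ hP) (hw _ _ hQ) hP.2.1 hQ.2.1 e' rfl,
    same_side h (hw _ _ hQ) (hu _ _ hP) hQ.2.1 hP.2.1 e rfl⟩

theorem nr_of_sub (h : Col c F) {x y v u : ℂ} (hv : Sub c F v x) (hu : Sub c F u y) (e : c v = c u)
    (hd : dist v u < 1) : Nr c F (c v) x y := by
  obtain ⟨P, hP⟩ := exists_at h v
  obtain ⟨Q, hQ⟩ := exists_at h u
  rw [← e] at hQ
  exact nr_of_lt h (hv _ _ hP) (hu _ _ hQ) hP.2.1 hQ.2.1 hd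

theorem fa_of_sub (h : Col c F) {x y v u : ℂ} (hv : Sub c F v x) (hu : Sub c F u y) (e : c v = c u)
    (hd : ¬ dist v u < 1) : Fa c F (c v) x y := by
  have hd' : 1 < dist v u := lt_of_le_of_ne (not_lt.1 hd) (fun hh => h.proper v u hh.symm e)
  obtain ⟨P, hP⟩ := exists_at h v
  obtain ⟨Q, hQ⟩ := exists_at h u
  rw [← e] at hQ
  exact fa_of_gt h (hv _ _ hP) (hu _ _ hQ) hP.2.1 hQ.2.1 hd'

theorem sub_refl (u : ℂ) : Sub c F u u := fun _ _ hh => hh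

/-- M4 for centers, one half -/
theorem M4_half (h : Col c F) {x y y' : ℂ} {i : Fin 6} (hu : ∀ k, k ∈ CC c F y ∨ k ∈ CC c F y')
    (hi : i ∈ CC c F x) (hiy : i ∈ CC c F y) (hd : dist x y' = 1) (h2 : 2 ≤ dist y y')
    (hn : Nr c F i x y) (hone : ∀ k ∈ CC c F x, k ∈ CC c F y → k = i) : False := by
  obtain ⟨ε, hε, hl⟩ := loc h x
  obtain ⟨s, hs, hs1, hs2, -⟩ := arc_pos h hd hε (p := fun _ => True) (by simp)
  obtain ⟨P, hP, hsP⟩ := gn_near h hl hs hs2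
  have hni := gn_not_mem h hs hs1
  have : c s = i := hone _ hP.mem ((hu _).resolve_right hni)
  rw [this] at hP
  obtain ⟨Q, hQ⟩ := mem_CC.1 hiy
  have := (hn P Q hP hQ).lt (h.opn P hP.1) hsP hQ.2.1
  have t := dist_triangle y s y'
  rw [dist_comm y s] at t
  linarith

theorem M4c (h : Col c F) {x y y' : ℂ} {i j : Fin 6} (hu : ∀ k, k ∈ CC c F y ∨ k ∈ CC c F y')
    (hi : i ∈ CC c F x) (hiy : i ∈ CC c F y) (hj : j ∈ CC c F x) (hjy : j ∈ CC c F y')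
    (hn : Nr c F i x y) (hn' : Nr c F j x y') : False := by
  have c1 := E1 h y
  have c2 := E1 h y'
  have c3 := E1 h x
  have hun : CC c F y ∪ CC c F y' = Finset.univ := by
    ext k; simpa using hu k
  have hc : (CC c F y ∪ CC c F y').card = 6 := by rw [hun]; simp
  have hci := Finset.card_union_add_card_inter (CC c F y) (CC c F y')
  have hdis : CC c F y ∩ CC c F y' = ∅ := by rw [← Finset.card_eq_zero]; omega
  have hne : y ≠ y' := by
    rintro rfl; rw [Finset.inter_self] at hdis; rw [hdis] at hiy; simp at hiy
  have h2 := E3 h hu hne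
  have d1 := hn.le hi hiy
  have d2 := hn'.le hj hjy
  have t := dist_triangle y x y'
  rw [dist_comm y x] at t
  have e1 : dist x y = 1 := by linarith
  have e2 : dist x y' = 1 := by linarith
  by_cases h1 : ∀ k ∈ CC c F x, k ∈ CC c F y → k = i
  · exact M4_half h hu hi hiy e2 h2 hn h1
  · by_cases h3 : ∀ k ∈ CC c F x, k ∈ CC c F y' → k = j
    · exact M4_half h (fun k => (hu k).symm) hj hjy e1 (by rw [dist_comm]; exact h2) hn' h3
    · push Not at h1 h3
      obtain ⟨k, k1, k2, k3⟩ := h1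
      obtain ⟨l, l1, l2, l3⟩ := h3
      have hd : ∀ k ∈ CC c F y, k ∉ CC c F y' := fun k hk hk' => by
        have : k ∈ CC c F y ∩ CC c F y' := Finset.mem_inter.2 ⟨hk, hk'⟩
        rw [hdis] at this; simp at this
      have : ({i, k, j, l} : Finset (Fin 6)) ⊆ CC c F x := by
        intro m hm; simp only [Finset.mem_insert, Finset.mem_singleton] at hm
        rcases hm with rfl | rfl | rfl | rfl <;> assumption
      have hc4 := Finset.card_le_card this
      rw [Finset.card_insert_of_notMem, Finset.card_insert_of_notMem,
        Finset.card_insert_of_notMem, Finset.card_singleton] at hc4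
      · omega
      · simpa using fun hh => l3 hh.symm
      · simp only [Finset.mem_insert, Finset.mem_singleton, not_or]
        exact ⟨fun hh => hd k k2 (hh ▸ hjy), fun hh => hd k k2 (hh ▸ l2)⟩
      · simp only [Finset.mem_insert, Finset.mem_singleton, not_or]
        exact ⟨fun hh => k3 hh.symm, fun hh => hd i hiy (hh ▸ hjy), fun hh => hd i hiy (hh ▸ l2)⟩

/-- the basic count -/
noncomputable def hh (κ : L → Fin 6) (pos : L → ℂ) (M : ℕ) (p : L) (a b : Fin 6) : ZMod 2 :=
  Tg M (fun u v w => I2 (κ u = κ p ∧ dist (pos p) (pos u) < 1 ∧ κ v = a ∧ κ w = b))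

theorem hh_symm {κ : L → Fin 6} {pos : L → ℂ} {M : ℕ} {p : L} {a b : Fin 6} :
    hh κ pos M p a b = hh κ pos M p b a := by
  unfold hh
  rw [← T_swap23]
  apply T_congr; intro u v w _ _ _; apply I2_congr; tauto

/-- separation radius of a finite set -/
theorem sep_exists {Y : Set ℂ} (hY : Y.Finite) {r0 : ℝ} (hr0 : 0 < r0) : ∃ r > 0, r ≤ r0 ∧
    ∀ y ∈ Y, ∀ y' ∈ Y, dist y y' < 4 * r → y = y' := by
  induction Y, hY using Set.Finite.induction_on with
  | empty => exact ⟨r0, hr0, le_rfl, by simp⟩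
  | @insert a s ha hs ih =>
    obtain ⟨r, hr, hr1, H⟩ := ih
    have : ∃ d > 0, ∀ y ∈ s, d ≤ dist y a := by
      rcases s.eq_empty_or_nonempty with rfl | hne
      · exact ⟨1, one_pos, by simp⟩
      · obtain ⟨y0, hy0, hm⟩ := hs.exists_minimalFor (fun y => dist y a) _ hne
        refine ⟨dist y0 a, dist_pos.2 (fun hh => ha (hh ▸ hy0)), fun y hy => ?_⟩
        rcases le_total (dist y0 a) (dist y a) with h1 | h1
        · exact h1
        · exact hm hy h1
    obtain ⟨d, hd, hd'⟩ := this
    refine ⟨min r (d / 4), by positivity, (min_le_left _ _).trans hr1, ?_⟩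
    have m1 := min_le_left r (d / 4)
    have m2 := min_le_right r (d / 4)
    rintro y (rfl | hy) y' (rfl | hy') hlt
    · rfl
    · have := hd' y' hy'; rw [dist_comm] at this; linarith
    · have := hd' y hy; linarith
    · exact H y hy y' hy' (by linarith)

/-- projection to the unit circle -/
theorem proj_circle {x u : ℂ} {e : ℝ} (h : |dist u x - 1| ≤ e) (he : e < 1) :
    ∃ p, dist p x = 1 ∧ dist u p ≤ e := by
  have hpos : 0 < dist u x := by
    have := abs_le.1 h; linarith
  have hn : ‖u - x‖ = dist u x := (Complex.dist_eq u x).symm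
  refine ⟨x + (u - x) / (‖u - x‖ : ℝ), ?_, ?_⟩
  · rw [Complex.dist_eq, add_sub_cancel_left, norm_div, Complex.norm_real, norm_norm, hn,
      div_self hpos.ne']
  · have : u - (x + (u - x) / (‖u - x‖ : ℝ)) = (u - x) / (‖u - x‖ : ℝ) * ((‖u - x‖ : ℝ) - 1) := by
      have : ((‖u - x‖ : ℝ) : ℂ) ≠ 0 := by rw [hn]; exact_mod_cast hpos.ne'
      field_simp; ring
    rw [Complex.dist_eq, this, norm_mul, norm_div, Complex.norm_real, norm_norm, hn,
      div_self hpos.ne', one_mul]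
    rw [show ((dist u x : ℝ) : ℂ) - 1 = ((dist u x - 1 : ℝ) : ℂ) by push_cast; ring,
      Complex.norm_real, Real.norm_eq_abs]
    exact h

/-- circle data around x -/
theorem circle_data (h : Col c F) (x : ℂ) {r0 : ℝ} (hr0 : 0 < r0) : ∃ r > 0, r ≤ r0 ∧
    (∀ y, dist y x = 1 → ¬ Gn F y → ∀ y', dist y' x = 1 → ¬ Gn F y' → dist y y' < 4 * r → y = y') ∧
    (∀ y, dist y x = 1 → ¬ Gn F y → ∀ p, dist p y < 2 * r → Sub c F p y) := by
  have hf := fin_circle h x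
  have : ∃ r1 > 0, ∀ y ∈ {s | dist s x = 1 ∧ ¬ Gn F s}, ∀ p, dist p y < r1 → Sub c F p y := by
    generalize {s | dist s x = 1 ∧ ¬ Gn F s} = Y at hf
    induction Y, hf using Set.Finite.induction_on with
    | empty => exact ⟨1, one_pos, by simp⟩
    | @insert a s ha hs ih =>
      obtain ⟨r, hr, H⟩ := ih
      obtain ⟨ε, hε, hl⟩ := loc h a
      refine ⟨min r ε, by positivity, ?_⟩
      rintro y (rfl | hy) p hp
      · exact hl p (hp.trans_le (min_le_right _ _))
      · exact H y hy p (hp.trans_le (min_le_left _ _))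
  obtain ⟨r1, hr1, H1⟩ := this
  obtain ⟨r, hr, hr', H⟩ := sep_exists hf (r0 := min r0 (r1 / 2)) (by positivity)
  refine ⟨r, hr, hr'.trans (min_le_left _ _), fun y a b y' a' b' => H y ⟨a, b⟩ y' ⟨a', b'⟩,
    fun y a b p hp => H1 y ⟨a, b⟩ p ?_⟩
  have := hr'.trans (min_le_right _ _); linarith

theorem circle_leb (h : Col c F) (x : ℂ) {r : ℝ} (hr : 0 < r) : ∃ η > 0, ∀ v, dist v x = 1 →
    ∃ y, dist y x = 1 ∧ ∀ u, dist u v < η → Sub c F u y ∧ dist u y < r := by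
  obtain ⟨Λ, hΛ, η, hη, H⟩ := leb (R := fun u v => Sub c F u v ∧ dist u v < r)
    (isCompact_sphere x 1) (fun v _ => (sub_ev h v).and (eventually_nhds_iff_ball.2
      ⟨r, hr, fun u hu => hu⟩))
  refine ⟨η, hη, fun v hv => ?_⟩
  obtain ⟨w, hw, hw'⟩ := H v (mem_sphere.2 hv)
  exact ⟨w, mem_sphere.1 (hΛ w hw), hw'⟩

theorem H2 (h : Col c F) (x : ℂ) (hx : ‖x‖ ≤ 20) : ∃ δ0 > (0:ℝ), ∀ δ : ℝ, 0 < δ → δ < δ0 → ∀ M : ℕ,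
    40 ≤ δ * (M - 2) → ∀ vi vj : L, Sub c F (ps δ vi) x → Sub c F (ps δ vj) x →
    c (ps δ vi) ≠ c (ps δ vj) → ∀ k, k ≠ c (ps δ vi) → k ≠ c (ps δ vj) →
    hh (fun q => c (ps δ q)) (ps δ) M vi (c (ps δ vj)) k =
      hh (fun q => c (ps δ q)) (ps δ) M vj (c (ps δ vi)) k := by
  classical
  obtain ⟨r, hr, hr1, hsep, hsub⟩ := circle_data h x (r0 := 1) one_pos
  obtain ⟨η, hη, hleb⟩ := circle_leb h x hr
  refine ⟨min (1/8) (η / 8), by positivity, ?_⟩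
  intro δ hδ hδ0 M hM vi vj hsi hsj hij k hki hkj
  have hδ1 : δ < 1/8 := hδ0.trans_le (min_le_left _ _)
  have hδη : δ < η / 8 := hδ0.trans_le (min_le_right _ _)
  set i := c (ps δ vi) with hi
  set j := c (ps δ vj) with hj
  set κ : L → Fin 6 := fun q => c (ps δ q) with hκ
  set A : L → Prop := fun u => dist (ps δ vi) (ps δ u) < 1 with hA
  set B : L → Prop := fun u => dist (ps δ vj) (ps δ u) < 1 with hB
  set bad : L → L → Prop := fun u v => ¬ (A u ↔ B v) ∧ κ u = i ∧ κ v = j with hbad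
  -- localisation
  have key : ∀ u v, adj u v → bad u v → ‖ps δ u‖ ≤ 39 ∧ ∃ y, dist y x = 1 ∧ ¬ Gn F y ∧
      i ∈ CC c F y ∧ j ∈ CC c F y ∧
      (∀ w, adj u w → Sub c F (ps δ w) y ∧ dist (ps δ w) y < r) := by
    intro u v huv ⟨hb, hu, hv⟩
    have hd := ps_adj hδ huv
    have iu : i ∈ CC c F (ps δ u) := hu ▸ c_mem h _
    have jv : j ∈ CC c F (ps δ v) := hv ▸ c_mem h _
    have ix : i ∈ CC c F x := hsi.cmem h
    have jx : j ∈ CC c F x := hsj.cmem h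
    have t1 := dist_triangle (ps δ u) (ps δ v) x
    have t2 := dist_triangle_left (ps δ v) x (ps δ u)
    have hrad : |dist (ps δ u) x - 1| ≤ 2 * δ := by
      by_cases ha : A u
      · have hb' : ¬ B v := fun hb' => hb ⟨fun _ => hb', fun _ => ha⟩
        have n1 := (nr_of_sub h hsi (sub_refl _) hu.symm ha).le ix iu
        have n2 := (fa_of_sub h hsj (sub_refl _) hv.symm hb').ge jx jv
        rw [dist_comm] at n1 n2
        rw [abs_le]; constructor <;> linarith
      · have hb' : B v := by by_contra hb'; exact hb ⟨fun h1 => absurd h1 ha, fun h1 => absurd h1 hb'⟩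
        have n1 := (fa_of_sub h hsi (sub_refl _) hu.symm ha).ge ix iu
        have n2 := (nr_of_sub h hsj (sub_refl _) hv.symm hb').le jx jv
        rw [dist_comm] at n1 n2
        rw [abs_le]; constructor <;> linarith
    refine ⟨?_, ?_⟩
    · have : ‖ps δ u‖ ≤ ‖ps δ u - x‖ + ‖x‖ := by
        simpa using norm_add_le (ps δ u - x) x
      rw [← Complex.dist_eq] at this
      have := abs_le.1 hrad; linarith
    · obtain ⟨p, hp, hup⟩ := proj_circle hrad (by linarith)
      obtain ⟨y, hy, hyy⟩ := hleb p hp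
      have hw : ∀ w, adj u w → Sub c F (ps δ w) y ∧ dist (ps δ w) y < r := by
        intro w hw
        apply hyy
        have := dist_triangle_left (ps δ w) p (ps δ u)
        have := ps_adj hδ hw
        linarith
      have hiy : i ∈ CC c F y := hu ▸ (hw u (adj_refl u)).1.cmem h
      have hjy : j ∈ CC c F y := hv ▸ (hw v huv).1.cmem h
      exact ⟨y, hy, not_gn_of_two h hij hiy hjy, hiy, hjy, hw⟩
  -- the set of centers
  have hYf := fin_circle h x
  set Y : Finset ℂ := hYf.toFinset with hY
  have memY : ∀ y, y ∈ Y ↔ dist y x = 1 ∧ ¬ Gn F y := by intro y; simp [hY]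
  set E : ℂ → L → L → Prop := fun y u v => bad u v ∧ dist (ps δ u) y < 2 * r with hE
  have hterm : ∀ y ∈ Y, Tg M (fun u v w => I2 (E y u v ∧ κ w = k)) = 0 := by
    intro y hy
    rw [memY] at hy
    have center : ∀ u v, adj u v → E y u v → i ∈ CC c F y ∧ j ∈ CC c F y ∧
      (∀ w, adj u w → Sub c F (ps δ w) y ∧ dist (ps δ w) y < r) := by
      intro u v huv hEu
      obtain ⟨-, y', a, b, ci, cj, hw⟩ := key u v huv hEu.1
      have : y = y' := by
        apply hsep y hy.1 hy.2 y' a b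
        have := dist_triangle_left y y' (ps δ u)
        have := (hw u (adj_refl u)).2
        have := hEu.2
        linarith
      subst this
      exact ⟨ci, cj, hw⟩
    have hs := HSK (M := M) (κ := κ) hij (E := E y)
      (fun u v huv hEu => ⟨ps_inb hδ hM (key u v huv hEu.1).1, hEu.1.2⟩)
      (by
        intro u v w uv uw vw hEu hw
        obtain ⟨-, -, hc⟩ := center u v uv hEu
        refine ⟨⟨?_, hw, hEu.1.2.2⟩, by linarith [(hc w uw).2]⟩
        have := M1 h (hc u (adj_refl u)).1 (hc w uw).1 (p := ps δ vi) hEu.1.2.1 hw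
        rw [hA]; simp only; rw [← this]; exact hEu.1.1)
      (by
        intro u v w uv uw vw hEu hw
        obtain ⟨-, -, hc⟩ := center u v uv hEu
        refine ⟨⟨?_, hEu.1.2.1, hw⟩, hEu.2⟩
        have := M1 h (hc v uv).1 (hc w uw).1 (p := ps δ vj) hEu.1.2.2 hw
        rw [hB]; simp only; rw [← this]; exact hEu.1.1)
    by_cases hky : ∃ u v, adj u v ∧ E y u v ∧ k ∈ CC c F y
    · obtain ⟨u0, v0, uv0, e0, hk⟩ := hky
      obtain ⟨hiy, hjy, -⟩ := center u0 v0 uv0 e0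
      rw [Finset.sum_eq_single k] at hs
      · exact hs
      · intro k' hk' hne
        rw [T_congr (G' := fun _ _ _ => 0), T_zero]
        intro u v w uv uw vw
        apply I2_false
        rintro ⟨e, hw⟩
        obtain ⟨-, -, hc⟩ := center u v uv e
        have hk'y : k' ∈ CC c F y := hw ▸ (hc w uw).1.cmem h
        simp only [Finset.mem_erase, Finset.mem_univ, and_true] at hk'
        have : ({i, j, k, k'} : Finset (Fin 6)) ⊆ CC c F y := by
          intro m hm; simp only [Finset.mem_insert, Finset.mem_singleton] at hm
          rcases hm with rfl | rfl | rfl | rfl <;> assumption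
        have hc4 := Finset.card_le_card this
        have := E1 h y
        rw [Finset.card_insert_of_notMem, Finset.card_insert_of_notMem,
          Finset.card_insert_of_notMem, Finset.card_singleton] at hc4
        · omega
        · simpa using hne.symm
        · simp only [Finset.mem_insert, Finset.mem_singleton, not_or]
          exact ⟨hkj.symm, hk'.1.symm⟩
        · simp only [Finset.mem_insert, Finset.mem_singleton, not_or]
          exact ⟨hij, hki.symm, hk'.2.symm⟩
      · intro hc; exact absurd hc (by simp [hki, hkj])
    · rw [T_congr (G' := fun _ _ _ => 0), T_zero]
      intro u v w uv uw vw
      apply I2_false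
      rintro ⟨e, hw⟩
      obtain ⟨-, -, hc⟩ := center u v uv e
      exact hky ⟨u, v, uv, e, hw ▸ (hc w uw).1.cmem h⟩
  have hsum : hh κ (ps δ) M vi j k + hh κ (ps δ) M vj i k = 0 := by
    have e2 : hh κ (ps δ) M vj i k = Tg M (fun u v w => I2 (B v ∧ (κ u = i ∧ κ v = j ∧ κ w = k))) := by
      unfold hh; rw [← T_swap12]
      apply T_congr; intro u v w _ _ _; apply I2_congr; simp only [hB]
      constructor
      · rintro ⟨a, b, d, e⟩; exact ⟨b, d, a, e⟩
      · rintro ⟨a, b, d, e⟩; exact ⟨d, a, b, e⟩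
    have e1 : hh κ (ps δ) M vi j k = Tg M (fun u v w => I2 (A u ∧ (κ u = i ∧ κ v = j ∧ κ w = k))) := by
      unfold hh
      apply T_congr; intro u v w _ _ _; apply I2_congr; simp only [hA]
      constructor
      · rintro ⟨a, b, d, e⟩; exact ⟨b, a, d, e⟩
      · rintro ⟨a, b, d, e⟩; exact ⟨b, a, d, e⟩
    rw [e1, e2, ← T_add]
    have : Tg M (fun u v w => I2 (A u ∧ (κ u = i ∧ κ v = j ∧ κ w = k)) +
        I2 (B v ∧ (κ u = i ∧ κ v = j ∧ κ w = k))) =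
        ∑ y ∈ Y, Tg M (fun u v w => I2 (E y u v ∧ κ w = k)) := by
      rw [← T_sum]
      apply T_congr
      intro u v w uv uw vw
      rw [I2_xor]
      by_cases hb : bad u v ∧ κ w = k
      · obtain ⟨-, y, a, b, ci, cj, hw⟩ := key u v uv hb.1
        have hyr := (hw u (adj_refl u)).2
        rw [Finset.sum_eq_single y]
        · rw [I2_true, I2_true]
          · exact ⟨⟨hb.1, by linarith⟩, hb.2⟩
          · exact ⟨hb.1.1, hb.1.2.1, hb.1.2.2, hb.2⟩
        · intro y' hy' hne
          apply I2_false
          rintro ⟨⟨-, hd⟩, -⟩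
          rw [memY] at hy'
          apply hne
          apply hsep y' hy'.1 hy'.2 y a b
          have := dist_triangle_left y' y (ps δ u)
          linarith
        · intro hc; exact absurd ((memY y).2 ⟨a, b⟩) hc
      · rw [I2_false, Finset.sum_eq_zero]
        · intro y _; apply I2_false; rintro ⟨⟨hh, -⟩, hw⟩; exact hb ⟨hh, hw⟩
        · rintro ⟨a, b, d, e⟩; exact hb ⟨⟨a, b, d⟩, e⟩
    rw [this, Finset.sum_eq_zero hterm]
  have := z2_add_self (hh κ (ps δ) M vj i k)
  linear_combination hsum - this

end Hx


open Set Metric Filter Topology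

namespace Hx

/-- boundary pairing -/
noncomputable def Br (δ : ℝ) (M : ℕ) (U : Set ℂ) (α : L → L → ZMod 2) : ZMod 2 :=
  ∑ q ∈ bx M, ((I2 (ps δ q ∈ U) + I2 (ps δ (q - (0, 1)) ∈ U)) * α q (q + (1, 0)) +
    (I2 (ps δ q ∈ U) + I2 (ps δ (q - (1, 0)) ∈ U)) * α q (q + (0, 1)))

variable {δ : ℝ} {M : ℕ} {U : Set ℂ} {α β : L → L → ZMod 2}

theorem I2_ne {p : Prop} (h : I2 p ≠ 0) : p := by
  by_contra hc; exact h (I2_false hc)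

theorem Br_sq (hs : ∀ q, ps δ q ∈ U → inb M q) :
    ∑ q ∈ bx M, I2 (ps δ q ∈ U) * (α q (q + (1, 0)) + α (q + (1, 0)) (q + (1, 1)) +
      α q (q + (0, 1)) + α (q + (0, 1)) (q + (1, 1))) = Br δ M U α := by
  have H : ∀ e : L, adj e 0 → ∀ f : L → ZMod 2, ∀ q, I2 (ps δ (q - e) ∈ U) * f q ≠ 0 →
      |q.1| + 1 ≤ M ∧ |q.2| + 1 ≤ M := by
    intro e he f q hq
    have := hs _ (I2_ne (left_ne_zero_of_mul hq))
    simp only [adj, inb, Prod.fst_zero, Prod.snd_zero, sub_zero, Prod.fst_sub, Prod.snd_sub] at *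
    have a1 := abs_le.1 (show |q.1 - e.1| ≤ M - 2 by omega)
    have a2 := abs_le.1 (show |q.2 - e.2| ≤ M - 2 by omega)
    have b1 := abs_le.1 he.1
    have b2 := abs_le.1 he.2
    have c1 : |q.1| ≤ M - 1 := abs_le.2 (by omega)
    have c2 : |q.2| ≤ M - 1 := abs_le.2 (by omega)
    omega
  have s1 := shift (M := M) (φ := fun q => I2 (ps δ (q - (0, 1)) ∈ U) * α q (q + (1, 0)))
    (H (0, 1) (by simp [adj]) (fun q => α q (q + (1, 0)))) (0, 1) (by simp [adj])
  have s2 := shift (M := M) (φ := fun q => I2 (ps δ (q - (1, 0)) ∈ U) * α q (q + (0, 1)))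
    (H (1, 0) (by simp [adj]) (fun q => α q (q + (0, 1)))) (1, 0) (by simp [adj])
  have e1 : ∀ q : L, q + (1, 0) + (0, 1) = q + (1, 1) := fun q => by simp [add_assoc]
  have e2 : ∀ q : L, q + (0, 1) + (1, 0) = q + (1, 1) := fun q => by simp [add_assoc]
  simp only [e1, e2, add_sub_cancel_right] at s1 s2
  have : Br δ M U α = ∑ q ∈ bx M, I2 (ps δ q ∈ U) * (α q (q + (1, 0)) + α q (q + (0, 1))) +
      (∑ q ∈ bx M, I2 (ps δ (q - (0, 1)) ∈ U) * α q (q + (1, 0)) +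
        ∑ q ∈ bx M, I2 (ps δ (q - (1, 0)) ∈ U) * α q (q + (0, 1))) := by
    unfold Br
    rw [← Finset.sum_add_distrib, ← Finset.sum_add_distrib]
    refine Finset.sum_congr rfl fun q _ => ?_
    ring
  rw [this, ← s1, ← s2, ← Finset.sum_add_distrib, ← Finset.sum_add_distrib]
  refine Finset.sum_congr rfl fun q _ => ?_
  ring

theorem Br_d (hs : ∀ q, ps δ q ∈ U → inb M q) (φ : L → ZMod 2) :
    Br δ M U (fun u v => φ u + φ v) = 0 := by
  rw [← Br_sq hs]
  refine Finset.sum_eq_zero fun q _ => ?_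
  linear_combination I2 (ps δ q ∈ U) * (φ q + φ (q + (1, 0)) + φ (q + (0, 1)) + φ (q + (1, 1))) *
    z2_two

theorem Br_add : Br δ M U (fun u v => α u v + β u v) = Br δ M U α + Br δ M U β := by
  unfold Br
  rw [← Finset.sum_add_distrib]
  refine Finset.sum_congr rfl fun q _ => ?_
  ring

theorem Br_mul (a : ZMod 2) : Br δ M U (fun u v => a * α u v) = a * Br δ M U α := by
  unfold Br
  rw [Finset.mul_sum]
  refine Finset.sum_congr rfl fun q _ => ?_
  ring

theorem Br_zero : Br δ M U (fun _ _ => 0) = 0 := by simp [Br]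

theorem Br_sum {ι : Type*} (s : Finset ι) (A : ι → L → L → ZMod 2) :
    Br δ M U (fun u v => ∑ i ∈ s, A i u v) = ∑ i ∈ s, Br δ M U (A i) := by
  classical
  induction s using Finset.induction_on with
  | empty => simpa using Br_zero
  | insert i s hi ih =>
    simp only [Finset.sum_insert hi]
    rw [Br_add, ih]

/-- near the frontier -/
def NF (δ : ℝ) (U : Set ℂ) (q : L) : Prop := ∃ z ∈ frontier U, dist (ps δ q) z ≤ 2 * δ

theorem inter_frontier {t s : Set ℂ} (ht : IsPreconnected t) (h1 : (t ∩ s).Nonempty)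
    (h2 : (t ∩ sᶜ).Nonempty) : (t ∩ frontier s).Nonempty := by
  by_contra hc
  rw [not_nonempty_iff_eq_empty] at hc
  have hn : ∀ z ∈ t, z ∉ frontier s := fun z hz hf => by
    have : z ∈ t ∩ frontier s := ⟨hz, hf⟩
    rw [hc] at this; exact this
  have := ht (interior s) (closure s)ᶜ isOpen_interior isClosed_closure.isOpen_compl
    (fun z hz => by
      by_cases hi : z ∈ interior s
      · exact Or.inl hi
      · exact Or.inr fun hcl => hn z hz ⟨hcl, hi⟩)
    (by
      obtain ⟨z, hz, hzs⟩ := h1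
      refine ⟨z, hz, ?_⟩
      by_contra hi; exact hn z hz ⟨subset_closure hzs, hi⟩)
    (by
      obtain ⟨z, hz, hzs⟩ := h2
      refine ⟨z, hz, fun hcl => hn z hz ⟨hcl, fun hi => hzs (interior_subset hi)⟩⟩)
  obtain ⟨z, -, hz1, hz2⟩ := this
  exact hz2 (subset_closure (interior_subset hz1))

theorem NF_of (hδ : 0 < δ) {q q' : L} (ha : adj q q')
    (h : I2 (ps δ q ∈ U) + I2 (ps δ q' ∈ U) ≠ 0) : NF δ U q := by
  have hc : (segment ℝ (ps δ q) (ps δ q') ∩ frontier U).Nonempty := by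
    by_cases h1 : ps δ q ∈ U
    · have h2 : ps δ q' ∉ U := by
        intro h2; rw [I2_true h1, I2_true h2, z2_add_self] at h; exact h rfl
      exact inter_frontier (convex_segment _ _).isPreconnected
        ⟨_, left_mem_segment _ _ _, h1⟩ ⟨_, right_mem_segment _ _ _, h2⟩
    · have h2 : ps δ q' ∈ U := by
        by_contra h2; rw [I2_false h1, I2_false h2, z2_add_self] at h; exact h rfl
      exact inter_frontier (convex_segment _ _).isPreconnected
        ⟨_, right_mem_segment _ _ _, h2⟩ ⟨_, left_mem_segment _ _ _, h1⟩
  obtain ⟨z, hz, hzf⟩ := hc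
  refine ⟨z, hzf, ?_⟩
  have : segment ℝ (ps δ q) (ps δ q') ⊆ closedBall (ps δ q) (2 * δ) :=
    (convex_closedBall _ _).segment_subset (mem_closedBall_self (by linarith))
      (by rw [mem_closedBall, dist_comm]; exact ps_adj hδ ha)
  have := this hz
  rwa [mem_closedBall, dist_comm] at this

theorem Br_congr (hδ : 0 < δ) (h : ∀ u v, adj u v → NF δ U u → α u v = β u v) :
    Br δ M U α = Br δ M U β := by
  unfold Br
  refine Finset.sum_congr rfl fun q _ => ?_
  congr 1
  · by_cases h1 : I2 (ps δ q ∈ U) + I2 (ps δ (q - (0, 1)) ∈ U) = 0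
    · rw [h1]; simp
    · rw [h q _ (by simp [adj]) (NF_of hδ (by simp [adj]) h1)]
  · by_cases h1 : I2 (ps δ q ∈ U) + I2 (ps δ (q - (1, 0)) ∈ U) = 0
    · rw [h1]; simp
    · rw [h q _ (by simp [adj]) (NF_of hδ (by simp [adj]) h1)]

/-! rotated coordinates -/
noncomputable def Lf (x : ℂ) (θ : ℝ) (p : ℂ) : ℝ :=
  (p - x).im * Real.cos θ - (p - x).re * Real.sin θ
noncomputable def Mf (x : ℂ) (θ : ℝ) (p : ℂ) : ℝ :=
  (p - x).re * Real.cos θ + (p - x).im * Real.sin θ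

theorem LM_sq (x : ℂ) (θ : ℝ) (p : ℂ) : Lf x θ p ^ 2 + Mf x θ p ^ 2 = dist p x ^ 2 := by
  rw [Complex.dist_eq, ← Complex.normSq_eq_norm_sq, Complex.normSq_apply]
  unfold Lf Mf
  linear_combination ((p - x).im ^ 2 + (p - x).re ^ 2) * Real.cos_sq_add_sin_sq θ

theorem LM_add (x : ℂ) (θ Δ : ℝ) (p : ℂ) :
    Lf x (θ + Δ) p = Lf x θ p * Real.cos Δ - Mf x θ p * Real.sin Δ ∧
    Lf x θ p = Lf x (θ + Δ) p * Real.cos Δ + Mf x (θ + Δ) p * Real.sin Δ := by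
  have h2 := Real.cos_sq_add_sin_sq Δ
  unfold Lf Mf
  rw [Real.cos_add, Real.sin_add]
  constructor
  · ring
  · linear_combination -((p - x).im * Real.cos θ - (p - x).re * Real.sin θ) * h2

theorem LM_pt (x : ℂ) (θ : ℝ) (p : ℂ) :
    Lf x θ p ^ 2 + (Mf x θ p - 1) ^ 2 = dist p (pt x θ) ^ 2 := by
  have h2 := Real.cos_sq_add_sin_sq θ
  rw [Complex.dist_eq, ← Complex.normSq_eq_norm_sq, Complex.normSq_apply]
  have e1 : (p - pt x θ).re = (p - x).re - Real.cos θ := by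
    simp [pt, Complex.exp_ofReal_mul_I_re]; ring
  have e2 : (p - pt x θ).im = (p - x).im - Real.sin θ := by
    simp [pt, Complex.exp_ofReal_mul_I_im]; ring
  rw [e1, e2]
  unfold Lf Mf
  linear_combination ((p - x).im ^ 2 + (p - x).re ^ 2 - 1) * h2

theorem Lf_sub (x : ℂ) (θ : ℝ) (p q : ℂ) : |Lf x θ p - Lf x θ q| ≤ dist p q := by
  have : Lf x θ p - Lf x θ q = Lf q θ p := by unfold Lf; simp; ring
  rw [this]
  exact abs_le_of_sq_le_sq' (by have := LM_sq q θ p; nlinarith [sq_nonneg (Mf q θ p)]) dist_nonneg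
    |> abs_le.2

theorem Lf_pt_le (x : ℂ) (θ : ℝ) (p : ℂ) : |Lf x θ p| ≤ dist p (pt x θ) ∧
    |Mf x θ p - 1| ≤ dist p (pt x θ) := by
  have := LM_pt x θ p
  exact ⟨abs_le_of_sq_le_sq (by nlinarith [sq_nonneg (Mf x θ p - 1)]) dist_nonneg,
    abs_le_of_sq_le_sq (by nlinarith [sq_nonneg (Lf x θ p)]) dist_nonneg⟩

theorem dist_pt_le (x : ℂ) (θ : ℝ) (p : ℂ) : dist p (pt x θ) ≤ |Lf x θ p| + |Mf x θ p - 1| := by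
  refine (le_abs_self _).trans (abs_le_of_sq_le_sq ?_ (by positivity))
  rw [← LM_pt, add_sq, sq_abs, sq_abs]
  have : 0 ≤ |Lf x θ p| * |Mf x θ p - 1| := by positivity
  linarith

theorem dist_LM_le (x : ℂ) (θ : ℝ) (p : ℂ) : dist p x ≤ |Lf x θ p| + |Mf x θ p| ∧
    |Mf x θ p| ≤ dist p x ∧ |Lf x θ p| ≤ dist p x := by
  have := LM_sq x θ p
  refine ⟨?_, ?_, ?_⟩
  · refine (le_abs_self _).trans (abs_le_of_sq_le_sq ?_ (by positivity))
    rw [← this, add_sq, sq_abs, sq_abs]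
    have : 0 ≤ |Lf x θ p| * |Mf x θ p| := by positivity
    linarith
  · exact abs_le_of_sq_le_sq (by nlinarith [sq_nonneg (Lf x θ p)]) dist_nonneg
  · exact abs_le_of_sq_le_sq (by nlinarith [sq_nonneg (Mf x θ p)]) dist_nonneg

/-- sector predicate -/
def Wp (x : ℂ) (θ Δ : ℝ) (p : ℂ) : Prop := 0 ≤ Lf x θ p ∧ Lf x (θ + Δ) p < 0

section wind

variable {x : ℂ} {r ρ θ Δ : ℝ}

theorem Wp_step (hδ : 0 < δ) (hfr : ∀ z ∈ frontier U, |dist z x - 1| ≤ r) {u : L}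
    (hu : NF δ U u) : |dist (ps δ u) x - 1| ≤ r + 2 * δ := by
  obtain ⟨z, hz, hd⟩ := hu
  have h1 := abs_le.1 (hfr z hz)
  have h2 := dist_triangle (ps δ u) z x
  have h3 := dist_triangle_left z x (ps δ u)
  rw [abs_le]; constructor <;> linarith

/-- P2 -/
theorem P2 (hδ : 0 < δ) (hfr : ∀ z ∈ frontier U, |dist z x - 1| ≤ r) (hr : 0 < r)
    (hρ : r + 20 * δ < ρ) (hρ1 : ρ ≤ 1 / 8) (hs : 4 * ρ ≤ Real.sin Δ) (hc : 0 ≤ Real.cos Δ)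
    {u v : L} (huv : adj u v)
    (hu : NF δ U u) (hne : ¬ (Wp x θ Δ (ps δ u) ↔ Wp x θ Δ (ps δ v))) :
    dist (ps δ u) (pt x θ) < ρ - 2 * δ ∨ dist (ps δ u) (pt x (θ + Δ)) < ρ - 2 * δ := by
  have hrad := abs_le.1 (Wp_step hδ hfr hu)
  have hd := ps_adj hδ huv
  set p := ps δ u
  set q := ps δ v
  have l1 := abs_le.1 ((Lf_sub x θ p q).trans hd)
  have l2 := abs_le.1 ((Lf_sub x (θ + Δ) p q).trans hd)
  obtain ⟨a1, a2⟩ := LM_add x θ Δ p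
  have hc1 := Real.cos_le_one Δ
  have hs1 := Real.sin_le_one Δ
  by_cases h1 : (0 ≤ Lf x θ p ↔ 0 ≤ Lf x θ q)
  · -- second line
    have h2 : ¬ (Lf x (θ + Δ) p < 0 ↔ Lf x (θ + Δ) q < 0) := by
      intro h2; apply hne; unfold Wp; rw [h1, h2]
    have hL : |Lf x (θ + Δ) p| ≤ 2 * δ := by
      rw [abs_le]
      by_cases h3 : Lf x (θ + Δ) p < 0
      · have : ¬ Lf x (θ + Δ) q < 0 := fun h4 => h2 ⟨fun _ => h4, fun _ => h3⟩
        constructor <;> linarith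
      · have : Lf x (θ + Δ) q < 0 := by
          by_contra h4; exact h2 ⟨fun h => absurd h h3, fun h => absurd h h4⟩
        constructor <;> linarith
    obtain ⟨b1, b2, -⟩ := dist_LM_le x (θ + Δ) p
    rcases le_or_gt 0 (Mf x (θ + Δ) p) with hm | hm
    · right
      rw [abs_of_nonneg hm] at b1 b2
      refine (dist_pt_le x (θ + Δ) p).trans_lt ?_
      have : |Mf x (θ + Δ) p - 1| ≤ r + 4 * δ := by
        rw [abs_le]; constructor <;> linarith
      linarith
    · exfalso
      rw [abs_of_neg hm] at b1 b2
      have hm' : 1 / 2 ≤ - Mf x (θ + Δ) p := by linarith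
      have hL' := abs_le.1 hL
      have : Lf x θ p < - (2 * δ) := by
        rw [a2]
        have : Lf x (θ + Δ) p * Real.cos Δ ≤ 2 * δ := by nlinarith
        nlinarith
      apply hne
      unfold Wp
      constructor
      · intro hh; linarith [hh.1]
      · intro hh; linarith [hh.1]
  · have hL : |Lf x θ p| ≤ 2 * δ := by
      rw [abs_le]
      by_cases h3 : 0 ≤ Lf x θ p
      · have : ¬ 0 ≤ Lf x θ q := fun h4 => h1 ⟨fun _ => h4, fun _ => h3⟩
        constructor <;> linarith
      · have : 0 ≤ Lf x θ q := by
          by_contra h4; exact h1 ⟨fun h => absurd h h3, fun h => absurd h h4⟩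
        constructor <;> linarith
    obtain ⟨b1, b2, -⟩ := dist_LM_le x θ p
    rcases le_or_gt 0 (Mf x θ p) with hm | hm
    · left
      rw [abs_of_nonneg hm] at b1 b2
      refine (dist_pt_le x θ p).trans_lt ?_
      have : |Mf x θ p - 1| ≤ r + 4 * δ := by
        rw [abs_le]; constructor <;> linarith
      linarith
    · exfalso
      rw [abs_of_neg hm] at b1 b2
      have hm' : 1 / 2 ≤ - Mf x θ p := by linarith
      have hL' := abs_le.1 hL
      have : 2 * δ < Lf x (θ + Δ) p := by
        rw [a1]
        have : -(2 * δ) ≤ Lf x θ p * Real.cos Δ := by nlinarith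
        nlinarith
      apply hne
      unfold Wp
      constructor
      · intro hh; linarith [hh.2]
      · intro hh; linarith [hh.2]

/-- near the sample point -/
theorem P3 (hρ : 0 < ρ) (hρ1 : ρ ≤ 1 / 8) (hs : 4 * ρ ≤ Real.sin Δ) (hc : 0 ≤ Real.cos Δ) {p : ℂ}
    (hp : dist p (pt x (θ + Δ)) < ρ) : 2 * ρ < Lf x θ p ∧ Lf x (θ + Δ + Δ) p < - (2 * ρ) := by
  obtain ⟨b1, b2⟩ := Lf_pt_le x (θ + Δ) p
  have b1 := abs_le.1 b1
  have b2 := abs_le.1 b2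
  have a2 := (LM_add x θ Δ p).2
  have a1 := (LM_add x (θ + Δ) Δ p).1
  have hc1 := Real.cos_le_one Δ
  have hs1 := Real.sin_le_one Δ
  rw [a2, a1]
  have hm : 7 / 8 ≤ Mf x (θ + Δ) p := by linarith
  have k1 : -ρ ≤ Lf x (θ + Δ) p * Real.cos Δ := by nlinarith
  have k2 : Lf x (θ + Δ) p * Real.cos Δ ≤ ρ := by nlinarith
  have k3 : 7 / 8 * (4 * ρ) ≤ Mf x (θ + Δ) p * Real.sin Δ := by
    apply mul_le_mul hm hs <;> linarith
  constructor <;> linarith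

/-- the local contribution at the sample -/
noncomputable def Ai (δ : ℝ) (M : ℕ) (U : Set ℂ) (x : ℂ) (ρ θ Δ : ℝ) (φ : ℝ) : ZMod 2 :=
  Br δ M U (fun u v => I2 (dist (ps δ u) (pt x φ) < ρ) *
    (I2 (Wp x θ Δ (ps δ u)) + I2 (Wp x θ Δ (ps δ v))))

theorem I2_iff {p q : Prop} (h : p ↔ q) : I2 p + I2 q = 0 := by
  rw [I2_congr h, z2_add_self]

theorem BrW (hsupp : ∀ q, ps δ q ∈ U → inb M q)
    (hδ : 0 < δ) (hfr : ∀ z ∈ frontier U, |dist z x - 1| ≤ r) (hr : 0 < r)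
    (hρ : r + 20 * δ < ρ) (hρ1 : ρ ≤ 1 / 8) (hs : 4 * ρ ≤ Real.sin Δ) (hc : 0 ≤ Real.cos Δ)
    (χ : L → ZMod 2) (d d' : ZMod 2) (h1 : ∀ q, dist (ps δ q) (pt x θ) < ρ → χ q = d)
    (h2 : ∀ q, dist (ps δ q) (pt x (θ + Δ)) < ρ → χ q = d') :
    Br δ M U (fun u v => I2 (Wp x θ Δ (ps δ u)) * (χ u + χ v)) =
      d * Ai δ M U x ρ θ Δ θ + d' * Ai δ M U x ρ θ Δ (θ + Δ) := by
  have e1 : Br δ M U (fun u v => I2 (Wp x θ Δ (ps δ u)) * (χ u + χ v)) =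
      Br δ M U (fun u v => χ v * (I2 (Wp x θ Δ (ps δ u)) + I2 (Wp x θ Δ (ps δ v)))) := by
    have := Br_d hsupp (fun u => I2 (Wp x θ Δ (ps δ u)) * χ u)
    rw [← add_zero (Br δ M U (fun u v => χ v * _)), ← this, ← Br_add]
    congr 1; funext u v
    linear_combination (-I2 (Wp x θ Δ (ps δ v)) * χ v) * z2_two
  rw [e1]
  unfold Ai
  rw [← Br_mul, ← Br_mul, ← Br_add]
  apply Br_congr hδ
  intro u v huv hu
  by_cases hW : (Wp x θ Δ (ps δ u) ↔ Wp x θ Δ (ps δ v))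
  · rw [I2_iff hW]; simp
  · have hd := ps_adj hδ huv
    have hd' := hd
    rw [dist_comm] at hd'
    rcases P2 hδ hfr hr hρ hρ1 hs hc huv hu hW with hn | hn
    · have t := dist_triangle (ps δ v) (ps δ u) (pt x θ)
      have hn' : ¬ dist (ps δ u) (pt x (θ + Δ)) < ρ := by
        intro hh
        have := (P3 (by linarith) hρ1 hs hc hh).1
        have := (abs_le.1 (Lf_pt_le x θ (ps δ u)).1).2
        linarith
      rw [h1 v (by linarith), I2_true (show dist (ps δ u) (pt x θ) < ρ by linarith), I2_false hn']
      ring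
    · have t := dist_triangle (ps δ v) (ps δ u) (pt x (θ + Δ))
      have hn' : ¬ dist (ps δ u) (pt x θ) < ρ := by
        intro hh
        have := (P3 (by linarith) hρ1 hs hc
          (show dist (ps δ u) (pt x (θ + Δ)) < ρ by linarith)).1
        have := (abs_le.1 (Lf_pt_le x θ (ps δ u)).1).2
        linarith
      rw [h2 v (by linarith), I2_true (show dist (ps δ u) (pt x (θ + Δ)) < ρ by linarith),
        I2_false hn']
      ring

theorem Ai_eq (hsupp : ∀ q, ps δ q ∈ U → inb M q)
    (hδ : 0 < δ) (hfr : ∀ z ∈ frontier U, |dist z x - 1| ≤ r) (hr : 0 < r)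
    (hρ : r + 20 * δ < ρ) (hρ1 : ρ ≤ 1 / 8) (hs : 4 * ρ ≤ Real.sin Δ) (hc : 0 ≤ Real.cos Δ) :
    Ai δ M U x ρ θ Δ (θ + Δ) = Ai δ M U x ρ θ Δ θ := by
  have h0 := BrW (θ := θ) hsupp hδ hfr hr hρ hρ1 hs hc (fun _ => 1) 1 1 (fun _ _ => rfl)
    (fun _ _ => rfl)
  have : Br δ M U (fun u v => I2 (Wp x θ Δ (ps δ u)) * (1 + 1)) = 0 := by
    simp only [z2_add_self, mul_zero]; exact Br_zero
  rw [this] at h0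
  linear_combination -h0 - Ai δ M U x ρ θ Δ θ * z2_two

theorem Ai_next (hδ : 0 < δ) (hρ : 20 * δ < ρ) (hρ1 : ρ ≤ 1 / 8) (hs : 4 * ρ ≤ Real.sin Δ)
    (hc : 0 ≤ Real.cos Δ) :
    Ai δ M U x ρ θ Δ (θ + Δ) = Ai δ M U x ρ (θ + Δ) Δ (θ + Δ) := by
  unfold Ai
  apply Br_congr hδ
  intro u v huv hu
  by_cases hn : dist (ps δ u) (pt x (θ + Δ)) < ρ
  · congr 1
    obtain ⟨k1, k2⟩ := P3 (by linarith) hρ1 hs hc hn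
    have hd := ps_adj hδ huv
    have l1 := abs_le.1 ((Lf_sub x θ (ps δ u) (ps δ v)).trans hd)
    have l2 := abs_le.1 ((Lf_sub x (θ + Δ + Δ) (ps δ u) (ps δ v)).trans hd)
    have e1 : ∀ p, 0 < Lf x θ p → Lf x (θ + Δ + Δ) p < 0 →
        I2 (Wp x θ Δ p) = 1 + I2 (Wp x (θ + Δ) Δ p) := by
      intro p h1 h2
      by_cases h3 : Lf x (θ + Δ) p < 0
      · rw [I2_true ⟨h1.le, h3⟩, I2_false (fun hh => absurd hh.1 (not_le.2 h3)), add_zero]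
      · rw [I2_false (fun hh => h3 hh.2), I2_true ⟨not_lt.1 h3, h2⟩, z2_add_self]
    rw [e1 _ (by linarith) (by linarith), e1 (ps δ v) (by linarith) (by linarith)]
    linear_combination z2_two
  · rw [I2_false hn]; simp

theorem Ai_all (hsupp : ∀ q, ps δ q ∈ U → inb M q)
    (hδ : 0 < δ) (hfr : ∀ z ∈ frontier U, |dist z x - 1| ≤ r) (hr : 0 < r)
    (hρ : r + 20 * δ < ρ) (hρ1 : ρ ≤ 1 / 8) (hs : 4 * ρ ≤ Real.sin Δ) (hc : 0 ≤ Real.cos Δ) (i : ℕ) :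
    Ai δ M U x ρ (θ + i * Δ) Δ (θ + i * Δ) = Ai δ M U x ρ θ Δ θ := by
  induction i with
  | zero => simp
  | succ n ih =>
    have e : θ + ((n + 1 : ℕ) : ℝ) * Δ = θ + n * Δ + Δ := by push_cast; ring
    rw [e, ← Ai_next (θ := θ + n * Δ) hδ (by linarith) hρ1 hs hc,
      Ai_eq (θ := θ + n * Δ) hsupp hδ hfr hr hρ hρ1 hs hc, ih]

theorem col_iff (hδ : 0 < δ) (hρ0 : 0 < ρ) (hρ1 : ρ ≤ 1 / 8) {q : L}
    (hrad : |dist (ps δ q) x - 1| ≤ r + 2 * δ) (k1 : 2 * ρ ≤ Real.cos θ)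
    (k2 : Real.cos (θ + Δ) ≤ - (2 * ρ)) (hr' : r ≤ 1 / 8) (hρ : r + 20 * δ < ρ) (hr : 0 < r) {i0 j0 : ℤ}
    (i1 : δ * i0 ≤ x.re) (i2 : x.re < δ * i0 + δ) (j1 : δ * j0 ≤ x.im) (j2 : x.im < δ * j0 + δ)
    (hc1 : q.1 = i0) : Wp x θ Δ (ps δ q) ↔ j0 ≤ q.2 := by
  have hrad := abs_le.1 hrad
  have eim : (ps δ q - x).im = δ * q.2 - x.im := rfl
  have ere : (ps δ q - x).re = δ * q.1 - x.re := rfl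
  rw [hc1] at ere
  have hle := (Complex.norm_le_abs_re_add_abs_im (ps δ q - x))
  rw [← Complex.dist_eq] at hle
  unfold Wp Lf
  generalize (ps δ q - x).re = a at *
  generalize (ps δ q - x).im = b at *
  have ha : |a| ≤ δ := by rw [abs_le]; constructor <;> linarith
  have hb : 1 / 2 ≤ |b| := by linarith
  have as1 : |a * Real.sin θ| ≤ δ := by
    rw [abs_mul]
    calc |a| * |Real.sin θ| ≤ |a| * 1 :=
          mul_le_mul_of_nonneg_left (Real.abs_sin_le_one θ) (abs_nonneg a)
      _ ≤ δ := by linarith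
  have as2 : |a * Real.sin (θ + Δ)| ≤ δ := by
    rw [abs_mul]
    calc |a| * |Real.sin (θ + Δ)| ≤ |a| * 1 :=
          mul_le_mul_of_nonneg_left (Real.abs_sin_le_one (θ + Δ)) (abs_nonneg a)
      _ ≤ δ := by linarith
  have as1 := abs_le.1 as1
  have as2 := abs_le.1 as2
  constructor
  · rintro ⟨w1, -⟩
    by_contra hlt
    have h3 : (q.2 : ℝ) ≤ j0 - 1 := by
      have : q.2 ≤ j0 - 1 := by omega
      exact_mod_cast this
    have h4 : δ * (q.2 : ℝ) ≤ δ * (j0 - 1) := mul_le_mul_of_nonneg_left h3 hδ.le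
    have hbn : b ≤ 0 := by linarith
    rw [abs_of_nonpos hbn] at hb
    have : (1/2) * (2 * ρ) ≤ (-b) * Real.cos θ := mul_le_mul hb k1 (by linarith) (by linarith)
    linarith
  · intro hge
    have h3 : (j0 : ℝ) ≤ q.2 := by exact_mod_cast hge
    have h4 : δ * (j0 : ℝ) ≤ δ * q.2 := mul_le_mul_of_nonneg_left h3 hδ.le
    have hbp : 0 ≤ b := by
      have hb0 : - δ ≤ b := by linarith
      by_contra hneg
      rw [abs_of_neg (not_le.1 hneg)] at hb
      linarith
    rw [abs_of_nonneg hbp] at hb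
    have t1 : (1/2) * (2 * ρ) ≤ b * Real.cos θ := mul_le_mul hb k1 (by linarith) hbp
    have t2 : (1/2) * (2 * ρ) ≤ b * (-Real.cos (θ + Δ)) :=
      mul_le_mul hb (by linarith) (by linarith) hbp
    constructor <;> linarith

/-- the local contribution is one -/
theorem Ai_one (hsupp : ∀ q, ps δ q ∈ U → inb M q)
    (hδ : 0 < δ) (hfr : ∀ z ∈ frontier U, |dist z x - 1| ≤ r) (hr : 0 < r)
    (hρ : r + 20 * δ < ρ) (hρ1 : ρ ≤ 1 / 8) (hs : 4 * ρ ≤ Real.sin Δ) (hc : 0 ≤ Real.cos Δ)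
    (hin : ∀ p, dist p x < 1 / 2 → p ∈ U)
    (hr' : r ≤ 1 / 8) (k1 : 2 * ρ ≤ Real.cos θ) (k2 : Real.cos (θ + Δ) ≤ - (2 * ρ)) :
    Ai δ M U x ρ θ Δ θ = 1 := by
  set i0 := ⌊x.re / δ⌋ with hi0
  set j0 := ⌊x.im / δ⌋ with hj0
  have i1 : δ * i0 ≤ x.re := by
    have := Int.floor_le (x.re / δ); rw [le_div_iff₀ hδ] at this; linarith
  have i2 : x.re < δ * i0 + δ := by
    have := Int.lt_floor_add_one (x.re / δ); rw [div_lt_iff₀ hδ] at this; linarith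
  have j1 : δ * j0 ≤ x.im := by
    have := Int.floor_le (x.im / δ); rw [le_div_iff₀ hδ] at this; linarith
  have j2 : x.im < δ * j0 + δ := by
    have := Int.lt_floor_add_one (x.im / δ); rw [div_lt_iff₀ hδ] at this; linarith
  have hptre : ∀ φ : ℝ, (pt x φ).re = x.re + Real.cos φ := by
    intro φ; simp [pt, Complex.exp_ofReal_mul_I_re]
  have hre : ∀ (q : L) (φ : ℝ), dist (ps δ q) (pt x φ) < ρ → |δ * q.1 - (x.re + Real.cos φ)| < ρ := by
    intro q φ hh
    have := Complex.abs_re_le_norm (ps δ q - pt x φ)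
    rw [← Complex.dist_eq, Complex.sub_re, hptre] at this
    exact this.trans_lt hh
  have hB := BrW (θ := θ) hsupp hδ hfr hr hρ hρ1 hs hc (fun q => I2 (i0 + 1 ≤ q.1)) 1 0
    (by
      intro q hq
      apply I2_true
      have := abs_lt.1 (hre q _ hq)
      have h3 : δ * (i0 : ℝ) < δ * q.1 := by linarith
      have h4 : (i0 : ℝ) < q.1 := lt_of_mul_lt_mul_left h3 hδ.le
      have : i0 < q.1 := by exact_mod_cast h4
      omega)
    (by
      intro q hq
      apply I2_false
      have := abs_lt.1 (hre q _ hq)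
      have h3 : δ * q.1 < δ * ((i0 : ℝ) + 1) := by linarith
      have h4 : (q.1 : ℝ) < i0 + 1 := lt_of_mul_lt_mul_left h3 hδ.le
      have : q.1 < i0 + 1 := by exact_mod_cast h4
      omega)
  rw [zero_mul, add_zero, one_mul] at hB
  rw [← hB]
  set S : L → ZMod 2 := fun q => I2 (ps δ q ∈ U) with hS
  set φ : L → ZMod 2 := fun q => S q * I2 (q.1 = i0 ∧ j0 ≤ q.2) with hφ
  have hsh := shift (M := M) (φ := φ) (by
    intro q hq
    have := hsupp q (I2_ne (left_ne_zero_of_mul hq))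
    unfold inb at this; omega) (0, -1) (by simp [adj])
  have hpt : ps δ (i0, j0 - 1) ∈ U := by
    apply hin
    rw [Complex.dist_eq]
    refine (Complex.norm_le_abs_re_add_abs_im _).trans_lt ?_
    have e1 : |(ps δ (i0, j0 - 1) - x).re| ≤ δ := by
      simp only [ps, Complex.sub_re]; rw [abs_le]; constructor <;> linarith
    have e2 : |(ps δ (i0, j0 - 1) - x).im| ≤ 2 * δ := by
      simp only [ps, Complex.sub_im]; push_cast; rw [abs_le]; constructor <;> linarith
    linarith
  have hbx : (i0, j0) ∈ bx M := by
    have := hsupp _ hpt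
    rw [mem_bx]
    simp only [inb] at this
    have h3 := abs_le.1 (show |j0 - 1| ≤ M - 2 by omega)
    have h4 : |j0| ≤ M := abs_le.2 (by omega)
    have h5 : |i0| ≤ M := by omega
    exact ⟨h5, h4⟩
  have hone : ∑ q ∈ bx M, S (q - (0, 1)) * I2 (q = (i0, j0)) = 1 := by
    rw [Finset.sum_eq_single (i0, j0)]
    · rw [I2_true rfl, mul_one]
      exact I2_true (by simpa using hpt)
    · intro q _ hq; rw [I2_false hq, mul_zero]
    · intro hh; exact absurd hbx hh
  have hterm : ∀ q : L, (S q + S (q - (0, 1))) * (I2 (Wp x θ Δ (ps δ q)) *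
      (I2 (i0 + 1 ≤ q.1) + I2 (i0 + 1 ≤ (q + (1, 0)).1))) =
      φ q + φ (q + (0, -1)) + S (q - (0, 1)) * I2 (q = (i0, j0)) := by
    intro q
    have hq1 : q + (0, -1) = q - (0, 1) := by ext <;> simp [sub_eq_add_neg]
    rw [hq1]
    have hcol : I2 (i0 + 1 ≤ q.1) + I2 (i0 + 1 ≤ (q + (1, 0)).1) = I2 (q.1 = i0) := by
      simp only [Prod.fst_add]
      rcases lt_trichotomy q.1 i0 with h1 | h1 | h1
      · rw [I2_false (by omega), I2_false (by omega), I2_false (by omega), add_zero]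
      · rw [I2_false (by omega), I2_true (by omega), I2_true (by omega), zero_add]
      · rw [I2_true (by omega), I2_true (by omega), I2_false (by omega), z2_add_self]
    rw [hcol]
    by_cases hc1 : q.1 = i0
    · have hφs : φ (q - (0, 1)) = S (q - (0, 1)) * I2 (j0 + 1 ≤ q.2) := by
        simp only [hφ]; congr 1; apply I2_congr
        simp only [Prod.fst_sub, Prod.snd_sub]
        constructor
        · rintro ⟨-, h1⟩; omega
        · intro h1; exact ⟨by omega, by omega⟩
      have hφq : φ q = S q * I2 (j0 ≤ q.2) := by
        simp only [hφ]; congr 1; apply I2_congr; tauto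
      have hqe : I2 (q = (i0, j0)) = I2 (q.2 = j0) := by
        apply I2_congr; rw [Prod.ext_iff]; tauto
      have hj : I2 (j0 ≤ q.2) = I2 (j0 + 1 ≤ q.2) + I2 (q.2 = j0) := by
        rcases lt_trichotomy q.2 j0 with h1 | h1 | h1
        · rw [I2_false (by omega), I2_false (by omega), I2_false (by omega), add_zero]
        · rw [I2_true (by omega), I2_false (by omega), I2_true (by omega), zero_add]
        · rw [I2_true (by omega), I2_true (by omega), I2_false (by omega), add_zero]
      rw [I2_true hc1, mul_one, hφs, hφq, hqe]
      have : (S q + S (q - (0, 1))) * I2 (Wp x θ Δ (ps δ q)) =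
          (S q + S (q - (0, 1))) * I2 (j0 ≤ q.2) := by
        by_cases hz : S q + S (q - (0, 1)) = 0
        · rw [hz]; simp
        · congr 1
          have hnf := NF_of hδ (q := q) (q' := q - (0, 1)) (by simp [adj]) hz
          exact I2_congr (col_iff hδ (by linarith) hρ1 (Wp_step hδ hfr hnf) k1 k2 hr' hρ hr i1 i2 j1 j2 hc1)
      rw [this, hj]
      ring
    · have hφ0 : φ q = 0 := by simp only [hφ]; rw [I2_false (fun hh => hc1 hh.1), mul_zero]
      have hφ1 : φ (q - (0, 1)) = 0 := by
        simp only [hφ]; rw [I2_false, mul_zero]; rintro ⟨h1, -⟩; simp at h1; exact hc1 h1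
      rw [I2_false hc1, hφ0, hφ1, I2_false (p := q = (i0, j0)) (fun hh => hc1 (by rw [hh]))]
      simp
  have hver : ∀ q : L, I2 (i0 + 1 ≤ q.1) + I2 (i0 + 1 ≤ (q + (0, 1)).1) = 0 := by
    intro q; simp only [Prod.fst_add, add_zero]; exact z2_add_self _
  have hterm2 : ∀ q ∈ bx M, (I2 (ps δ q ∈ U) + I2 (ps δ (q - (0, 1)) ∈ U)) *
        (I2 (Wp x θ Δ (ps δ q)) * (I2 (i0 + 1 ≤ q.1) + I2 (i0 + 1 ≤ (q + (1, 0)).1))) +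
      (I2 (ps δ q ∈ U) + I2 (ps δ (q - (1, 0)) ∈ U)) *
        (I2 (Wp x θ Δ (ps δ q)) * (I2 (i0 + 1 ≤ q.1) + I2 (i0 + 1 ≤ (q + (0, 1)).1))) =
      φ q + φ (q + (0, -1)) + S (q - (0, 1)) * I2 (q = (i0, j0)) := by
    intro q _
    rw [hver q, mul_zero, mul_zero, add_zero]
    exact hterm q
  unfold Br
  refine (Finset.sum_congr rfl hterm2).trans ?_
  rw [Finset.sum_add_distrib, Finset.sum_add_distrib, hsh, hone, z2_add_self, zero_add]

/-- partition into sectors -/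
theorem P4 {N : ℕ} (hN : 0 < N) (α : ℝ) {p : ℂ} (hp : p ≠ x) (hΔ : Δ = Real.pi / (3 * N)) :
    ∃ i < 6 * N, Wp x (α + i * Δ) Δ p ∧ dist p (pt x (α + i * Δ)) ≤ |dist p x - 1| + Δ ∧
      ∀ j < 6 * N, Wp x (α + j * Δ) Δ p → j = i := by
  have hpi := Real.pi_pos
  have hN1 : (1 : ℝ) ≤ N := by exact_mod_cast hN
  have hΔ0 : 0 < Δ := by rw [hΔ]; positivity
  have hΔN : 6 * N * Δ = 2 * Real.pi := by rw [hΔ]; field_simp; ring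
  have hΔ1 : Δ ≤ Real.pi / 3 := by
    nlinarith
  set R := dist p x with hR
  have hR0 : 0 < R := dist_pos.2 hp
  set φ := Complex.arg (p - x) with hφ
  have hpe : p - x = R * Complex.exp (φ * Complex.I) := by
    rw [hR, Complex.dist_eq]; exact (Complex.norm_mul_exp_arg_mul_I _).symm
  have hre : (p - x).re = R * Real.cos φ := by
    rw [hpe, Complex.re_ofReal_mul, Complex.exp_ofReal_mul_I_re]
  have him : (p - x).im = R * Real.sin φ := by
    rw [hpe, Complex.im_ofReal_mul, Complex.exp_ofReal_mul_I_im]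
  have hL : ∀ θ, Lf x θ p = R * Real.sin (φ - θ) := by
    intro θ; unfold Lf; rw [hre, him, Real.sin_sub]; ring
  set t := toIcoMod Real.two_pi_pos 0 (φ - α) with ht
  set k := toIcoDiv Real.two_pi_pos 0 (φ - α) with hk
  have htk : φ - α = t + k * (2 * Real.pi) := by
    have := toIcoMod_add_toIcoDiv_zsmul Real.two_pi_pos 0 (φ - α)
    rw [zsmul_eq_mul] at this; exact this.symm
  have ht01 := toIcoMod_mem_Ico Real.two_pi_pos 0 (φ - α)
  rw [← ht] at ht01
  obtain ⟨ht0, ht1⟩ := ht01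
  rw [zero_add] at ht1
  have hLs : ∀ s : ℝ, Lf x (α + s) p = R * Real.sin (t - s) := by
    intro s
    rw [hL, show φ - (α + s) = t - s + k * (2 * Real.pi) by linarith, Real.sin_add_int_mul_two_pi]
  have key : ∀ τ : ℝ, 0 ≤ τ → τ < 2 * Real.pi → 0 ≤ Real.sin τ → Real.sin (τ - Δ) < 0 → τ < Δ := by
    intro τ h0 h1 h2 h3
    by_contra h4
    push Not at h4
    have h5 : τ ≤ Real.pi := by
      by_contra h6
      push Not at h6
      have := Real.sin_neg_of_neg_of_neg_pi_lt (x := τ - 2 * Real.pi) (by linarith) (by linarith)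
      rw [Real.sin_sub_two_pi] at this
      linarith
    have := Real.sin_nonneg_of_nonneg_of_le_pi (x := τ - Δ) (by linarith) (by linarith)
    linarith
  have hW : ∀ j : ℕ, j < 6 * N → Wp x (α + j * Δ) Δ p → j * Δ ≤ t ∧ t < (j + 1) * Δ := by
    intro j hj hw
    have hj1 : (j : ℝ) + 1 ≤ 6 * N := by exact_mod_cast hj
    obtain ⟨w1, w2⟩ := hw
    rw [hLs] at w1
    rw [show α + j * Δ + Δ = α + (j * Δ + Δ) by ring, hLs] at w2
    have w1' : 0 ≤ Real.sin (t - j * Δ) := nonneg_of_mul_nonneg_right w1 hR0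
    have w2' : Real.sin (t - j * Δ - Δ) < 0 := by
      rw [show t - j * Δ - Δ = t - (j * Δ + Δ) by ring]
      by_contra hc
      exact absurd w2 (not_lt.2 (mul_nonneg hR0.le (not_lt.1 hc)))
    have hjΔ : ((j : ℝ) + 1) * Δ ≤ 2 * Real.pi := by
      rw [← hΔN]; exact mul_le_mul_of_nonneg_right hj1 hΔ0.le
    have hj0 : 0 ≤ (j : ℝ) * Δ := by positivity
    rcases le_or_gt (j * Δ) t with h1 | h1
    · have := key (t - j * Δ) (by linarith) (by linarith) w1' w2'
      exact ⟨h1, by linarith⟩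
    · exfalso
      have := key (t - j * Δ + 2 * Real.pi) (by linarith) (by linarith)
        (by rw [Real.sin_add_two_pi]; exact w1')
        (by rw [show t - j * Δ + 2 * Real.pi - Δ = t - j * Δ - Δ + 2 * Real.pi by ring,
          Real.sin_add_two_pi]; exact w2')
      linarith
  refine ⟨⌊t / Δ⌋₊, ?_, ?_, ?_, ?_⟩
  · rw [Nat.floor_lt (by positivity), div_lt_iff₀ hΔ0]
    push_cast
    linarith
  all_goals
    have f1 := Nat.floor_le (show 0 ≤ t / Δ by positivity)
    have f2 := Nat.lt_floor_add_one (t / Δ)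
    rw [le_div_iff₀ hΔ0] at f1
    rw [div_lt_iff₀ hΔ0] at f2
  · constructor
    · rw [hLs]
      exact mul_nonneg hR0.le (Real.sin_nonneg_of_nonneg_of_le_pi (by linarith) (by linarith))
    · rw [show α + (⌊t / Δ⌋₊ : ℝ) * Δ + Δ = α + (⌊t / Δ⌋₊ * Δ + Δ) by ring, hLs]
      exact mul_neg_of_pos_of_neg hR0
        (Real.sin_neg_of_neg_of_neg_pi_lt (by linarith) (by linarith))
  · have e1 : p = x + R * Complex.exp (((α + t : ℝ) : ℂ) * Complex.I) := by
      have : Complex.exp (((α + t : ℝ) : ℂ) * Complex.I) = Complex.exp (φ * Complex.I) := by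
        rw [Complex.exp_eq_exp_iff_exists_int]
        refine ⟨-k, ?_⟩
        have : φ = α + t + k * (2 * Real.pi) := by linarith
        rw [this]; push_cast; ring
      rw [this, ← hpe]; ring
    have e2 : dist p (pt x (α + t)) = |R - 1| := by
      rw [Complex.dist_eq]
      have : p - pt x (α + t) = ((R - 1 : ℝ) : ℂ) * Complex.exp (((α + t : ℝ) : ℂ) * Complex.I) := by
        conv_lhs => rw [e1]
        unfold pt; push_cast; ring
      rw [this, norm_mul, Complex.norm_exp_ofReal_mul_I, mul_one, Complex.norm_real, Real.norm_eq_abs]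
    have e3 : dist (pt x (α + t)) (pt x (α + ⌊t / Δ⌋₊ * Δ)) ≤ Δ := by
      unfold pt
      rw [dist_add_left]
      refine (dist_exp_le _ _).trans ?_
      rw [abs_le]; constructor <;> linarith
    have := dist_triangle p (pt x (α + t)) (pt x (α + ⌊t / Δ⌋₊ * Δ))
    linarith
  · intro j hj hw
    obtain ⟨a1, a2⟩ := hW j hj hw
    symm
    rw [Nat.floor_eq_iff (by positivity), le_div_iff₀ hΔ0, div_lt_iff₀ hΔ0]
    exact ⟨a1, a2⟩

end wind

end Hx


open Set Metric Filter Topology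

namespace Hx

variable {c : ℂ → Fin 6} {F : Set (Set ℂ)}

def Yn (c : ℂ → Fin 6) (F : Set (Set ℂ)) (x : ℂ) (a b : Fin 6) : Set ℂ :=
  {y | dist y x = 1 ∧ a ∈ CC c F y ∧ b ∈ CC c F y ∧ ∃ k ∈ CC c F y, k ∈ CC c F x ∧ Nr c F k y x}
def Yf (c : ℂ → Fin 6) (F : Set (Set ℂ)) (x : ℂ) (a b : Fin 6) : Set ℂ :=
  {y | dist y x = 1 ∧ a ∈ CC c F y ∧ b ∈ CC c F y ∧ ∃ k ∈ CC c F y, k ∈ CC c F x ∧ Fa c F k y x}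

/-- the modified disc -/
def Us (c : ℂ → Fin 6) (F : Set (Set ℂ)) (x : ℂ) (a b : Fin 6) (r : ℝ) : Set ℂ :=
  {p | (dist p x < 1 ∧ ∀ y ∈ Yf c F x a b, r < dist p y) ∨ ∃ y ∈ Yn c F x a b, dist p y < r}

/-- separation of non generic points on the circle -/
def Sepd (F : Set (Set ℂ)) (x : ℂ) (s : ℝ) : Prop :=
  ∀ y, dist y x = 1 → ¬ Gn F y → ∀ y', dist y' x = 1 → ¬ Gn F y' → dist y y' < 4 * s → y = y'

section U

variable {x : ℂ} {a b : Fin 6} {r s : ℝ}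

theorem cc_three (h : Col c F) {y : ℂ} {k j : Fin 6} (hab : a ≠ b) (ha : a ∈ CC c F y)
    (hb : b ∈ CC c F y) (hk : k ∈ CC c F y) (hka : k ≠ a) (hkb : k ≠ b) (hj : j ∈ CC c F y) :
    j = a ∨ j = b ∨ j = k := by
  by_contra hc
  push Not at hc
  have hs : ({a, b, k, j} : Finset (Fin 6)) ⊆ CC c F y := by
    intro i hi
    simp only [Finset.mem_insert, Finset.mem_singleton] at hi
    rcases hi with rfl | rfl | rfl | rfl <;> assumption
  have h1 := (Finset.card_le_card hs).trans (E1 h y)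
  have h2 : ({a, b, k, j} : Finset (Fin 6)).card = 4 := by
    rw [Finset.card_insert_of_notMem, Finset.card_insert_of_notMem, Finset.card_insert_of_notMem,
      Finset.card_singleton]
    · simp only [Finset.mem_singleton]; exact fun e => hc.2.2 e.symm
    · simp only [Finset.mem_insert, Finset.mem_singleton]; rintro (e | e)
      · exact hkb e.symm
      · exact hc.2.1 e.symm
    · simp only [Finset.mem_insert, Finset.mem_singleton]; rintro (e | e | e)
      · exact hab e
      · exact hka e.symm
      · exact hc.1 e.symm
  omega

theorem yn_of (h : Col c F) {y : ℂ} {k : Fin 6} (hy : dist y x = 1) (hya : a ∈ CC c F y)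
    (hyb : b ∈ CC c F y) (hky : k ∈ CC c F y) (hkx : k ∈ CC c F x) :
    (y ∈ Yn c F x a b ∧ Nr c F k y x) ∨ (y ∈ Yf c F x a b ∧ Fa c F k y x) := by
  rcases nr_or_fa h k y x with hn | hn
  · exact Or.inl ⟨⟨hy, hya, hyb, k, hky, hkx, hn⟩, hn⟩
  · exact Or.inr ⟨⟨hy, hya, hyb, k, hky, hkx, hn⟩, hn⟩

theorem yn_yf (h : Col c F) (hab : a ≠ b) (ha : a ∉ CC c F x) (hb : b ∉ CC c F x) {y : ℂ}
    (h1 : y ∈ Yn c F x a b) (h2 : y ∈ Yf c F x a b) : False := by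
  obtain ⟨-, hya, hyb, k, hky, hkx, hn⟩ := h1
  obtain ⟨-, -, -, j, hjy, hjx, hf⟩ := h2
  rcases cc_three h hab hya hyb hky (fun e => ha (e ▸ hkx)) (fun e => hb (e ▸ hkx)) hjy with
    e | e | e
  · exact ha (e ▸ hjx)
  · exact hb (e ▸ hjx)
  · subst e; exact nr_fa_false h hn hf hky hkx

theorem yn_ng (h : Col c F) (hab : a ≠ b) {y : ℂ} (h1 : y ∈ Yn c F x a b) :
    dist y x = 1 ∧ ¬ Gn F y := ⟨h1.1, not_gn_of_two h hab h1.2.1 h1.2.2.1⟩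
theorem yf_ng (h : Col c F) (hab : a ≠ b) {y : ℂ} (h1 : y ∈ Yf c F x a b) :
    dist y x = 1 ∧ ¬ Gn F y := ⟨h1.1, not_gn_of_two h hab h1.2.1 h1.2.2.1⟩

theorem yn_fin (h : Col c F) (hab : a ≠ b) : (Yn c F x a b).Finite :=
  (fin_circle h x).subset fun _ hy => yn_ng h hab hy
theorem yf_fin (h : Col c F) (hab : a ≠ b) : (Yf c F x a b).Finite :=
  (fin_circle h x).subset fun _ hy => yf_ng h hab hy

theorem Us_open (h : Col c F) (hab : a ≠ b) : IsOpen (Us c F x a b r) := by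
  have e : Us c F x a b r = (ball x 1 ∩ ⋂ y ∈ Yf c F x a b, (closedBall y r)ᶜ) ∪
      ⋃ y ∈ Yn c F x a b, ball y r := by
    ext p; simp [Us]
  rw [e]
  refine (isOpen_ball.inter ?_).union (isOpen_biUnion fun _ _ => isOpen_ball)
  exact (yf_fin h hab).isOpen_biInter fun y _ => isClosed_closedBall.isOpen_compl

theorem Us_in (hr : 0 < r) {p : ℂ} (hp : dist p x < 1 - r) : p ∈ Us c F x a b r := by
  left
  refine ⟨by linarith, fun y hy => ?_⟩
  have := dist_triangle_left y x p
  rw [hy.1] at this; linarith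

theorem Us_out (hr : 0 < r) {p : ℂ} (hp : p ∈ Us c F x a b r) : dist p x < 1 + r := by
  rcases hp with ⟨h1, -⟩ | ⟨y, hy, h1⟩
  · linarith
  · have := dist_triangle p y x
    rw [hy.1] at this; linarith

theorem Us_fr (h : Col c F) (hab : a ≠ b) (hr : 0 < r) {z : ℂ} (hz : z ∈ frontier (Us c F x a b r)) :
    |dist z x - 1| ≤ r := by
  rw [(Us_open h hab).frontier_eq] at hz
  have h1 : dist z x ≤ 1 + r := by
    have : closure (Us c F x a b r) ⊆ closedBall x (1 + r) :=
      closure_minimal (fun p hp => mem_closedBall.2 (Us_out hr hp).le) isClosed_closedBall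
    exact mem_closedBall.1 (this hz.1)
  have h2 : 1 - r ≤ dist z x := by
    by_contra hc; exact hz.2 (Us_in hr (not_le.1 hc))
  rw [abs_le]; constructor <;> linarith

theorem Us_near {y p : ℂ} (hy : y ∈ Yn c F x a b) (hp : dist p y < r) : p ∈ Us c F x a b r :=
  Or.inr ⟨y, hy, hp⟩

theorem Us_far (h : Col c F) (hab : a ≠ b) (ha : a ∉ CC c F x) (hb : b ∉ CC c F x)
    (hs : Sepd F x s) (hrs : r ≤ s) (hr : 0 < r) {y p : ℂ}
    (hy : y ∈ Yf c F x a b) (hp : dist p y ≤ r) : p ∉ Us c F x a b r := by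
  rintro (⟨-, h1⟩ | ⟨y', hy', h1⟩)
  · exact absurd (h1 y hy) (not_lt.2 hp)
  · have := dist_triangle_left y y' p
    have e := hs y (yf_ng h hab hy).1 (yf_ng h hab hy).2 y' (yn_ng h hab hy').1 (yn_ng h hab hy').2
      (by linarith)
    subst e
    exact yn_yf h hab ha hb hy' hy

theorem Us_else {p : ℂ} (h1 : ∀ y ∈ Yn c F x a b, ¬ dist p y < r)
    (h2 : ∀ y ∈ Yf c F x a b, ¬ dist p y ≤ r) : p ∈ Us c F x a b r ↔ dist p x < 1 := by
  constructor
  · rintro (⟨h3, -⟩ | ⟨y, hy, h3⟩)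
    · exact h3
    · exact absurd h3 (h1 y hy)
  · intro h3; exact Or.inl ⟨h3, fun y hy => not_le.1 (h2 y hy)⟩

/-- the frontier only sees a, b near a,b-points -/
theorem star (h : Col c F) (hx : (CC c F x).card = 3) (hab : a ≠ b) (ha : a ∉ CC c F x)
    (hb : b ∉ CC c F x) (hs : Sepd F x s) (hrs : r ≤ s) (hr : 0 < r) {z y : ℂ}
    (hz : z ∈ frontier (Us c F x a b r)) (hy : dist y x = 1) (hya : a ∈ CC c F y)
    (hyb : b ∈ CC c F y) (hzy : Sub c F z y) (hd : dist z y < s) {k : Fin 6} (hk : k ∈ CC c F z) :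
    k = a ∨ k = b := by
  by_contra hc
  push Not at hc
  rw [(Us_open h hab).frontier_eq] at hz
  obtain ⟨hz1, hz2⟩ := hz
  obtain ⟨P, hP⟩ := mem_CC.1 hk
  have hPy := hzy _ _ hP
  have hky : k ∈ CC c F y := hPy.mem
  have hkx : k ∈ CC c F x := third_color h hx hy ha hb hab hya hyb hc.1 hc.2 hky
  have hyng := not_gn_of_two h hab hya hyb
  have hzng : dist z x = 1 → z = y := by
    intro h1
    have : ¬ Gn F z := by
      intro hg
      have := gn_not_mem h hg h1
      rw [← gn_CC h hg hk] at this
      exact this hkx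
    exact hs z h1 this y hy hyng (by linarith)
  obtain ⟨Q, hQ⟩ := mem_CC.1 hkx
  rcases yn_of h hy hya hyb hky hkx with ⟨hyn, hn⟩ | ⟨hyf, hf⟩
  · have hle : dist z x ≤ 1 := hn P Q hPy hQ z hP.2.1 x hQ.2.1
    rcases hle.lt_or_eq with hlt | heq
    · have : ∃ y' ∈ Yf c F x a b, dist z y' ≤ r := by
        by_contra hc'
        push Not at hc'
        exact hz2 (Or.inl ⟨hlt, hc'⟩)
      obtain ⟨y', hy', hd'⟩ := this
      have := dist_triangle_left y y' z
      have e := hs y hy hyng y' (yf_ng h hab hy').1 (yf_ng h hab hy').2 (by linarith)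
      subst e
      exact yn_yf h hab ha hb hyn hy'
    · have e := hzng heq
      subst e
      exact hz2 (Us_near hyn (by rwa [dist_self]))
  · have hge : 1 ≤ dist z x := hf P Q hPy hQ z hP.2.1 x hQ.2.1
    have hcl : z ∈ closure (ball z r ∩ Us c F x a b r) :=
      mem_closure_iff_nhdsWithin_neBot.2 (by
        rw [nhdsWithin_inter_of_mem (mem_nhdsWithin_of_mem_nhds (ball_mem_nhds z hr))]
        exact mem_closure_iff_nhdsWithin_neBot.1 hz1)
    have hsub : ball z r ∩ Us c F x a b r ⊆ closedBall x 1 ∩ {p | r ≤ dist p y} := by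
      rintro p ⟨hp1, hp2⟩
      rcases hp2 with ⟨h1, h2⟩ | ⟨y', hy', h1⟩
      · exact ⟨mem_closedBall.2 h1.le, (h2 y hyf).le⟩
      · exfalso
        have t1 := dist_triangle_left y y' p
        have t2 := dist_triangle p z y
        have e := hs y hy hyng y' (yn_ng h hab hy').1 (yn_ng h hab hy').2
          (by rw [mem_ball] at hp1; linarith)
        subst e
        exact yn_yf h hab ha hb hy' hyf
    have hcl' := closure_minimal hsub (isClosed_closedBall.inter
      (isClosed_le continuous_const (by fun_prop))) hcl
    have e := hzng (le_antisymm (mem_closedBall.1 hcl'.1) hge)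
    have := hcl'.2
    rw [mem_setOf_eq, e, dist_self] at this
    linarith

end U

end Hx


open Set Metric Filter Topology

namespace Hx

variable {c : ℂ → Fin 6} {F : Set (Set ℂ)}

noncomputable def om2 (κ : L → Fin 6) (a b : Fin 6) (u v : L) : ZMod 2 :=
  I2 ((κ u = a ∧ κ v = b) ∨ (κ u = b ∧ κ v = a))

theorem col_dec : ∀ p1 p2 q1 q2 r1 r2 : Bool, (p1 && p2) = false → (q1 && q2) = false →
    (r1 && r2) = false →
    (if (!p1 && !p2 && q1 && r2) then 1 else 0 : ZMod 2) + (if (!p1 && !p2 && r1 && q2) then 1 else 0) +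
    (if (!q1 && !q2 && p1 && r2) then 1 else 0) + (if (!q1 && !q2 && r1 && p2) then 1 else 0) +
    (if (!r1 && !r2 && p1 && q2) then 1 else 0) + (if (!r1 && !r2 && q1 && p2) then 1 else 0) =
    (if ((p1 && q2) || (p2 && q1)) then 1 else 0) + (if ((q1 && r2) || (q2 && r1)) then 1 else 0) +
    (if ((p1 && r2) || (p2 && r1)) then 1 else 0) := by decide

theorem I2_dec (p : Prop) [Decidable p] : I2 p = if p then 1 else 0 := by
  by_cases h : p
  · rw [I2_true h, if_pos h]
  · rw [I2_false h, if_neg h]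

theorem col_id {κ : L → Fin 6} {a b : Fin 6} (hab : a ≠ b) (u v w : L) :
    sy (fun u v w => I2 (κ u ≠ a ∧ κ u ≠ b ∧ κ v = a ∧ κ w = b)) u v w =
      om2 κ a b u v + om2 κ a b v w + om2 κ a b u w := by
  have hx : ∀ u, (decide (κ u = a) && decide (κ u = b)) = false := by
    intro u
    by_cases h : κ u = a
    · simp [h, hab]
    · simp [h]
  have := col_dec (decide (κ u = a)) (decide (κ u = b)) (decide (κ v = a)) (decide (κ v = b))
    (decide (κ w = a)) (decide (κ w = b)) (hx u) (hx v) (hx w)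
  simp only [sy, om2, I2_dec]
  simpa [and_assoc] using this

theorem tri_br {δ : ℝ} {M : ℕ} {U : Set ℂ} {κ : L → Fin 6} {a b : Fin 6} (hab : a ≠ b)
    (hs : ∀ q, ps δ q ∈ U → inb M q) (G : L → Prop)
    (TC : ∀ q u v w, adj q u → adj q v → adj q w → κ v = a → κ w = b → κ u ≠ a → κ u ≠ b →
      (ps δ q ∈ U ↔ G u)) :
    Tg M (fun u v w => I2 (κ u ≠ a ∧ κ u ≠ b ∧ G u ∧ κ v = a ∧ κ w = b)) =
      Br δ M U (om2 κ a b) := by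
  rw [← Br_sq hs]
  unfold Tg
  have key : ∀ q u v w, adj q u → adj q v → adj q w →
      sy (fun u v w => I2 (κ u ≠ a ∧ κ u ≠ b ∧ G u ∧ κ v = a ∧ κ w = b)) u v w =
      I2 (ps δ q ∈ U) * (om2 κ a b u v + om2 κ a b v w + om2 κ a b u w) := by
    intro q u v w h1 h2 h3
    have t : ∀ u v w, adj q u → adj q v → adj q w →
        I2 (κ u ≠ a ∧ κ u ≠ b ∧ G u ∧ κ v = a ∧ κ w = b) =
        I2 (ps δ q ∈ U) * I2 (κ u ≠ a ∧ κ u ≠ b ∧ κ v = a ∧ κ w = b) := by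
      intro u v w h1 h2 h3
      rw [← I2_and]
      apply I2_congr
      constructor
      · rintro ⟨k1, k2, k3, k4, k5⟩
        exact ⟨(TC q u v w h1 h2 h3 k4 k5 k1 k2).2 k3, k1, k2, k4, k5⟩
      · rintro ⟨k3, k1, k2, k4, k5⟩
        exact ⟨k1, k2, (TC q u v w h1 h2 h3 k4 k5 k1 k2).1 k3, k4, k5⟩
    rw [← col_id hab]
    simp only [sy]
    rw [t u v w h1 h2 h3, t u w v h1 h3 h2, t v u w h2 h1 h3, t v w u h2 h3 h1, t w u v h3 h1 h2,
      t w v u h3 h2 h1]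
    ring
  refine Finset.sum_congr rfl fun q _ => ?_
  rw [key q q _ _ (adj_refl q) (by simp [adj]) (by simp [adj]),
    key q q _ _ (adj_refl q) (by simp [adj]) (by simp [adj])]
  linear_combination (I2 (ps δ q ∈ U) * om2 κ a b q (q + (1, 1))) * z2_two

section H3

variable {x : ℂ} {a b : Fin 6} {r s : ℝ}

theorem compl_cover (hx : (CC c F x).card = 3) {y : ℂ} {k : Fin 6} (hab : a ≠ b) (hka : k ≠ a)
    (hkb : k ≠ b) (ha : a ∉ CC c F x) (hb : b ∉ CC c F x) (hk : k ∉ CC c F x)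
    (hay : a ∈ CC c F y) (hby : b ∈ CC c F y) (hky : k ∈ CC c F y) (i : Fin 6) :
    i ∈ CC c F y ∨ i ∈ CC c F x := by
  by_contra hc
  push Not at hc
  have hs : ({a, b, k, i} : Finset (Fin 6)) ⊆ (CC c F x)ᶜ := by
    intro j hj
    simp only [Finset.mem_insert, Finset.mem_singleton] at hj
    rw [Finset.mem_compl]
    rcases hj with rfl | rfl | rfl | rfl
    · exact ha
    · exact hb
    · exact hk
    · exact hc.2
  have h1 := Finset.card_le_card hs
  rw [Finset.card_compl, hx, Fintype.card_fin] at h1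
  have h2 : ({a, b, k, i} : Finset (Fin 6)).card = 4 := by
    rw [Finset.card_insert_of_notMem, Finset.card_insert_of_notMem, Finset.card_insert_of_notMem,
      Finset.card_singleton]
    · simp only [Finset.mem_singleton]; exact fun e => hc.1 (e ▸ hky)
    · simp only [Finset.mem_insert, Finset.mem_singleton]; rintro (e | e)
      · exact hkb e.symm
      · exact hc.1 (e ▸ hby)
    · simp only [Finset.mem_insert, Finset.mem_singleton]; rintro (e | e | e)
      · exact hab e
      · exact hka e.symm
      · exact hc.1 (e ▸ hay)
  omega

/-- termwise comparison -/
theorem TC (h : Col c F) (hx : (CC c F x).card = 3) (hab : a ≠ b) (ha : a ∉ CC c F x)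
    (hb : b ∉ CC c F x) (hs : Sepd F x s) (hrs : r ≤ s) (hr : 0 < r) (hs1 : s ≤ 1 / 8)
    (hsub : ∀ y, dist y x = 1 → ¬ Gn F y → ∀ p, dist p y < 2 * s → Sub c F p y)
    {η : ℝ} (hη1 : η < 1) (hη : ∀ v, dist v x = 1 → ∃ y, dist y x = 1 ∧ ∀ u, dist u v < η → Sub c F u y ∧ dist u y < r)
    {η' : ℝ} (hη' : ∀ v, dist v x ≤ 2 → ∃ y, ∀ u, dist u v < η' → Sub c F u y ∧ dist u y < 1 / 4)
    {d : ℝ} (hd0 : 0 < d) (hd : 2 * d < η) (hd' : d < η') (hds : d < s)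
    {V : Set ℂ} (hV : ∀ v ∈ V, Sub c F v x) (hVs : ∀ k ∈ CC c F x, ∃ v ∈ V, c v = k)
    {q u v w : ℂ} (qu : dist u q ≤ d) (qv : dist v q ≤ d) (qw : dist w q ≤ d)
    (cv : c v = a) (cw : c w = b) (cua : c u ≠ a) (cub : c u ≠ b) :
    q ∈ Us c F x a b r ↔ ∃ z ∈ V, c u = c z ∧ dist z u < 1 := by
  by_cases hk : c u ∈ CC c F x
  · -- main case
    obtain ⟨z0, hz0, cz0⟩ := hVs _ hk
    have hnr : ∀ y z, Sub c F u y → z ∈ V → c u = c z → dist z u < 1 → Nr c F (c u) y x := by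
      intro y z hu hz e hd
      have := nr_of_sub h (hV z hz) hu e.symm hd
      rw [← e] at this; exact this.symm
    have hfa : ∀ y z, Sub c F u y → z ∈ V → c u = c z → ¬ dist z u < 1 → Fa c F (c u) y x := by
      intro y z hu hz e hd
      have := fa_of_sub h (hV z hz) hu e.symm hd
      rw [← e] at this; exact this.symm
    have caseA : ∀ y, dist y x = 1 → Sub c F u y → Sub c F v y → Sub c F w y → dist q y < r →
        (q ∈ Us c F x a b r ↔ ∃ z ∈ V, c u = c z ∧ dist z u < 1) := by
      intro y hy hu hv hw hq
      have huy := hu.cmem h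
      rcases yn_of h hy (cv ▸ hv.cmem h) (cw ▸ hw.cmem h) huy hk with ⟨hyn, hn⟩ | ⟨hyf, hf⟩
      · refine iff_of_true (Us_near hyn hq) ⟨z0, hz0, cz0.symm, ?_⟩
        by_contra hc
        exact nr_fa_false h hn (hfa y z0 hu hz0 cz0.symm hc) huy hk
      · refine iff_of_false (Us_far h hab ha hb hs hrs hr hyf hq.le) ?_
        rintro ⟨z, hz, e, hd⟩
        exact nr_fa_false h (hnr y z hu hz e hd) hf huy hk
    by_cases hrad : |dist q x - 1| ≤ η / 2
    · have hη2 : 0 < η := by linarith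
      obtain ⟨p, hp, hqp⟩ := proj_circle hrad (by linarith)
      obtain ⟨y, hy, hyy⟩ := hη p hp
      have tr : ∀ u, dist u q ≤ d → dist u p < η := fun u hu => by
        have := dist_triangle u q p; linarith
      exact caseA y hy (hyy u (tr u qu)).1 (hyy v (tr v qv)).1 (hyy w (tr w qw)).1
        (hyy q (by linarith)).2
    · by_cases hYn : ∃ y ∈ Yn c F x a b, dist q y < r
      · obtain ⟨y, hy, hqy⟩ := hYn
        have hng := yn_ng h hab hy
        have tr : ∀ u, dist u q ≤ d → Sub c F u y := fun u hu => by
          have := dist_triangle u q y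
          exact hsub y hng.1 hng.2 u (by linarith)
        exact caseA y hng.1 (tr u qu) (tr v qv) (tr w qw) hqy
      by_cases hYf : ∃ y ∈ Yf c F x a b, dist q y ≤ r
      · obtain ⟨y, hy, hqy⟩ := hYf
        have hng := yf_ng h hab hy
        have tr : ∀ u, dist u q ≤ d → Sub c F u y := fun u hu => by
          have := dist_triangle u q y
          exact hsub y hng.1 hng.2 u (by linarith)
        have huy := (tr u qu).cmem h
        refine iff_of_false (Us_far h hab ha hb hs hrs hr hy hqy) ?_
        rintro ⟨z, hz, e, hd⟩
        rcases yn_of h hng.1 hy.2.1 hy.2.2.1 huy hk with ⟨hyn, hn⟩ | ⟨-, hf⟩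
        · exact yn_yf h hab ha hb hyn hy
        · exact nr_fa_false h (hnr y z (tr u qu) hz e hd) hf huy hk
      push Not at hYn hYf
      rw [Us_else (fun y hy => not_lt.2 (hYn y hy)) (fun y hy => not_le.2 (hYf y hy))]
      have hmem := c_mem h u
      have t1 := dist_triangle u q x
      have t2 := dist_triangle_left q x u
      constructor
      · intro hq
        refine ⟨z0, hz0, cz0.symm, ?_⟩
        by_contra hc
        have := (hfa u z0 (sub_refl u) hz0 cz0.symm hc).ge hmem hk
        rw [abs_of_neg (by linarith)] at hrad
        linarith
      · rintro ⟨z, hz, e, hd⟩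
        have := (hnr u z (sub_refl u) hz e hd).le hmem hk
        by_contra hc
        rw [abs_of_nonneg (by linarith)] at hrad
        linarith
  · refine iff_of_false ?_ ?_
    · intro hq
      have h1 := Us_out hr hq
      obtain ⟨y, hy⟩ := hη' q (by linarith)
      have k1 := (hy u (by linarith)).1.cmem h
      have k2 := (hy v (by linarith)).1.cmem h
      have k3 := (hy w (by linarith)).1.cmem h
      have k4 := (hy q (by rw [dist_self]; linarith)).2
      rw [cv] at k2
      rw [cw] at k3
      have hne : y ≠ x := by rintro rfl; exact ha k2
      have := E3 h (compl_cover hx hab cua cub ha hb hk k2 k3 k1) hne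
      have := dist_triangle_left y x q
      linarith
    · rintro ⟨z, hz, e, -⟩
      exact hk (e ▸ (hV z hz).cmem h)

theorem om2_zero {κ : L → Fin 6} {C : Finset (Fin 6)} (hC : ¬ (a ∈ C ∧ b ∈ C)) {u v : L}
    (hu : κ u ∈ C) (hv : κ v ∈ C) : om2 κ a b u v = 0 := by
  apply I2_false
  rintro (⟨e1, e2⟩ | ⟨e1, e2⟩)
  · exact hC ⟨e1 ▸ hu, e2 ▸ hv⟩
  · exact hC ⟨e2 ▸ hv, e1 ▸ hu⟩

theorem ab_sum (hab : a ≠ b) {i j : Fin 6} (hi : i = a ∨ i = b) (hj : j = a ∨ j = b) :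
    I2 ((i = a ∧ j = b) ∨ (i = b ∧ j = a)) = I2 (i = a) + I2 (j = a) := by
  rcases hi with rfl | rfl <;> rcases hj with rfl | rfl
  · rw [z2_add_self]; apply I2_false; rintro (⟨-, e⟩ | ⟨e, -⟩) <;> exact hab e
  · rw [I2_true (Or.inl ⟨rfl, rfl⟩), I2_true rfl, I2_false hab.symm, add_zero]
  · rw [I2_true (Or.inr ⟨rfl, rfl⟩), I2_true rfl, I2_false hab.symm, zero_add]
  · rw [z2_add_self]; apply I2_false; rintro (⟨e, -⟩ | ⟨-, e⟩) <;> exact hab e.symm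

theorem JB (h : Col c F) (hx : (CC c F x).card = 3) (hab : a ≠ b) (ha : a ∉ CC c F x)
    (hb : b ∉ CC c F x) (hs : Sepd F x s) (hrs : r ≤ s) (hr : 0 < r) (hs1 : r ≤ 1 / 8)
    {η : ℝ} (hη : ∀ v, dist v x = 1 → ∃ y, dist y x = 1 ∧ ∀ u, dist u v < η → Sub c F u y ∧ dist u y < s)
    {N : ℕ} (hN : 0 < N) {Δ α : ℝ} (hΔ : Δ = Real.pi / (3 * N))
    (hgn : ∀ i : ℕ, Gn F (pt x (α + i * Δ)))
    (hJ : ∑ i ∈ Finset.range (6 * N),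
      I2 ((c (pt x (α + i * Δ)) = a ∧ c (pt x (α + (i + 1 : ℕ) * Δ)) = b) ∨
          (c (pt x (α + i * Δ)) = b ∧ c (pt x (α + (i + 1 : ℕ) * Δ)) = a)) = 1)
    {ρ : ℝ} (hmono : ∀ i ≤ 6 * N, ∀ p, dist p (pt x (α + i * Δ)) < ρ → c p = c (pt x (α + i * Δ)))
    {δ : ℝ} {M : ℕ} (hδ : 0 < δ)
    (hρ : r + 20 * δ < ρ) (hρ1 : ρ ≤ 1 / 8) (hsin : 4 * ρ ≤ Real.sin Δ) (hcos : 0 ≤ Real.cos Δ)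
    (k1 : 2 * ρ ≤ Real.cos α) (k2 : Real.cos (α + Δ) ≤ - (2 * ρ))
    {η2 : ℝ} (hη2 : ∀ z ∈ frontier (Us c F x a b r), ∃ w ∈ frontier (Us c F x a b r),
      ∀ u, dist u z < η2 → Sub c F u w ∧ dist u w < η / 8)
    (d1 : 4 * δ < η2) (d2 : Δ < η / 4) (d3 : r + 4 * δ < η / 4)
    (hsupp : ∀ q, ps δ q ∈ Us c F x a b r → inb M q) :
    Br δ M (Us c F x a b r) (om2 (fun q => c (ps δ q)) a b) = 1 := by
  set U := Us c F x a b r with hU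
  have hfr : ∀ z ∈ frontier U, |dist z x - 1| ≤ r := fun z hz => Us_fr h hab hr hz
  choose y hy hyy using fun i : ℕ => hη (pt x (α + i * Δ)) (pt_cen _ _)
  set g : ℕ → ZMod 2 := fun i => I2 (a ∈ CC c F (y i) ∧ b ∈ CC c F (y i)) with hg
  set χ : L → ZMod 2 := fun q => I2 (c (ps δ q) = a) with hχ
  have hΔ0 : 0 < Δ := by rw [hΔ]; have := Real.pi_pos; positivity
  have step1 : Br δ M U (om2 (fun q => c (ps δ q)) a b) =
      Br δ M U (fun u v => ∑ i ∈ Finset.range (6 * N),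
        g i * (I2 (Wp x (α + i * Δ) Δ (ps δ u)) * (χ u + χ v))) := by
    apply Br_congr hδ
    intro u v huv hu
    have hrad := Wp_step hδ hfr hu
    have hne : ps δ u ≠ x := by
      intro e; rw [e, dist_self] at hrad
      have := abs_le.1 hrad; linarith
    obtain ⟨i, hi, hW, hdi, huniq⟩ := P4 hN α hne hΔ
    rw [Finset.sum_eq_single i]
    rotate_left
    · intro j hj hji
      rw [I2_false (p := Wp x (α + j * Δ) Δ (ps δ u))
        (fun hw => hji (huniq j (Finset.mem_range.1 hj) hw))]
      simp
    · intro hi'; exact absurd (Finset.mem_range.2 hi) hi'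
    rw [I2_true hW, one_mul]
    obtain ⟨z, hz, hzu⟩ := hu
    have huv' := ps_adj hδ huv
    rw [dist_comm] at huv'
    have su := hyy i (ps δ u) (by linarith)
    have sv := hyy i (ps δ v) (by
      have := dist_triangle (ps δ v) (ps δ u) (pt x (α + i * Δ)); linarith)
    by_cases hgi : a ∈ CC c F (y i) ∧ b ∈ CC c F (y i)
    · simp only [hg]
      rw [I2_true hgi, one_mul]
      obtain ⟨w, hw, hww⟩ := hη2 z hz
      have wu := hww (ps δ u) (by linarith)
      have wv := hww (ps δ v) (by
        have := dist_triangle (ps δ v) (ps δ u) z; linarith)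
      have sw := hyy i w (by
        have := dist_triangle_left w (pt x (α + i * Δ)) (ps δ u)
        linarith [wu.2])
      have hst : ∀ k ∈ CC c F w, k = a ∨ k = b := fun k hk =>
        star h hx hab ha hb hs hrs hr hw (hy i) hgi.1 hgi.2 sw.1 sw.2 hk
      exact ab_sum hab (hst _ (wu.1.cmem h)) (hst _ (wv.1.cmem h))
    · simp only [hg]
      rw [I2_false hgi, zero_mul]
      exact om2_zero (κ := fun q => c (ps δ q)) hgi (su.1.cmem h) (sv.1.cmem h)
  rw [step1, Br_sum, ← hJ]
  refine Finset.sum_congr rfl fun i hi => ?_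
  have hi' := Finset.mem_range.1 hi
  have e1 : α + ((i + 1 : ℕ) : ℝ) * Δ = α + i * Δ + Δ := by push_cast; ring
  have hm1 := hmono i (by omega)
  have hm2 := hmono (i + 1) (by omega)
  have hg1 := hgn i
  have hg2 := hgn (i + 1)
  have hk1 := hyy i (pt x (α + i * Δ)) (by rw [dist_self]; linarith)
  have hk2 := hyy i (pt x (α + (i + 1 : ℕ) * Δ)) (by
    unfold pt
    rw [dist_add_left]
    refine (dist_exp_le _ _).trans_lt ?_
    rw [e1, show α + i * Δ + Δ - (α + i * Δ) = Δ by ring, abs_of_pos hΔ0]; linarith)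
  rw [e1] at *
  rw [Br_mul, BrW hsupp hδ hfr hr hρ hρ1 hsin hcos χ (I2 (c (pt x (α + i * Δ)) = a))
    (I2 (c (pt x (α + i * Δ + Δ)) = a)) (fun q hq => by simp only [hχ]; rw [hm1 _ hq])
    (fun q hq => by simp only [hχ]; rw [hm2 _ hq]),
    Ai_eq hsupp hδ hfr hr hρ hρ1 hsin hcos, Ai_all hsupp hδ hfr hr hρ hρ1 hsin hcos,
    Ai_one hsupp hδ hfr hr hρ hρ1 hsin hcos (fun p hp => Us_in hr (by linarith)) hs1 k1 k2,
    mul_one, mul_one]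
  by_cases hgi : a ∈ CC c F (y i) ∧ b ∈ CC c F (y i)
  · simp only [hg]
    rw [I2_true hgi, one_mul]
    have hst : ∀ p, Gn F p → dist p x = 1 → Sub c F p (y i) → c p = a ∨ c p = b := by
      intro p hp hpx hps
      by_contra hc
      push Not at hc
      exact gn_not_mem h hp hpx
        (third_color h hx (hy i) ha hb hab hgi.1 hgi.2 hc.1 hc.2 (hps.cmem h))
    rw [ab_sum hab (hst _ hg1 (pt_cen _ _) hk1.1) (hst _ hg2 (pt_cen _ _) hk2.1)]
  · simp only [hg]
    rw [I2_false hgi, zero_mul]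
    symm
    apply I2_false
    rintro (⟨f1, f2⟩ | ⟨f1, f2⟩)
    · exact hgi ⟨f1 ▸ hk1.1.cmem h, f2 ▸ hk2.1.cmem h⟩
    · exact hgi ⟨f2 ▸ hk2.1.cmem h, f1 ▸ hk1.1.cmem h⟩

end H3

end Hx


open Set Metric Filter Topology

namespace Hx

variable {c : ℂ → Fin 6} {F : Set (Set ℂ)}

theorem alpha_ex (h : Col c F) (x : ℂ) {Δ lo hi : ℝ} (hlt : lo < hi) :
    ∃ α, lo < α ∧ α < hi ∧ ∀ i : ℕ, Gn F (pt x (α + i * Δ)) := by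
  have hc : (⋃ i : ℕ, {θ : ℝ | ¬ Gn F (pt x (θ + i * Δ))}).Countable := by
    apply countable_iUnion
    intro i
    have := bad_gn h x (Complex.exp (((i * Δ : ℝ) : ℂ) * Complex.I)) (Complex.norm_exp_ofReal_mul_I _)
    refine this.mono ?_
    intro θ hθ hg
    apply hθ
    have e : pt x (θ + i * Δ) = x + Complex.exp (((i * Δ : ℝ) : ℂ) * Complex.I) *
        Complex.exp (θ * Complex.I) := by
      rw [pt, ← Complex.exp_add]
      congr 2; push_cast; ring
    rw [e]; exact hg
  obtain ⟨α, h1, h2⟩ := (hc.dense_compl ℝ).exists_between hlt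
  refine ⟨α, h2.1, h2.2, fun i => ?_⟩
  by_contra hg
  exact h1 (mem_iUnion.2 ⟨i, hg⟩)

theorem mono_ball (h : Col c F) (f : ℕ → ℂ) (hf : ∀ i, Gn F (f i)) (n : ℕ) :
    ∃ ρ > (0:ℝ), ∀ i ≤ n, ∀ p, dist p (f i) < ρ → c p = c (f i) := by
  have one : ∀ i, ∃ ρ > (0:ℝ), ∀ p, dist p (f i) < ρ → c p = c (f i) := by
    intro i
    obtain ⟨P, hP, hx⟩ := hf i
    obtain ⟨ρ, hρ, hb⟩ := Metric.isOpen_iff.1 (h.opn P hP) _ hx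
    exact ⟨ρ, hρ, fun p hp => h.const P hP _ (hb hp) _ hx⟩
  induction n with
  | zero =>
    obtain ⟨ρ, hρ, H⟩ := one 0
    refine ⟨ρ, hρ, fun i hi => ?_⟩
    obtain rfl : i = 0 := by omega
    exact H
  | succ n ih =>
    obtain ⟨ρ, hρ, H⟩ := ih
    obtain ⟨ρ', hρ', H'⟩ := one (n + 1)
    refine ⟨min ρ ρ', lt_min hρ hρ', fun i hi p hp => ?_⟩
    rcases Nat.lt_or_ge n i with hl | hl
    · obtain rfl : i = n + 1 := by omega
      exact H' p (hp.trans_le (min_le_right _ _))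
    · exact H i hl p (hp.trans_le (min_le_left _ _))

theorem leb_sub (h : Col c F) {K : Set ℂ} (hK : IsCompact K) {r : ℝ} (hr : 0 < r) :
    ∃ η > (0:ℝ), ∀ v ∈ K, ∃ w ∈ K, ∀ u, dist u v < η → Sub c F u w ∧ dist u w < r := by
  obtain ⟨Λ, hΛ, η, hη, H⟩ := leb (R := fun u v => Sub c F u v ∧ dist u v < r)
    hK (fun v _ => (sub_ev h v).and (eventually_nhds_iff_ball.2 ⟨r, hr, fun u hu => hu⟩))
  refine ⟨η, hη, fun v hv => ?_⟩
  obtain ⟨w, hw, hw'⟩ := H v hv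
  exact ⟨w, hΛ w hw, hw'⟩

theorem H3ab (h : Col c F) (x : ℂ) (hx20 : ‖x‖ ≤ 20) (hx : (CC c F x).card = 3) {a b : Fin 6}
    (hab : a ≠ b) (ha : a ∉ CC c F x) (hb : b ∉ CC c F x) :
    ∃ δ0 > (0:ℝ), ∀ δ : ℝ, 0 < δ → δ < δ0 → ∀ M : ℕ,
    40 ≤ δ * (M - 2) → ∀ v1 v2 v3 : L, Sub c F (ps δ v1) x → Sub c F (ps δ v2) x →
    Sub c F (ps δ v3) x → c (ps δ v1) ≠ c (ps δ v2) → c (ps δ v1) ≠ c (ps δ v3) →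
    c (ps δ v2) ≠ c (ps δ v3) →
    hh (fun q => c (ps δ q)) (ps δ) M v1 a b + hh (fun q => c (ps δ q)) (ps δ) M v2 a b +
      hh (fun q => c (ps δ q)) (ps δ) M v3 a b = 1 := by
  obtain ⟨s, hs0, hs8, hsep, hsub⟩ := circle_data h x (r0 := 1 / 8) (by norm_num)
  obtain ⟨η, hη0, hη⟩ := circle_leb h x hs0
  obtain ⟨N0, hE2⟩ := E2 h hx
  have hpi := Real.pi_pos
  obtain ⟨N1, hN1⟩ := exists_nat_gt (4 * Real.pi / η)
  set N := N0 + N1 + 2 with hN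
  have hNpos : 0 < N := by omega
  have hNR : (N1 : ℝ) ≤ N := by rw [hN]; push_cast; linarith [(Nat.cast_nonneg N0 : (0:ℝ) ≤ N0)]
  have hN2 : (2 : ℝ) ≤ N := by
    rw [hN]; push_cast
    linarith [(Nat.cast_nonneg N0 : (0:ℝ) ≤ N0), (Nat.cast_nonneg N1 : (0:ℝ) ≤ N1)]
  set Δ := Real.pi / (3 * N) with hΔ
  have hΔ0 : 0 < Δ := by positivity
  have hΔη : Δ < η / 4 := by
    rw [div_lt_iff₀ hη0] at hN1
    rw [hΔ, div_lt_iff₀ (by positivity)]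
    nlinarith
  have hΔ2 : Δ < Real.pi / 2 := by
    rw [hΔ, div_lt_iff₀ (by positivity)]
    nlinarith
  obtain ⟨α, hα1, hα2, hgn⟩ := alpha_ex h x (Δ := Δ) (show Real.pi / 2 - Δ < Real.pi / 2 by linarith)
  have hJ := hE2 N (by omega) hNpos α hgn a b ha hb hab
  have hsin : 0 < Real.sin Δ := Real.sin_pos_of_pos_of_lt_pi hΔ0 (by linarith)
  have hcos : 0 ≤ Real.cos Δ := Real.cos_nonneg_of_neg_pi_div_two_le_of_le (by linarith) hΔ2.le
  have hca : 0 < Real.cos α := Real.cos_pos_of_mem_Ioo ⟨by linarith, hα2⟩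
  have hca' : Real.cos (α + Δ) < 0 :=
    Real.cos_neg_of_pi_div_two_lt_of_lt (by linarith) (by linarith)
  obtain ⟨ρ0, hρ0, hmono0⟩ := mono_ball h (fun i => pt x (α + i * Δ)) hgn (6 * N)
  obtain ⟨ρ, hρ, l1, l2, l3, l4, l5⟩ : ∃ ρ > (0:ℝ), ρ ≤ ρ0 ∧ ρ ≤ 1 / 8 ∧ 4 * ρ ≤ Real.sin Δ ∧
      2 * ρ ≤ Real.cos α ∧ Real.cos (α + Δ) ≤ - (2 * ρ) := by
    refine ⟨min ρ0 (min (1/8) (min (Real.sin Δ / 4) (min (Real.cos α / 2) (- Real.cos (α + Δ) / 2)))),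
      ?_, ?_⟩
    · have : 0 < - Real.cos (α + Δ) := by linarith
      positivity
    · generalize ht : min ρ0 (min (1/8) (min (Real.sin Δ / 4)
        (min (Real.cos α / 2) (- Real.cos (α + Δ) / 2)))) = t
      have ht := ht.ge
      simp only [le_min_iff] at ht
      obtain ⟨t1, t2, t3, t4, t5⟩ := ht
      refine ⟨t1, t2, by linarith, by linarith, by linarith⟩
  obtain ⟨r, hr, m1, m2, m3⟩ : ∃ r > (0:ℝ), r ≤ s ∧ r ≤ η / 8 ∧ r ≤ ρ / 8 :=
    ⟨min s (min (η / 8) (ρ / 8)), by positivity, min_le_left _ _,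
      (min_le_right _ _).trans (min_le_left _ _), (min_le_right _ _).trans (min_le_right _ _)⟩
  have hfrK : IsCompact (frontier (Us c F x a b r)) := by
    apply (isCompact_closedBall x (1 + r)).of_isClosed_subset isClosed_frontier
    intro z hz
    have := (abs_le.1 (Us_fr h hab hr hz)).2
    rw [mem_closedBall]; linarith
  obtain ⟨η2, hη2, H2'⟩ := leb_sub h hfrK (show 0 < η / 8 by positivity)
  obtain ⟨η3', hη3', H3'⟩ := circle_leb h x hr
  obtain ⟨η3, hη3, n1, H3⟩ : ∃ η3 > (0:ℝ), η3 < 1 ∧ ∀ v, dist v x = 1 → ∃ y, dist y x = 1 ∧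
      ∀ u, dist u v < η3 → Sub c F u y ∧ dist u y < r := by
    refine ⟨min η3' (1/2), by positivity, (min_le_right _ _).trans_lt (by norm_num), ?_⟩
    intro v hv
    obtain ⟨y, hy, hyy⟩ := H3' v hv
    exact ⟨y, hy, fun u hu => hyy u (hu.trans_le (min_le_left _ _))⟩
  obtain ⟨η4, hη4, H4⟩ := leb_sub h (isCompact_closedBall x 2) (show (0:ℝ) < 1 / 4 by norm_num)
  obtain ⟨δ0, hδ0, p1, p2, p3, p4, p5, p6⟩ : ∃ δ0 > (0:ℝ), 4 * δ0 ≤ η3 ∧ 2 * δ0 ≤ η4 ∧ 2 * δ0 ≤ s ∧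
      40 * δ0 ≤ ρ ∧ 4 * δ0 ≤ η2 ∧ 32 * δ0 ≤ η := by
    refine ⟨min (η3 / 4) (min (η4 / 2) (min (s / 2) (min (ρ / 40) (min (η2 / 4) (η / 32))))),
      by positivity, ?_⟩
    generalize ht : min (η3 / 4) (min (η4 / 2) (min (s / 2) (min (ρ / 40) (min (η2 / 4) (η / 32))))) = t
    have ht := ht.ge
    simp only [le_min_iff] at ht
    obtain ⟨t1, t2, t3, t4, t5, t6⟩ := ht
    refine ⟨?_, ?_, ?_, ?_, ?_, ?_⟩ <;> linarith
  refine ⟨δ0, hδ0, ?_⟩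
  intro δ hδ hδδ M hM v1 v2 v3 s1 s2 s3 c12 c13 c23
  have hsupp : ∀ q, ps δ q ∈ Us c F x a b r → inb M q := by
    intro q hq
    apply ps_inb hδ hM
    have h1 := Us_out hr hq
    rw [Complex.dist_eq] at h1
    have h2 := norm_le_insert' (ps δ q) x
    linarith
  have hB := JB h hx hab ha hb hsep m1 hr (by linarith) hη hNpos hΔ hgn hJ
    (fun i hi p hp => hmono0 i hi p (hp.trans_le l1)) hδ (by linarith) l2 l3 hcos l4 l5 H2'
    (by linarith) hΔη (by linarith) hsupp
  set V : Set ℂ := {ps δ v1, ps δ v2, ps δ v3} with hV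
  have hVsub : ∀ v ∈ V, Sub c F v x := by
    rintro v (rfl | rfl | rfl) <;> assumption
  have hVs : ∀ k ∈ CC c F x, ∃ v ∈ V, c v = k := by
    intro k hk
    have hss : ({c (ps δ v1), c (ps δ v2), c (ps δ v3)} : Finset (Fin 6)) ⊆ CC c F x := by
      intro i hi
      simp only [Finset.mem_insert, Finset.mem_singleton] at hi
      rcases hi with rfl | rfl | rfl
      · exact s1.cmem h
      · exact s2.cmem h
      · exact s3.cmem h
    have he := Finset.eq_of_subset_of_card_le hss (by
      rw [hx, Finset.card_insert_of_notMem (by simp [c12, c13]),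
        Finset.card_insert_of_notMem (by simp [c23]), Finset.card_singleton])
    rw [← he] at hk
    simp only [Finset.mem_insert, Finset.mem_singleton] at hk
    rcases hk with rfl | rfl | rfl
    · exact ⟨_, by simp [hV], rfl⟩
    · exact ⟨_, by simp [hV], rfl⟩
    · exact ⟨_, by simp [hV], rfl⟩
  have hT := tri_br (M := M) (κ := fun q => c (ps δ q)) hab hsupp
    (fun u => ∃ z ∈ V, c (ps δ u) = c z ∧ dist z (ps δ u) < 1) (by
      intro q u v w qu qv qw cv cw cua cub
      have e : ∀ u, adj q u → dist (ps δ u) (ps δ q) ≤ 2 * δ := fun u hu => ps_adj hδ hu.symm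
      exact TC h hx hab ha hb hsep m1 hr hs8 hsub n1 H3 (η' := η4) (fun v hv => by
        obtain ⟨w, -, hw⟩ := H4 v (mem_closedBall.2 hv)
        exact ⟨w, hw⟩) (d := 2 * δ) (by linarith) (by linarith) (by linarith) (by linarith)
        hVsub hVs (e u qu) (e v qv) (e w qw) cv cw cua cub)
  rw [hB] at hT
  rw [← hT]
  unfold hh
  rw [← T_add, ← T_add]
  apply T_congr
  intro u v w _ _ _
  have nn : ∀ i, Sub c F (ps δ i) x → c (ps δ i) ≠ a ∧ c (ps δ i) ≠ b := fun i hi =>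
    ⟨fun e => ha (e ▸ hi.cmem h), fun e => hb (e ▸ hi.cmem h)⟩
  have n1 := nn _ s1
  have n2 := nn _ s2
  have n3 := nn _ s3
  by_cases hab' : c (ps δ v) = a ∧ c (ps δ w) = b
  · simp only [hab', and_true]
    by_cases e1 : c (ps δ u) = c (ps δ v1)
    · simp [hV, e1, c12, c13, n1, I2_false not_false]
    · by_cases e2 : c (ps δ u) = c (ps δ v2)
      · simp [hV, e2, c12.symm, c23, n2, I2_false not_false]
      · by_cases e3 : c (ps δ u) = c (ps δ v3)
        · simp [hV, e3, c13.symm, c23.symm, n3, I2_false not_false]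
        · simp [hV, e1, e2, e3, I2_false not_false]
  · rw [I2_false, I2_false, I2_false, I2_false]
    · simp
    · tauto
    · tauto
    · tauto
    · tauto

theorem fin_min {ι : Type*} (s : Finset ι) (P : ι → ℝ → Prop)
    (H : ∀ i ∈ s, ∃ δ0 > (0:ℝ), ∀ δ, 0 < δ → δ < δ0 → P i δ) :
    ∃ δ0 > (0:ℝ), ∀ δ, 0 < δ → δ < δ0 → ∀ i ∈ s, P i δ := by
  classical
  induction s using Finset.induction_on with
  | empty => exact ⟨1, one_pos, by simp⟩
  | insert a s ha ih =>
    obtain ⟨d1, hd1, H1⟩ := ih (fun i hi => H i (Finset.mem_insert_of_mem hi))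
    obtain ⟨d2, hd2, H2⟩ := H a (Finset.mem_insert_self _ _)
    refine ⟨min d1 d2, lt_min hd1 hd2, fun δ h0 h1 i hi => ?_⟩
    rcases Finset.mem_insert.1 hi with rfl | hi
    · exact H2 δ h0 (h1.trans_le (min_le_right _ _))
    · exact H1 δ h0 (h1.trans_le (min_le_left _ _)) i hi

theorem H3 (h : Col c F) (x : ℂ) (hx20 : ‖x‖ ≤ 20) :
    ∃ δ0 > (0:ℝ), ∀ δ : ℝ, 0 < δ → δ < δ0 → ∀ M : ℕ,
    40 ≤ δ * (M - 2) → ∀ v1 v2 v3 : L, Sub c F (ps δ v1) x → Sub c F (ps δ v2) x →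
    Sub c F (ps δ v3) x → c (ps δ v1) ≠ c (ps δ v2) → c (ps δ v1) ≠ c (ps δ v3) →
    c (ps δ v2) ≠ c (ps δ v3) → ∀ a b, a ≠ b →
    a ≠ c (ps δ v1) → a ≠ c (ps δ v2) → a ≠ c (ps δ v3) →
    b ≠ c (ps δ v1) → b ≠ c (ps δ v2) → b ≠ c (ps δ v3) →
    hh (fun q => c (ps δ q)) (ps δ) M v1 a b + hh (fun q => c (ps δ q)) (ps δ) M v2 a b +
      hh (fun q => c (ps δ q)) (ps δ) M v3 a b = 1 := by
  have key : ∃ δ0 > (0:ℝ), ∀ δ, 0 < δ → δ < δ0 → ∀ p ∈ (Finset.univ : Finset (Fin 6 × Fin 6)),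
      ((CC c F x).card = 3 → p.1 ≠ p.2 → p.1 ∉ CC c F x → p.2 ∉ CC c F x → ∀ M : ℕ,
    40 ≤ δ * (M - 2) → ∀ v1 v2 v3 : L, Sub c F (ps δ v1) x → Sub c F (ps δ v2) x →
    Sub c F (ps δ v3) x → c (ps δ v1) ≠ c (ps δ v2) → c (ps δ v1) ≠ c (ps δ v3) →
    c (ps δ v2) ≠ c (ps δ v3) → 
    hh (fun q => c (ps δ q)) (ps δ) M v1 p.1 p.2 + hh (fun q => c (ps δ q)) (ps δ) M v2 p.1 p.2 +
      hh (fun q => c (ps δ q)) (ps δ) M v3 p.1 p.2 = 1) := by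
    apply fin_min
    rintro ⟨a, b⟩ -
    by_cases hh : (CC c F x).card = 3 ∧ a ≠ b ∧ a ∉ CC c F x ∧ b ∉ CC c F x
    · obtain ⟨δ0, h0, H⟩ := H3ab h x hx20 hh.1 hh.2.1 hh.2.2.1 hh.2.2.2
      exact ⟨δ0, h0, fun δ h1 h2 _ _ _ _ => H δ h1 h2⟩
    · exact ⟨1, one_pos, fun δ _ _ e1 e2 e3 e4 => absurd ⟨e1, e2, e3, e4⟩ hh⟩
  obtain ⟨δ0, h0, H⟩ := key
  refine ⟨δ0, h0, ?_⟩
  intro δ h1 h2 M hM v1 v2 v3 s1 s2 s3 c12 c13 c23 a b hab a1 a2 a3 b1 b2 b3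
  have hss : ({c (ps δ v1), c (ps δ v2), c (ps δ v3)} : Finset (Fin 6)) ⊆ CC c F x := by
    intro i hi
    simp only [Finset.mem_insert, Finset.mem_singleton] at hi
    rcases hi with rfl | rfl | rfl
    · exact s1.cmem h
    · exact s2.cmem h
    · exact s3.cmem h
  have hc3 : ({c (ps δ v1), c (ps δ v2), c (ps δ v3)} : Finset (Fin 6)).card = 3 := by
    rw [Finset.card_insert_of_notMem (by simp [c12, c13]),
        Finset.card_insert_of_notMem (by simp [c23]), Finset.card_singleton]
  have he := Finset.eq_of_subset_of_card_le hss (by rw [hc3]; exact E1 h x)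
  refine H δ h1 h2 (a, b) (Finset.mem_univ _) (by rw [← he, hc3]) hab ?_ ?_ M hM v1 v2 v3 s1 s2 s3
    c12 c13 c23
  · rw [← he]; simp [a1, a2, a3]
  · rw [← he]; simp [b1, b2, b3]

end Hx


open Set Metric Filter Topology

namespace Hx

variable {c : ℂ → Fin 6} {F : Set (Set ℂ)}

/-- a triangle near `p` witnessing colors `a`, `b` -/
def Wt (κ : L → Fin 6) (δ : ℝ) (p : L) (a b : Fin 6) : Prop :=
  ∃ u v w, adj u v ∧ adj u w ∧ adj v w ∧ κ u = κ p ∧ dist (ps δ p) (ps δ u) < 1 ∧ κ v = a ∧ κ w = b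

/-- the combinatorial properties of a fine mesh -/
structure Msh (κ : L → Fin 6) (δ : ℝ) (M : ℕ) : Prop where
  pos : 0 < δ
  small : δ ≤ 1 / 16
  inb : ∀ q, ‖ps δ q‖ ≤ 39 → inb M q
  loc : ∀ p u v, ‖ps δ p‖ ≤ 20 → adj p u → adj p v → ∀ w, κ u = κ w → κ v = κ w →
    (dist (ps δ w) (ps δ u) < 1 ↔ dist (ps δ w) (ps δ v) < 1)
  H2 : ∀ u v, ‖ps δ u‖ ≤ 20 → adj u v → κ u ≠ κ v → ∀ k, k ≠ κ u → k ≠ κ v →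
    hh κ (ps δ) M u (κ v) k = hh κ (ps δ) M v (κ u) k
  H3 : ∀ u v w, ‖ps δ u‖ ≤ 20 → adj u v → adj u w → κ u ≠ κ v → κ u ≠ κ w → κ v ≠ κ w →
    ∀ a b, a ≠ b → a ≠ κ u → a ≠ κ v → a ≠ κ w → b ≠ κ u → b ≠ κ v → b ≠ κ w →
    hh κ (ps δ) M u a b + hh κ (ps δ) M v a b + hh κ (ps δ) M w a b = 1
  M4 : ∀ p q, ‖ps δ p‖ ≤ 15 → adj p q → ∀ a b d e, Wt κ δ p a b → Wt κ δ q d e →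
    (∀ k, k = κ p ∨ k = a ∨ k = b ∨ k = κ q ∨ k = d ∨ k = e) → False

theorem mesh_ex (h : Col c F) : ∃ δ M, Msh (fun q => c (ps δ q)) δ M := by
  obtain ⟨Λ, hΛ, ε, hε, hcen⟩ := centers h
  obtain ⟨d1, hd1, K1⟩ := fin_min Λ _ (fun x hx => H2 h x (hΛ x hx))
  obtain ⟨d2, hd2, K2⟩ := fin_min Λ _ (fun x hx => H3 h x (hΛ x hx))
  obtain ⟨δ, hδ, l1, l2, l3, l4⟩ : ∃ δ > (0:ℝ), δ < d1 ∧ δ < d2 ∧ 2 * δ < ε ∧ δ ≤ 1 / 16 := by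
    refine ⟨min (d1 / 2) (min (d2 / 2) (min (ε / 4) (1 / 16))), by positivity, ?_⟩
    generalize ht : min (d1 / 2) (min (d2 / 2) (min (ε / 4) (1 / 16))) = t
    have ht := ht.ge
    simp only [le_min_iff] at ht
    obtain ⟨t1, t2, t3, t4⟩ := ht
    refine ⟨?_, ?_, ?_, ?_⟩ <;> linarith
  obtain ⟨M, hM⟩ := exists_nat_gt (40 / δ + 2)
  have hM : 40 ≤ δ * (M - 2) := by
    have : 40 / δ < M - 2 := by linarith
    rw [div_lt_iff₀ hδ] at this; linarith
  have hc : ∀ p, ‖ps δ p‖ ≤ 20 → ∃ x ∈ Λ, ∀ u, adj p u → Sub c F (ps δ u) x := by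
    intro p hp
    obtain ⟨x, hx, hxx⟩ := hcen _ hp
    exact ⟨x, hx, fun u hu => hxx _ ((ps_adj hδ hu.symm).trans_lt l3)⟩
  refine ⟨δ, M, hδ, l4, fun q hq => ps_inb hδ hM hq, ?_, ?_, ?_, ?_⟩
  · intro p u v hp hu hv w e1 e2
    obtain ⟨x, hx, hs⟩ := hc p hp
    exact M1 h (hs u hu) (hs v hv) e1 e2
  · intro u v hu huv hne k k1 k2
    obtain ⟨x, hx, hs⟩ := hc u hu
    exact K1 δ hδ l1 x hx M hM u v (hs u (adj_refl u)) (hs v huv) hne k k1 k2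
  · intro u v w hu uv uw n1 n2 n3 a b hab a1 a2 a3 b1 b2 b3
    obtain ⟨x, hx, hs⟩ := hc u hu
    exact K2 δ hδ l2 x hx M hM u v w (hs u (adj_refl u)) (hs v uv) (hs w uw) n1 n2 n3 a b hab a1 a2 a3
      b1 b2 b3
  · rintro p q hp hpq a b d e ⟨u, v, w, uv, uw, vw, cu, du, cv, cw⟩
      ⟨u', v', w', uv', uw', vw', cu', du', cv', cw'⟩ hk
    have hpq' := ps_adj hδ hpq
    have n1 : ‖ps δ u‖ ≤ 20 := by
      have := norm_le_insert' (ps δ u) (ps δ p)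
      rw [Complex.dist_eq, norm_sub_rev] at du
      linarith
    have n2 : ‖ps δ u'‖ ≤ 20 := by
      have h1 := norm_le_insert' (ps δ u') (ps δ q)
      have h2 := norm_le_insert' (ps δ q) (ps δ p)
      rw [Complex.dist_eq, norm_sub_rev] at du' hpq'
      linarith
    obtain ⟨x, -, hx⟩ := hc p (by linarith)
    obtain ⟨y, -, hy⟩ := hc u n1
    obtain ⟨y', -, hy'⟩ := hc u' n2
    simp only at cu cv cw cu' cv' cw' hk
    have m1 := (hx p (adj_refl p)).cmem h
    have m2 := (hx q hpq).cmem h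
    have m3 := (hy u (adj_refl u)).cmem h
    have m4 := (hy v uv).cmem h
    have m5 := (hy w uw).cmem h
    have m3' := (hy' u' (adj_refl u')).cmem h
    have m4' := (hy' v' uv').cmem h
    have m5' := (hy' w' uw').cmem h
    rw [cu] at m3; rw [cv] at m4; rw [cw] at m5
    rw [cu'] at m3'; rw [cv'] at m4'; rw [cw'] at m5'
    refine M4c h (x := x) (y := y) (y' := y') ?_ m1 m3 m2 m3'
      (nr_of_sub h (hx p (adj_refl p)) (hy u (adj_refl u)) cu.symm du)
      (nr_of_sub h (hx q hpq) (hy' u' (adj_refl u')) cu'.symm du')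
    intro k
    rcases hk k with rfl | rfl | rfl | rfl | rfl | rfl <;> simp [*]

section
variable {κ : L → Fin 6} {δ : ℝ} {M : ℕ}

theorem Msh.nadj (h : Msh κ δ M) {u v : L} (huv : adj u v) : ‖ps δ v‖ ≤ ‖ps δ u‖ + 1 / 8 := by
  have h1 := norm_le_insert' (ps δ v) (ps δ u)
  have h2 := ps_adj h.pos huv
  have := h.small
  rw [Complex.dist_eq, norm_sub_rev] at h2
  linarith

theorem nd {u v : L} (hd : dist (ps δ u) (ps δ v) < 1) : ‖ps δ v‖ ≤ ‖ps δ u‖ + 1 := by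
  have h1 := norm_le_insert' (ps δ v) (ps δ u)
  rw [Complex.dist_eq, norm_sub_rev] at hd
  linarith

/-- H1 -/
theorem Msh.H1 (h : Msh κ δ M) {p : L} (hp : ‖ps δ p‖ ≤ 15) {a : Fin 6} (ha : κ p ≠ a) :
    ∑ b ∈ (Finset.univ.erase (κ p)).erase a, hh κ (ps δ) M p a b = 0 := by
  have := HSK (M := M) (κ := κ) ha
    (E := fun u v => κ u = κ p ∧ dist (ps δ p) (ps δ u) < 1 ∧ κ v = a) ?_ ?_ ?_
  · rw [← this]
    refine Finset.sum_congr rfl fun b _ => ?_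
    unfold hh
    apply T_congr; intro u v w _ _ _; apply I2_congr; tauto
  · rintro u v _ ⟨h1, h2, h3⟩
    exact ⟨h.inb _ (by have := nd h2; linarith), h1, h3⟩
  · rintro u v w uv uw vw ⟨h1, h2, h3⟩ hw
    exact ⟨hw, (h.loc u u w (by have := nd h2; linarith) (adj_refl u) uw p h1 hw).1 h2, h3⟩
  · rintro u v w uv uw vw ⟨h1, h2, h3⟩ hw
    exact ⟨h1, h2, hw⟩

/-- nonvanishing gives a witness -/
theorem wt_of {p : L} {a b : Fin 6} (hne : hh κ (ps δ) M p a b ≠ 0) : Wt κ δ p a b := by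
  obtain ⟨u, v, w, uv, uw, vw, hn⟩ := T_ne hne
  have : κ u = κ p ∧ dist (ps δ p) (ps δ u) < 1 ∧ κ v = a ∧ κ w = b := by
    by_contra hc; exact hn (I2_false hc)
  exact ⟨u, v, w, uv, uw, vw, this.1, this.2.1, this.2.2.1, this.2.2.2⟩

/-- connectedness -/
def Cn (κ : L → Fin 6) : L → L → Prop := Relation.ReflTransGen fun u v => adj u v ∧ κ u = κ v

theorem Cn.symm {u v : L} (h : Cn κ u v) : Cn κ v u := by
  induction h with
  | refl => exact Relation.ReflTransGen.refl
  | tail _ h2 ih => exact Relation.ReflTransGen.head ⟨h2.1.symm, h2.2.symm⟩ ih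

theorem Cn.trans {u v w : L} (h : Cn κ u v) (h' : Cn κ v w) : Cn κ u w :=
  Relation.ReflTransGen.trans h h'

theorem Cn.col {u v : L} (h : Cn κ u v) : κ u = κ v := by
  induction h with
  | refl => rfl
  | tail _ h2 ih => exact ih.trans h2.2

theorem Cn.single {u v : L} (h : adj u v) (e : κ u = κ v) : Cn κ u v :=
  Relation.ReflTransGen.single ⟨h, e⟩

theorem Msh.near (h : Msh κ δ M) {p u v : L} (hp : ‖ps δ p‖ ≤ 15) (hu : κ u = κ p)
    (hd : dist (ps δ p) (ps δ u) < 1) (huv : Cn κ u v) : dist (ps δ p) (ps δ v) < 1 := by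
  induction huv with
  | refl => exact hd
  | @tail v w h1 h2 ih =>
    have e : κ v = κ p := (Cn.col h1).symm.trans hu
    exact (h.loc v v w (by have := nd ih; linarith) (adj_refl v) h2.1 p e (h2.2.symm.trans e)).1 ih

theorem Msh.diam (h : Msh κ δ M) {p u : L} (hp : ‖ps δ p‖ ≤ 15) (hu : Cn κ p u) :
    dist (ps δ p) (ps δ u) < 1 :=
  h.near hp rfl (by simp) hu

theorem Msh.hh_cn (h : Msh κ δ M) {p u : L} (hp : ‖ps δ p‖ ≤ 15) (hu : Cn κ p u) (a b : Fin 6) :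
    hh κ (ps δ) M u a b = hh κ (ps δ) M p a b := by
  unfold hh
  apply T_congr
  intro x v w _ _ _
  apply I2_congr
  rw [hu.col]
  have key : κ x = κ u → (dist (ps δ p) (ps δ x) < 1 ↔ dist (ps δ u) (ps δ x) < 1) := by
    intro hx
    induction hu with
    | refl => rfl
    | @tail v w h1 h2 ih =>
      have hx' : κ x = κ v := hx.trans h2.2.symm
      rw [ih hx', dist_comm, dist_comm (ps δ w)]
      exact h.loc v v w (by have := nd (h.diam hp h1); linarith) (adj_refl v) h2.1 x hx'.symm hx.symm
  constructor
  · rintro ⟨h1, h2, h3⟩; exact ⟨h1, (key h1).2 h2, h3⟩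
  · rintro ⟨h1, h2, h3⟩; exact ⟨h1, (key h1).1 h2, h3⟩

/-- witness moves along the component -/
theorem Msh.wt_cn (h : Msh κ δ M) {p u : L} (hp : ‖ps δ p‖ ≤ 14) (hu : Cn κ p u) {a b : Fin 6}
    {u' v w : L} (hu' : Cn κ p u') (uv : adj u' v) (uw : adj u' w) (vw : adj v w) (cv : κ v = a)
    (cw : κ w = b) : Wt κ δ u a b := by
  have c1 : Cn κ u u' := hu.symm.trans hu'
  exact ⟨u', v, w, uv, uw, vw, c1.col.symm,
    h.diam (by have := nd (h.diam (by linarith) hu); linarith) c1, cv, cw⟩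

end

end Hx


open Set Metric Filter Topology

namespace Hx

variable {κ : L → Fin 6} {δ : ℝ} {M : ℕ}

theorem sp_dec : ∀ a b a' b' : Prop, ¬ (a ∧ b) → ¬ (a' ∧ b') →
    I2 ((a ∧ b) ∨ (b ∧ a)) + I2 ((a ∧ b') ∨ (b ∧ a')) + I2 ((a ∧ b') ∨ (b ∧ a')) = 0 := by
  intro a b a' b' h h'
  rw [add_assoc, z2_add_self, add_zero]
  apply I2_false; tauto

theorem sp_or (a b d e : Prop) : (a ∧ b ∨ d ∧ e) ↔ (e ∧ d ∨ b ∧ a) := by tauto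

/-- existence of a tricolored triangle -/
theorem Msh.tri (h : Msh κ δ M) : ∃ u v w, ‖ps δ u‖ ≤ 4 ∧ adj u v ∧ adj u w ∧ adj v w ∧
    κ u ≠ κ v ∧ κ u ≠ κ w ∧ κ v ≠ κ w := by
  by_contra hcon
  have hδ := h.pos
  have hδ' := h.small
  obtain ⟨n, hn1, hn2⟩ : ∃ n : ℕ, 1 ≤ n * δ ∧ n * δ ≤ 2 := by
    refine ⟨⌈1 / δ⌉₊, ?_, ?_⟩
    · have := Nat.le_ceil (1 / δ)
      rwa [div_le_iff₀ hδ] at this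
    · have := (Nat.ceil_lt_add_one (show 0 ≤ 1 / δ by positivity)).le
      calc (⌈1 / δ⌉₊ : ℝ) * δ ≤ (1 / δ + 1) * δ := by gcongr
        _ = 1 + δ := by field_simp
        _ ≤ 2 := by linarith
  set A : L → Prop := fun u => ∃ v, Cn κ u v ∧ v.1 = 0 with hA
  set B : L → Prop := fun u => ¬ A u ∧ ∃ v, Cn κ u v ∧ v.2 = 0 with hB
  set E : L → L → ZMod 2 := fun u v => I2 ((A u ∧ B v) ∨ (B u ∧ A v)) with hE
  have Esym : ∀ u v, E u v = E v u := fun u v => I2_congr (sp_or _ _ _ _)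
  have ex : ∀ u, ¬ (A u ∧ B u) := fun u hh => hh.2.1 hh.1
  have cA : ∀ u v, Cn κ u v → (A u ↔ A v) := by
    intro u v huv
    exact ⟨fun ⟨w, h1, h2⟩ => ⟨w, huv.symm.trans h1, h2⟩, fun ⟨w, h1, h2⟩ => ⟨w, huv.trans h1, h2⟩⟩
  have cB : ∀ u v, Cn κ u v → (B u ↔ B v) := by
    intro u v huv
    have : (∃ w, Cn κ u w ∧ w.2 = 0) ↔ (∃ w, Cn κ v w ∧ w.2 = 0) :=
      ⟨fun ⟨w, h1, h2⟩ => ⟨w, huv.symm.trans h1, h2⟩, fun ⟨w, h1, h2⟩ => ⟨w, huv.trans h1, h2⟩⟩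
    simp only [hB, cA u v huv, this]
  have same : ∀ u v w, adj u v → κ u = κ v → E u v + E v w + E u w = 0 := by
    intro u v w huv e
    have hc := Cn.single huv e
    simp only [hE, ← cA u v hc, ← cB u v hc]
    exact sp_dec _ _ _ _ (ex u) (ex w)
  have tri0 : ∀ u v w, ‖ps δ u‖ ≤ 4 → adj u v → adj u w → adj v w → E u v + E v w + E u w = 0 := by
    intro u v w hu uv uw vw
    by_cases e1 : κ u = κ v
    · exact same u v w uv e1
    · by_cases e2 : κ u = κ w
      · have := same u w v uw e2
        rw [Esym w v] at this; linear_combination this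
      · by_cases e3 : κ v = κ w
        · have := same v w u vw e3
          rw [Esym w u, Esym v u] at this; linear_combination this
        · exact absurd ⟨u, v, w, hu, uv, uw, vw, e1, e2, e3⟩ hcon
  have nrm : ∀ i j : ℕ, i ≤ n → j ≤ n → ‖ps δ ((i : ℤ), (j : ℤ))‖ ≤ 4 := by
    intro i j hi hj
    refine (Complex.norm_le_abs_re_add_abs_im _).trans ?_
    have hi' : (i : ℝ) ≤ n := by exact_mod_cast hi
    have hj' : (j : ℝ) ≤ n := by exact_mod_cast hj
    simp only [ps, Int.cast_natCast]
    rw [abs_of_nonneg (by positivity), abs_of_nonneg (by positivity)]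
    nlinarith
  set H : ℕ → ℕ → ZMod 2 := fun i j => E (i, j) ((i + 1 : ℕ), j) with hH
  set V : ℕ → ℕ → ZMod 2 := fun i j => E (i, j) (i, (j + 1 : ℕ)) with hV
  have sq : ∀ i < n, ∀ j < n, (H i (j + 1) + H i j) + (V (i + 1) j + V i j) = 0 := by
    intro i hi j hj
    have t1 := tri0 (i, j) ((i + 1 : ℕ), j) ((i + 1 : ℕ), (j + 1 : ℕ)) (nrm i j hi.le hj.le)
      (by simp [adj]) (by simp [adj]) (by simp [adj])
    have t2 := tri0 (i, j) (i, (j + 1 : ℕ)) ((i + 1 : ℕ), (j + 1 : ℕ)) (nrm i j hi.le hj.le)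
      (by simp [adj]) (by simp [adj]) (by simp [adj])
    have t3 := z2_add_self (E (i, j) ((i + 1 : ℕ), (j + 1 : ℕ)))
    simp only [hH, hV]
    linear_combination t1 + t2 - t3
  have tot : ∑ i ∈ Finset.range n, ∑ j ∈ Finset.range n,
      ((H i (j + 1) + H i j) + (V (i + 1) j + V i j)) = 0 := by
    refine Finset.sum_eq_zero fun i hi => Finset.sum_eq_zero fun j hj => ?_
    exact sq i (Finset.mem_range.1 hi) j (Finset.mem_range.1 hj)
  simp only [Finset.sum_add_distrib (f := fun j => H _ (j + 1) + H _ j)] at tot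
  rw [Finset.sum_add_distrib, Finset.sum_comm (f := fun i j => V (i + 1) j + V i j)] at tot
  simp only [tele] at tot
  rw [Finset.sum_congr rfl (fun j _ => tele (fun i => V i j) n)] at tot
  -- boundary
  have Bd : ∀ u v : L, ‖ps δ u‖ ≤ 4 → Cn κ u v → δ * |(u.1 : ℝ) - v.1| < 1 ∧ δ * |(u.2 : ℝ) - v.2| < 1 := by
    intro u v hu huv
    have hd := h.diam (by linarith) huv
    rw [Complex.dist_eq] at hd
    have h1 := (Complex.abs_re_le_norm _).trans_lt hd
    have h2 := (Complex.abs_im_le_norm _).trans_lt hd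
    have e1 : (ps δ u - ps δ v).re = δ * ((u.1 : ℝ) - v.1) := by simp [ps]; ring
    have e2 : (ps δ u - ps δ v).im = δ * ((u.2 : ℝ) - v.2) := by simp [ps]; ring
    rw [e1, abs_mul, abs_of_pos hδ] at h1
    rw [e2, abs_mul, abs_of_pos hδ] at h2
    exact ⟨h1, h2⟩
  have left : ∀ j : ℕ, A (((0 : ℕ) : ℤ), j) := fun j => ⟨_, Relation.ReflTransGen.refl, by simp⟩
  have right : ∀ j ≤ n, ¬ A ((n : ℤ), j) := by
    rintro j hj ⟨v, hv, e⟩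
    have := (Bd _ _ (nrm n j le_rfl hj) hv).1
    rw [e] at this
    simp only [Int.cast_natCast, Int.cast_zero, sub_zero, Nat.abs_cast] at this
    linarith
  have bot : ∀ i : ℕ, A (i, ((0 : ℕ) : ℤ)) ∨ B (i, ((0 : ℕ) : ℤ)) := by
    intro i
    by_cases hA' : A (i, ((0 : ℕ) : ℤ))
    · exact Or.inl hA'
    · exact Or.inr ⟨hA', _, Relation.ReflTransGen.refl, by simp⟩
  have top : ∀ i ≤ n, ¬ B (i, (n : ℤ)) := by
    rintro i hi ⟨-, v, hv, e⟩
    have := (Bd _ _ (nrm i n hi le_rfl) hv).2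
    rw [e] at this
    simp only [Int.cast_natCast, Int.cast_zero, sub_zero, Nat.abs_cast] at this
    linarith
  clear_value A B
  have b1 : ∑ j ∈ Finset.range n, (V n j + V 0 j) = 0 := by
    refine Finset.sum_eq_zero fun j hj => ?_
    have hj := Finset.mem_range.1 hj
    have r1 := right j hj.le
    have r2 := right (j + 1) hj
    have l1 := left j
    have l2 := left (j + 1)
    simp only [hV, hE]
    rw [I2_false (by tauto), I2_false, add_zero]
    rintro (⟨-, h1⟩ | ⟨h1, -⟩)
    · exact ex _ ⟨l2, h1⟩
    · exact ex _ ⟨l1, h1⟩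
  have b2 : ∑ i ∈ Finset.range n, (H i n + H i 0) = 1 := by
    have : ∑ i ∈ Finset.range n, (H i n + H i 0) = ∑ i ∈ Finset.range n,
        (I2 (B (((i + 1 : ℕ) : ℤ), ((0 : ℕ) : ℤ))) + I2 (B ((i : ℤ), ((0 : ℕ) : ℤ)))) := by
      refine Finset.sum_congr rfl fun i hi => ?_
      have hi := Finset.mem_range.1 hi
      have t1 := top i hi.le
      have t2 := top (i + 1) hi
      simp only [hH, hE]
      rw [I2_false (by tauto), zero_add]
      have m1 := bot i
      have m2 := bot (i + 1)
      have e1 := ex (i, ((0 : ℕ) : ℤ))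
      have e2 := ex ((i + 1 : ℕ), ((0 : ℕ) : ℤ))
      rcases m1 with m1 | m1
      · have nb : ¬ B (i, ((0 : ℕ) : ℤ)) := fun hh => e1 ⟨m1, hh⟩
        rw [I2_false nb, add_zero]
        apply I2_congr; tauto
      · have na : ¬ A (i, ((0 : ℕ) : ℤ)) := fun hh => e1 ⟨hh, m1⟩
        rcases m2 with m2 | m2
        · have nb : ¬ B ((i + 1 : ℕ), ((0 : ℕ) : ℤ)) := fun hh => e2 ⟨m2, hh⟩
          rw [I2_false nb, zero_add]
          apply I2_congr; tauto
        · have na2 : ¬ A ((i + 1 : ℕ), ((0 : ℕ) : ℤ)) := fun hh => e2 ⟨hh, m2⟩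
          rw [I2_true m1, I2_true m2, I2_false (by tauto)]; decide
    rw [this, tele (fun i => I2 (B ((i : ℤ), ((0 : ℕ) : ℤ)))) n]
    have q1 : B ((n : ℤ), ((0 : ℕ) : ℤ)) := (bot n).resolve_left (right 0 (Nat.zero_le _))
    have q2 : ¬ B (((0 : ℕ) : ℤ), ((0 : ℕ) : ℤ)) := fun hh => ex _ ⟨left 0, hh⟩
    rw [I2_true q1, I2_false q2, add_zero]
  rw [b1, b2] at tot
  revert tot; decide

/-! counting over components -/

/-- number of triangles of type `κ p, a, b` on the component of `p` -/
noncomputable def Cc (κ : L → Fin 6) (M : ℕ) (p : L) (a b : Fin 6) : ZMod 2 :=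
  Tg M (fun u v w => I2 (Cn κ p u ∧ κ v = a ∧ κ w = b))

/-- number of triangles on the components of `p` and `q` -/
noncomputable def Dd (κ : L → Fin 6) (M : ℕ) (p q : L) (a : Fin 6) : ZMod 2 :=
  Tg M (fun u v w => I2 (Cn κ p u ∧ Cn κ q v ∧ κ w = a))

theorem Cc_symm {p : L} {a b : Fin 6} : Cc κ M p a b = Cc κ M p b a := by
  unfold Cc
  rw [← T_swap23]
  apply T_congr; intro u v w _ _ _; apply I2_congr; tauto

theorem Msh.Cc_sum (h : Msh κ δ M) {p : L} (hp : ‖ps δ p‖ ≤ 15) {a : Fin 6} (ha : κ p ≠ a) :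
    ∑ b ∈ (Finset.univ.erase (κ p)).erase a, Cc κ M p a b = 0 := by
  have := HSK (M := M) (κ := κ) ha (E := fun u v => Cn κ p u ∧ κ v = a) ?_ ?_ ?_
  · rw [← this]
    refine Finset.sum_congr rfl fun b _ => ?_
    unfold Cc
    apply T_congr; intro u v w _ _ _; apply I2_congr; tauto
  · rintro u v _ ⟨h1, h3⟩
    exact ⟨h.inb _ (by have := nd (h.diam hp h1); linarith), h1.col.symm, h3⟩
  · rintro u v w uv uw vw ⟨h1, h3⟩ hw
    exact ⟨h1.trans (Cn.single uw (h1.col.symm.trans hw.symm)), h3⟩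
  · rintro u v w uv uw vw ⟨h1, h3⟩ hw
    exact ⟨h1, hw⟩

theorem Msh.Dd_sum (h : Msh κ δ M) {p q : L} (hp : ‖ps δ p‖ ≤ 15) (ha : κ p ≠ κ q) :
    ∑ b ∈ (Finset.univ.erase (κ p)).erase (κ q), Dd κ M p q b = 0 := by
  have := HSK (M := M) (κ := κ) ha (E := fun u v => Cn κ p u ∧ Cn κ q v) ?_ ?_ ?_
  · rw [← this]
    refine Finset.sum_congr rfl fun b _ => ?_
    unfold Dd
    apply T_congr; intro u v w _ _ _; apply I2_congr; tauto
  · rintro u v _ ⟨h1, h3⟩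
    exact ⟨h.inb _ (by have := nd (h.diam hp h1); linarith), h1.col.symm, h3.col.symm⟩
  · rintro u v w uv uw vw ⟨h1, h3⟩ hw
    exact ⟨h1.trans (Cn.single uw (h1.col.symm.trans hw.symm)), h3⟩
  · rintro u v w uv uw vw ⟨h1, h3⟩ hw
    exact ⟨h1, h3.trans (Cn.single vw (h3.col.symm.trans hw.symm))⟩

theorem rep_ex (κ : L → Fin 6) : ∃ rep : L → L, ∀ u v, Cn κ u v ↔ rep u = rep v := by
  let st : Setoid L := ⟨Cn κ, ⟨fun _ => Relation.ReflTransGen.refl, Cn.symm, Cn.trans⟩⟩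
  refine ⟨fun u => (Quotient.mk st u).out, fun u v => ?_⟩
  constructor
  · intro huv
    have : Quotient.mk st u = Quotient.mk st v := Quotient.sound huv
    simp only [this]
  · intro e
    have := congrArg (Quotient.mk st) e
    simp only [Quotient.out_eq] at this
    exact Quotient.exact this

/-- splitting a count over components of a vertex `f u v` -/
theorem split {P : L → L → L → Prop} (hne : Tg M (fun u v w => I2 (P u v w)) ≠ 0)
    (hb : ∀ u v w, adj u v → adj u w → adj v w → P u v w → u ∈ bx M) :
    ∃ q, Tg M (fun u v w => I2 (Cn κ q u ∧ P u v w)) ≠ 0 := by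
  classical
  obtain ⟨rep, hrep⟩ := rep_ex κ
  by_contra hc
  push Not at hc
  apply hne
  have : Tg M (fun u v w => I2 (P u v w)) =
      ∑ q ∈ (bx M).image rep, Tg M (fun u v w => I2 (rep u = q ∧ P u v w)) := by
    rw [← T_sum]
    apply T_congr
    intro u v w uv uw vw
    by_cases hP : P u v w
    · have hu := hb u v w uv uw vw hP
      rw [Finset.sum_eq_single (rep u)]
      · exact I2_congr (by simp)
      · intro q _ hq; exact I2_false (fun hh => hq hh.1.symm)
      · intro hn; exact absurd (Finset.mem_image_of_mem _ hu) hn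
    · rw [I2_false hP, Finset.sum_eq_zero]
      intro q _; exact I2_false (fun hh => hP hh.2)
  rw [this]
  refine Finset.sum_eq_zero fun q hq => ?_
  obtain ⟨q0, -, rfl⟩ := Finset.mem_image.1 hq
  rw [← hc q0]
  apply T_congr
  intro u v w _ _ _
  apply I2_congr
  rw [hrep, eq_comm]

theorem inb_bx {u : L} (hu : inb M u) : u ∈ bx M := by
  rw [mem_bx]; exact ⟨by have := hu.1; omega, by have := hu.2; omega⟩

theorem Msh.exC (h : Msh κ δ M) {p : L} (hp : ‖ps δ p‖ ≤ 12) {a b : Fin 6}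
    (hne : hh κ (ps δ) M p a b ≠ 0) : ∃ q, ‖ps δ q‖ ≤ ‖ps δ p‖ + 1 ∧ κ q = κ p ∧ Cc κ M q a b = 1 := by
  obtain ⟨q, hq⟩ := split (κ := κ) hne (by
    rintro u v w uv uw vw ⟨h1, h2, h3⟩
    exact inb_bx (h.inb _ (by have := nd h2; linarith)))
  obtain ⟨u, v, w, uv, uw, vw, hn⟩ := T_ne hq
  obtain ⟨n1, n2, n3, -, -⟩ := I2_ne hn
  have hqp : κ q = κ p := n1.col.trans n2
  have hqd : dist (ps δ p) (ps δ q) < 1 := h.near (by linarith) n2 n3 n1.symm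
  refine ⟨q, nd hqd, hqp, (z2_cases _).resolve_left ?_⟩
  intro h0
  apply hq
  rw [← h0]
  apply T_congr
  intro u v w _ _ _
  apply I2_congr
  constructor
  · rintro ⟨m1, m2, m3, m4⟩; exact ⟨m1, m4⟩
  · rintro ⟨m1, m4⟩
    exact ⟨m1, m1.col.symm.trans hqp, h.near (by linarith) hqp hqd m1, m4⟩

theorem Msh.exD (h : Msh κ δ M) {p : L} (hp : ‖ps δ p‖ ≤ 12) {a b : Fin 6}
    (hne : Cc κ M p a b = 1) : ∃ q, ‖ps δ q‖ ≤ ‖ps δ p‖ + 3 ∧ κ q = b ∧ Dd κ M p q a = 1 := by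
  have hne' : Tg M (fun u v w => I2 (Cn κ p v ∧ κ u = b ∧ κ w = a)) ≠ 0 := by
    rw [T_swap12 (G := fun u v w => I2 (Cn κ p u ∧ κ v = b ∧ κ w = a))]
    change Cc κ M p b a ≠ 0
    rw [Cc_symm, hne]; decide
  obtain ⟨q, hq⟩ := split (κ := κ) hne' (by
    rintro u v w uv uw vw ⟨h1, h2, h3⟩
    have n1 := nd (h.diam (by linarith) h1)
    have n2 := h.nadj uv.symm
    exact inb_bx (h.inb _ (by linarith)))
  obtain ⟨u, v, w, uv, uw, vw, hn⟩ := T_ne hq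
  obtain ⟨n1, n2, n3, -⟩ := I2_ne hn
  have k1 := nd (h.diam (by linarith) n2)
  have k2 := h.nadj uv.symm
  have k3 := nd (h.diam (by linarith) n1.symm)
  refine ⟨q, by linarith, n1.col.trans n3, (z2_cases _).resolve_left ?_⟩
  intro h0
  apply hq
  rw [← h0]
  unfold Dd
  rw [← T_swap12]
  apply T_congr
  intro u v w _ _ _
  apply I2_congr
  constructor
  · rintro ⟨m1, m2, m3, m4⟩; exact ⟨m2, m1, m4⟩
  · rintro ⟨m1, m2, m4⟩
    exact ⟨m2, m1, (m2.col.symm.trans n1.col).trans n3, m4⟩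

end Hx


open Set Metric Filter Topology

namespace Hx

variable {κ : L → Fin 6} {δ : ℝ} {M : ℕ}

theorem perm_step (σ : Equiv.Perm (Fin 6)) (i w : Fin 6) : ∃ τ : Equiv.Perm (Fin 6), τ i = w ∧
    ∀ j, j ≠ i → σ j ≠ w → τ j = σ j := by
  refine ⟨σ.trans (Equiv.swap (σ i) w), by simp, fun j hj hw => ?_⟩
  simp only [Equiv.trans_apply]
  exact Equiv.swap_apply_of_ne_of_ne (fun e => hj (σ.injective e)) hw

theorem perm3 {x y z : Fin 6} (xy : x ≠ y) (xz : x ≠ z) (yz : y ≠ z) :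
    ∃ σ : Equiv.Perm (Fin 6), σ 0 = x ∧ σ 1 = y ∧ σ 2 = z := by
  obtain ⟨s0, h0, -⟩ := perm_step (Equiv.refl _) 0 x
  obtain ⟨s1, h1, k1⟩ := perm_step s0 1 y
  obtain ⟨s2, h2, k2⟩ := perm_step s1 2 z
  have a0 : s1 0 = x := by rw [k1 0 (by decide) (by rw [h0]; exact xy), h0]
  refine ⟨s2, ?_, ?_, h2⟩
  · rw [k2 0 (by decide) (by rw [a0]; exact xz), a0]
  · rw [k2 1 (by decide) (by rw [h1]; exact yz), h1]

theorem perm4 {x y z w : Fin 6} (xy : x ≠ y) (xz : x ≠ z) (yz : y ≠ z) (xw : x ≠ w) (yw : y ≠ w)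
    (zw : z ≠ w) : ∃ σ : Equiv.Perm (Fin 6), σ 0 = x ∧ σ 1 = y ∧ σ 2 = z ∧ σ 3 = w := by
  obtain ⟨s, h0, h1, h2⟩ := perm3 xy xz yz
  obtain ⟨t, h3, k⟩ := perm_step s 3 w
  refine ⟨t, ?_, ?_, ?_, h3⟩
  · rw [k 0 (by decide) (by rw [h0]; exact xw), h0]
  · rw [k 1 (by decide) (by rw [h1]; exact yw), h1]
  · rw [k 2 (by decide) (by rw [h2]; exact zw), h2]

theorem sum_four {f : Fin 6 → ZMod 2} {x y : Fin 6} (σ : Equiv.Perm (Fin 6)) {i j k l m n : Fin 6}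
    (hx : x = σ i) (hy : y = σ j) (hf : ∑ b ∈ (Finset.univ.erase x).erase y, f b = 0)
    (e : (Finset.univ.erase i).erase j = ({k, l, m, n} : Finset (Fin 6)))
    (hn : k ∉ ({l, m, n} : Finset (Fin 6)) ∧ l ∉ ({m, n} : Finset (Fin 6)) ∧
      m ∉ ({n} : Finset (Fin 6))) :
    f (σ k) + (f (σ l) + (f (σ m) + f (σ n))) = 0 := by
  rw [← hf]
  have : ∑ b ∈ (Finset.univ.erase x).erase y, f b = ∑ t ∈ (Finset.univ.erase i).erase j, f (σ t) := by
    symm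
    apply Finset.sum_equiv σ
    · intro t; simp [hx, hy]
    · intro t _; rfl
  rw [this, e, Finset.sum_insert hn.1, Finset.sum_insert hn.2.1, Finset.sum_insert hn.2.2,
    Finset.sum_singleton]

theorem Msh.H1s (h : Msh κ δ M) (σ : Equiv.Perm (Fin 6)) {p : L} (hp : ‖ps δ p‖ ≤ 15)
    (i j k l m n : Fin 6) (hi : κ p = σ i) 
    (e : (Finset.univ.erase i).erase j = ({k, l, m, n} : Finset (Fin 6)))
    (hn : k ∉ ({l, m, n} : Finset (Fin 6)) ∧ l ∉ ({m, n} : Finset (Fin 6)) ∧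
      m ∉ ({n} : Finset (Fin 6))) (hij : i ≠ j) :
    hh κ (ps δ) M p (σ j) (σ k) + (hh κ (ps δ) M p (σ j) (σ l) + (hh κ (ps δ) M p (σ j) (σ m) +
      hh κ (ps δ) M p (σ j) (σ n))) = 0 :=
  sum_four σ hi rfl (h.H1 hp (a := σ j) (by rw [hi]; exact fun e => hij (σ.injective e))) e hn

theorem Msh.Cs (h : Msh κ δ M) (σ : Equiv.Perm (Fin 6)) {p : L} (hp : ‖ps δ p‖ ≤ 15)
    (i j k l m n : Fin 6) (hi : κ p = σ i) 
    (e : (Finset.univ.erase i).erase j = ({k, l, m, n} : Finset (Fin 6)))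
    (hn : k ∉ ({l, m, n} : Finset (Fin 6)) ∧ l ∉ ({m, n} : Finset (Fin 6)) ∧
      m ∉ ({n} : Finset (Fin 6))) (hij : i ≠ j) :
    Cc κ M p (σ j) (σ k) + (Cc κ M p (σ j) (σ l) + (Cc κ M p (σ j) (σ m) +
      Cc κ M p (σ j) (σ n))) = 0 :=
  sum_four σ hi rfl (h.Cc_sum hp (a := σ j) (by rw [hi]; exact fun e => hij (σ.injective e))) e hn

theorem Msh.M4s (h : Msh κ δ M) (σ : Equiv.Perm (Fin 6)) {p q : L} (hp : ‖ps δ p‖ ≤ 15) (pq : adj p q)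
    (i j k l m n : Fin 6) (hi : κ p = σ i) (hl : κ q = σ l)
    (hc : ∀ t : Fin 6, t = i ∨ t = j ∨ t = k ∨ t = l ∨ t = m ∨ t = n)
    (w1 : Wt κ δ p (σ j) (σ k)) : hh κ (ps δ) M q (σ m) (σ n) = 0 := by
  by_contra hne
  refine h.M4 p q hp pq _ _ _ _ w1 (wt_of hne) ?_
  intro t
  obtain ⟨t, rfl⟩ := σ.surjective t
  rw [hi, hl]
  rcases hc t with rfl | rfl | rfl | rfl | rfl | rfl <;> simp

theorem Msh.M4m (h : Msh κ δ M) (σ : Equiv.Perm (Fin 6)) {p q : L} (hp : ‖ps δ p‖ ≤ 15) (pq : adj p q)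
    (i j k l m n : Fin 6) (hi : κ p = σ i) (hl : κ q = σ l)
    (hc : ∀ t : Fin 6, t = i ∨ t = j ∨ t = k ∨ t = l ∨ t = m ∨ t = n) :
    hh κ (ps δ) M p (σ j) (σ k) * hh κ (ps δ) M q (σ m) (σ n) = 0 := by
  by_cases h0 : hh κ (ps δ) M p (σ j) (σ k) = 0
  · rw [h0, zero_mul]
  · rw [h.M4s σ hp pq i j k l m n hi hl hc (wt_of h0), mul_zero]

theorem Msh.H2s (h : Msh κ δ M) (σ : Equiv.Perm (Fin 6)) {u v : L} (hu : ‖ps δ u‖ ≤ 15) (uv : adj u v)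
    (i j k : Fin 6) (hi : κ u = σ i) (hj : κ v = σ j) (hd : i ≠ j ∧ k ≠ i ∧ k ≠ j) :
    hh κ (ps δ) M u (σ j) (σ k) = hh κ (ps δ) M v (σ i) (σ k) := by
  have := h.H2 u v (by linarith) uv (by rw [hi, hj]; exact fun e => hd.1 (σ.injective e)) (σ k)
    (by rw [hi]; exact fun e => hd.2.1 (σ.injective e)) (by rw [hj]; exact fun e => hd.2.2 (σ.injective e))
  rwa [hi, hj] at this

theorem Msh.H3s (h : Msh κ δ M) (σ : Equiv.Perm (Fin 6)) {u v w : L} (hu : ‖ps δ u‖ ≤ 15)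
    (uv : adj u v) (uw : adj u w)
    (i j k l m : Fin 6) (hi : κ u = σ i) (hj : κ v = σ j) (hk : κ w = σ k)
    (hd : i ≠ j ∧ i ≠ k ∧ j ≠ k ∧ l ≠ m ∧ l ≠ i ∧ l ≠ j ∧ l ≠ k ∧ m ≠ i ∧ m ≠ j ∧ m ≠ k) :
    hh κ (ps δ) M u (σ l) (σ m) + hh κ (ps δ) M v (σ l) (σ m) + hh κ (ps δ) M w (σ l) (σ m) = 1 := by
  have inj : ∀ {a b : Fin 6}, a ≠ b → σ a ≠ σ b := fun hab e => hab (σ.injective e)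
  obtain ⟨d1, d2, d3, d4, d5, d6, d7, d8, d9, d10⟩ := hd
  apply h.H3 u v w (by linarith) uv uw <;> (try rw [hi]) <;> (try rw [hj]) <;> (try rw [hk]) <;>
    apply inj <;> assumption

theorem f1_dec : ∀ μ1 μ2 μ3 r1 r2 r3 m1 m2 m3 : ZMod 2, r3 + r2 + m1 + μ1 = 0 → r3 + r1 + m2 + μ2 = 0 →
    r1 + r2 + m3 + μ3 = 0 → m1 + m2 + m3 = 1 → r1 * m1 = 0 → r2 * m2 = 0 → r3 * m3 = 0 →
    r1 = m2 * μ3 + m3 * μ2 := by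
  intro μ1 μ2 μ3 r1 r2 r3 m1 m2 m3 h1 h2 h3 h4 h5 h6 h7
  linear_combination -m2 * h3 - m3 * h2 + r1 * h4 - h5 + h6 + h7 + (r1 + m2 * m3) * z2_two

/-- F1 -/
theorem Msh.F1 (h : Msh κ δ M) (σ : Equiv.Perm (Fin 6)) {v0 v1 v2 : L} (hv : ‖ps δ v0‖ ≤ 14)
    (h01 : adj v0 v1) (h02 : adj v0 v2) (h12 : adj v1 v2) (c0 : κ v0 = σ 0) (c1 : κ v1 = σ 1)
    (c2 : κ v2 = σ 2) : hh κ (ps δ) M v0 (σ 1) (σ 2) = 0 := by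
  have hv1 : ‖ps δ v1‖ ≤ 15 := by have := h.nadj h01; linarith
  have hv2 : ‖ps δ v2‖ ≤ 15 := by have := h.nadj h02; linarith
  have hv0 : ‖ps δ v0‖ ≤ 15 := by linarith
  obtain ⟨f, hf⟩ : ∃ f : L → Fin 6 → Fin 6 → ZMod 2, f = fun p i j => hh κ (ps δ) M p (σ i) (σ j) :=
    ⟨_, rfl⟩
  have sym : ∀ p i j, f p i j = f p j i := fun p i j => by rw [hf]; exact hh_symm
  have per : ∀ j k l : Fin 6, (j = 3 ∧ k = 4 ∧ l = 5) ∨ (j = 4 ∧ k = 3 ∧ l = 5) ∨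
      (j = 5 ∧ k = 3 ∧ l = 4) →
      f v1 2 j = f v1 k l * (f v2 j k + f v2 j l + f v2 k l) + f v2 k l * (f v1 j k + f v1 j l + f v1 k l) := by
    intro j k l hjkl
    have r3 : f v0 1 j = f v1 0 j := by
      rw [hf]; apply h.H2s σ hv0 h01 0 1 j c0 c1
      rcases hjkl with ⟨rfl, rfl, rfl⟩ | ⟨rfl, rfl, rfl⟩ | ⟨rfl, rfl, rfl⟩ <;> decide
    have r2 : f v0 2 j = f v2 0 j := by
      rw [hf]; apply h.H2s σ hv0 h02 0 2 j c0 c2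
      rcases hjkl with ⟨rfl, rfl, rfl⟩ | ⟨rfl, rfl, rfl⟩ | ⟨rfl, rfl, rfl⟩ <;> decide
    have r1 : f v1 2 j = f v2 1 j := by
      rw [hf]; apply h.H2s σ hv1 h12 1 2 j c1 c2
      rcases hjkl with ⟨rfl, rfl, rfl⟩ | ⟨rfl, rfl, rfl⟩ | ⟨rfl, rfl, rfl⟩ <;> decide
    have e0 : f v0 j 1 + (f v0 j 2 + (f v0 j k + f v0 j l)) = 0 := by
      rw [hf]; apply h.H1s σ hv0 0 j 1 2 k l c0 <;>
      rcases hjkl with ⟨rfl, rfl, rfl⟩ | ⟨rfl, rfl, rfl⟩ | ⟨rfl, rfl, rfl⟩ <;> decide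
    have e1 : f v1 j 0 + (f v1 j 2 + (f v1 j k + f v1 j l)) = 0 := by
      rw [hf]; apply h.H1s σ hv1 1 j 0 2 k l c1 <;>
      rcases hjkl with ⟨rfl, rfl, rfl⟩ | ⟨rfl, rfl, rfl⟩ | ⟨rfl, rfl, rfl⟩ <;> decide
    have e2 : f v2 j 0 + (f v2 j 1 + (f v2 j k + f v2 j l)) = 0 := by
      rw [hf]; apply h.H1s σ hv2 2 j 0 1 k l c2 <;>
      rcases hjkl with ⟨rfl, rfl, rfl⟩ | ⟨rfl, rfl, rfl⟩ | ⟨rfl, rfl, rfl⟩ <;> decide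
    have e3 : f v0 k l + f v1 k l + f v2 k l = 1 := by
      rw [hf]; apply h.H3s σ hv0 h01 h02 0 1 2 k l c0 c1 c2
      rcases hjkl with ⟨rfl, rfl, rfl⟩ | ⟨rfl, rfl, rfl⟩ | ⟨rfl, rfl, rfl⟩ <;> decide
    have m1 : f v1 2 j * f v0 k l = 0 := by
      rw [hf]; apply h.M4m σ hv1 h01.symm 1 2 j 0 k l c1 c0
      rcases hjkl with ⟨rfl, rfl, rfl⟩ | ⟨rfl, rfl, rfl⟩ | ⟨rfl, rfl, rfl⟩ <;> decide
    have m2 : f v0 2 j * f v1 k l = 0 := by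
      rw [hf]; apply h.M4m σ hv0 h01 0 2 j 1 k l c0 c1
      rcases hjkl with ⟨rfl, rfl, rfl⟩ | ⟨rfl, rfl, rfl⟩ | ⟨rfl, rfl, rfl⟩ <;> decide
    have m3 : f v0 1 j * f v2 k l = 0 := by
      rw [hf]; apply h.M4m σ hv0 h02 0 1 j 2 k l c0 c2
      rcases hjkl with ⟨rfl, rfl, rfl⟩ | ⟨rfl, rfl, rfl⟩ | ⟨rfl, rfl, rfl⟩ <;> decide
    have two := z2_two
    rw [sym v0 j 1, sym v0 j 2] at e0
    rw [sym v1 j 0, sym v1 j 2, ← r3] at e1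
    rw [sym v2 j 0, sym v2 j 1, ← r2, ← r1] at e2
    apply f1_dec (f v0 j k + f v0 j l + f v0 k l) _ _ _ (f v0 2 j) (f v0 1 j) (f v0 k l) _ _ ?_ ?_ ?_ e3
      m1 m2 m3
    · linear_combination e0 + f v0 k l * two
    · linear_combination e1 + f v1 k l * two
    · linear_combination e2 + f v2 k l * two
  have p3 := per 3 4 5 (by decide)
  have p4 := per 4 3 5 (by decide)
  have p5 := per 5 3 4 (by decide)
  have e : f v1 2 0 + (f v1 2 3 + (f v1 2 4 + f v1 2 5)) = 0 := by
    rw [hf]; exact h.H1s σ hv1 1 2 0 3 4 5 c1 (by decide) (by decide) (by decide)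
  have e' : f v0 1 2 = f v1 0 2 := by
    rw [hf]; exact h.H2s σ hv0 h01 0 1 2 c0 c1 (by decide)
  have goal : f v0 1 2 = 0 := by
    rw [sym v1 4 3, sym v2 4 3] at p4
    rw [sym v1 5 3, sym v2 5 3, sym v1 5 4, sym v2 5 4] at p5
    rw [e', sym v1 0 2]
    have two := z2_two
    rw [p3, p4, p5] at e
    linear_combination e - ((f v1 3 4 + f v1 3 5 + f v1 4 5) * (f v2 3 4 + f v2 3 5 + f v2 4 5)) * two
  rw [hf] at goal; exact goal

/-- the key step -/
theorem Msh.S1 (h : Msh κ δ M) (σ : Equiv.Perm (Fin 6)) {p q v0 v1 v2 w0 w1 w3 : L}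
    (hp : ‖ps δ p‖ ≤ 12) (hq : ‖ps δ q‖ ≤ 12)
    (p0 : Cn κ p v0) (q1 : Cn κ q v1) (p0' : Cn κ p w0) (q1' : Cn κ q w1)
    (h01 : adj v0 v1) (h02 : adj v0 v2) (h12 : adj v1 v2)
    (g01 : adj w0 w1) (g03 : adj w0 w3) (g13 : adj w1 w3)
    (cp : κ p = σ 0) (cq : κ q = σ 1) (c2 : κ v2 = σ 2) (c3 : κ w3 = σ 3) :
    hh κ (ps δ) M p (σ 1) (σ 5) = 0 := by
  have n0 := nd (h.diam (by linarith) p0)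
  have n0' := nd (h.diam (by linarith) p0')
  have n1' := nd (h.diam (by linarith) q1')
  have n3 := h.nadj g03
  have c0 : κ v0 = σ 0 := p0.col.symm.trans cp
  have c1 : κ v1 = σ 1 := q1.col.symm.trans cq
  have d0 : κ w0 = σ 0 := p0'.col.symm.trans cp
  have d1 : κ w1 = σ 1 := q1'.col.symm.trans cq
  obtain ⟨f, hf⟩ : ∃ f : L → Fin 6 → Fin 6 → ZMod 2, f = fun p i j => hh κ (ps δ) M p (σ i) (σ j) :=
    ⟨_, rfl⟩
  have sym : ∀ p i j, f p i j = f p j i := fun p i j => by rw [hf]; exact hh_symm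
  have cnp : ∀ u, Cn κ p u → ∀ i j, f u i j = f p i j := fun u hu i j => by
    rw [hf]; exact h.hh_cn (by linarith) hu _ _
  have cnq : ∀ u, Cn κ q u → ∀ i j, f u i j = f q i j := fun u hu i j => by
    rw [hf]; exact h.hh_cn (by linarith) hu _ _
  have z : f w3 4 5 = 0 := by
    rw [hf]
    exact h.M4s σ (by linarith) g03 0 2 1 3 4 5 d0 c3 (by decide)
      (h.wt_cn (by linarith) p0' p0 h02 h01 h12.symm c2 c1)
  have e1 : f w3 4 0 + (f w3 4 1 + (f w3 4 2 + f w3 4 5)) = 0 := by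
    rw [hf]; exact h.H1s σ (by linarith) 3 4 0 1 2 5 c3 (by decide) (by decide) (by decide)
  have e2 : f w0 3 4 = f w3 0 4 := by
    rw [hf]; exact h.H2s σ (by linarith) g03 0 3 4 d0 c3 (by decide)
  have e3 : f w1 3 4 = f w3 1 4 := by
    rw [hf]; exact h.H2s σ (by linarith) g13 1 3 4 d1 c3 (by decide)
  have e4 : f v0 3 4 + f v1 3 4 + f v2 3 4 = 1 := by
    rw [hf]; exact h.H3s σ (by linarith) h01 h02 0 1 2 3 4 c0 c1 c2 (by decide)
  have e5 : f v0 1 5 * f v2 3 4 = 0 := by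
    rw [hf]; exact h.M4m σ (by linarith) h02 0 1 5 2 3 4 c0 c2 (by decide)
  have e6 : f w0 1 5 * f w3 2 4 = 0 := by
    rw [hf]; exact h.M4m σ (by linarith) g03 0 1 5 3 2 4 d0 c3 (by decide)
  have goal : f p 1 5 = 0 := by
    rw [cnp v0 p0, cnq v1 q1] at e4
    rw [cnp w0 p0'] at e2 e6
    rw [cnp v0 p0] at e5
    rw [cnq w1 q1'] at e3
    rw [sym w3 4 0, sym w3 4 1, sym w3 4 2, z, ← e2, ← e3] at e1
    have two := z2_two
    linear_combination f p 1 5 * (e1 - e4) + e5 - e6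
  rw [hf] at goal; exact goal

end Hx


open Set Metric Filter Topology

namespace Hx

variable {κ : L → Fin 6} {δ : ℝ} {M : ℕ}

theorem sum_other {s : Finset (Fin 6)} {f : Fin 6 → ZMod 2} (hs : ∑ b ∈ s, f b = 0) {a : Fin 6}
    (ha : a ∈ s) (hf : f a = 1) : ∃ b ∈ s, b ≠ a ∧ f b = 1 := by
  by_contra hc
  push Not at hc
  rw [Finset.sum_eq_single_of_mem a ha
    (fun b hb hba => (z2_cases _).resolve_right (hc b hb hba)), hf] at hs
  exact absurd hs (by decide)

theorem Dd_wit {p q : L} {a : Fin 6} (hd : Dd κ M p q a = 1) : ∃ u v w, adj u v ∧ adj u w ∧ adj v w ∧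
    Cn κ p u ∧ Cn κ q v ∧ κ w = a := by
  have : Dd κ M p q a ≠ 0 := by rw [hd]; decide
  obtain ⟨u, v, w, uv, uw, vw, hn⟩ := T_ne this
  exact ⟨u, v, w, uv, uw, vw, I2_ne hn⟩

theorem Cc_wit {p : L} {a b : Fin 6} (hd : Cc κ M p a b ≠ 0) : ∃ u v w, adj u v ∧ adj u w ∧ adj v w ∧
    Cn κ p u ∧ κ v = a ∧ κ w = b := by
  obtain ⟨u, v, w, uv, uw, vw, hn⟩ := T_ne hd
  exact ⟨u, v, w, uv, uw, vw, I2_ne hn⟩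

/-- step S -/
theorem Msh.S (h : Msh κ δ M) {p : L} (hp : ‖ps δ p‖ ≤ 6) {a b : Fin 6} (ab : a ≠ b) (pa : κ p ≠ a)
    (pb : κ p ≠ b) (hC : Cc κ M p a b = 1) (x : Fin 6) (hx : x ≠ b) (hx' : x ≠ κ p) :
    hh κ (ps δ) M p b x = 0 := by
  obtain ⟨q, hq, cq, hD⟩ := h.exD (by linarith) hC
  obtain ⟨d, hd, da, hD'⟩ := sum_other (h.Dd_sum (q := q) (by linarith) (by rw [cq]; exact pb)) (a := a)
    (by simp [cq, ab, pa.symm]) hD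
  simp only [Finset.mem_erase, Finset.mem_univ, and_true, cq] at hd
  obtain ⟨σ, s0, s1, s2, s3⟩ := perm4 pb pa ab.symm hd.2.symm hd.1.symm da.symm
  obtain ⟨v0, v1, v2, h01, h02, h12, p0, q1, c2⟩ := Dd_wit hD
  obtain ⟨w0, w1, w3, g01, g03, g13, p0', q1', c3⟩ := Dd_wit hD'
  have n0 := nd (h.diam (by linarith) p0)
  have n0' := nd (h.diam (by linarith) p0')
  have k0 : κ v0 = κ p := p0.col.symm
  have k1 : κ v1 = b := q1.col.symm.trans cq
  have k0' : κ w0 = κ p := p0'.col.symm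
  have k1' : κ w1 = b := q1'.col.symm.trans cq
  have e2 : hh κ (ps δ) M p (σ 1) (σ 2) = 0 := by
    rw [← h.hh_cn (by linarith) p0]
    exact h.F1 σ (by linarith) h01 h02 h12 (k0.trans s0.symm) (k1.trans s1.symm) (c2.trans s2.symm)
  have e3 : hh κ (ps δ) M p (σ 1) (σ 3) = 0 := by
    rw [← h.hh_cn (by linarith) p0']
    have := h.F1 ((Equiv.swap 2 3).trans σ) (v0 := w0) (v1 := w1) (v2 := w3) (by linarith) g01 g03 g13
      (by simpa [Equiv.swap_apply_def] using k0'.trans s0.symm)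
      (by simpa [Equiv.swap_apply_def] using k1'.trans s1.symm)
      (by simpa [Equiv.swap_apply_def] using c3.trans s3.symm)
    simpa [Equiv.swap_apply_def] using this
  have e5 : hh κ (ps δ) M p (σ 1) (σ 5) = 0 :=
    h.S1 σ (by linarith) (by linarith) p0 q1 p0' q1' h01 h02 h12 g01 g03 g13 s0.symm
      (cq.trans s1.symm) (c2.trans s2.symm) (c3.trans s3.symm)
  have e4 : hh κ (ps δ) M p (σ 1) (σ 4) = 0 := by
    have := h.S1 ((Equiv.swap 4 5).trans σ) (by linarith) (by linarith) p0 q1 p0' q1' h01 h02 h12 g01 g03 g13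
      (by simpa [Equiv.swap_apply_def] using s0.symm)
      (by simpa [Equiv.swap_apply_def] using cq.trans s1.symm)
      (by simpa [Equiv.swap_apply_def] using c2.trans s2.symm)
      (by simpa [Equiv.swap_apply_def] using c3.trans s3.symm)
    simpa [Equiv.swap_apply_def] using this
  obtain ⟨x, rfl⟩ := σ.surjective x
  rw [← s1]
  rw [← s1] at hx
  rw [← s0] at hx'
  fin_cases x
  · exact absurd rfl hx'
  · exact absurd rfl hx
  · exact e2
  · exact e3
  · exact e4
  · exact e5

/-- zero lemma -/
theorem Msh.Z (h : Msh κ δ M) {p : L} (hp : ‖ps δ p‖ ≤ 6) {a b : Fin 6} (ab : a ≠ b) (pa : κ p ≠ a)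
    (pb : κ p ≠ b) (hC : Cc κ M p a b = 1) (x y : Fin 6) (xy : x ≠ y) (hx : x ≠ κ p) (hy : y ≠ κ p) :
    hh κ (ps δ) M p x y = 0 := by
  obtain ⟨d, hd, da, hC'⟩ := sum_other (h.Cc_sum (p := p) (by linarith) pb) (a := a)
    (by simp [ab, pa.symm]) (by rw [Cc_symm]; exact hC)
  simp only [Finset.mem_erase, Finset.mem_univ, and_true] at hd
  have R1 := h.S hp ab.symm pb pa (by rw [Cc_symm]; exact hC)
  have R2 := h.S hp ab pa pb hC
  have R3 := h.S hp hd.1.symm pb hd.2.symm hC'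
  obtain ⟨σ, s0, s1, s2, s3⟩ := perm4 pa pb ab hd.2.symm da.symm hd.1.symm
  obtain ⟨f, hf⟩ : ∃ f : Fin 6 → Fin 6 → ZMod 2, f = fun i j => hh κ (ps δ) M p (σ i) (σ j) :=
    ⟨_, rfl⟩
  have sym : ∀ i j, f i j = f j i := fun i j => by rw [hf]; exact hh_symm
  have q1 : ∀ j, j ≠ 1 → j ≠ 0 → f 1 j = 0 := by
    intro j h1 h0
    rw [hf]; simp only [s1]
    exact R1 _ (by rw [← s1]; exact fun e => h1 (σ.injective e)) (by rw [← s0]; exact fun e => h0 (σ.injective e))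
  have q2 : ∀ j, j ≠ 2 → j ≠ 0 → f 2 j = 0 := by
    intro j h1 h0
    rw [hf]; simp only [s2]
    exact R2 _ (by rw [← s2]; exact fun e => h1 (σ.injective e)) (by rw [← s0]; exact fun e => h0 (σ.injective e))
  have q3 : ∀ j, j ≠ 3 → j ≠ 0 → f 3 j = 0 := by
    intro j h1 h0
    rw [hf]; simp only [s3]
    exact R3 _ (by rw [← s3]; exact fun e => h1 (σ.injective e)) (by rw [← s0]; exact fun e => h0 (σ.injective e))
  have q4 : f 4 5 = 0 := by
    have : f 4 1 + (f 4 2 + (f 4 3 + f 4 5)) = 0 := by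
      rw [hf]; exact h.H1s σ (by linarith) 0 4 1 2 3 5 s0.symm (by decide) (by decide) (by decide)
    rw [sym 4 1, sym 4 2, sym 4 3, q1 4 (by decide) (by decide), q2 4 (by decide) (by decide),
      q3 4 (by decide) (by decide)] at this
    simpa using this
  have main : ∀ i j, i ≠ j → i ≠ 0 → j ≠ 0 → f i j = 0 := by
    intro i j hij hi hj
    by_cases i1 : i = 1
    · subst i1; exact q1 j hij.symm hj
    by_cases i2 : i = 2
    · subst i2; exact q2 j hij.symm hj
    by_cases i3 : i = 3
    · subst i3; exact q3 j hij.symm hj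
    by_cases j1 : j = 1
    · subst j1; rw [sym]; exact q1 i hij hi
    by_cases j2 : j = 2
    · subst j2; rw [sym]; exact q2 i hij hi
    by_cases j3 : j = 3
    · subst j3; rw [sym]; exact q3 i hij hi
    have : (i = 4 ∧ j = 5) ∨ (i = 5 ∧ j = 4) := by omega
    rcases this with ⟨rfl, rfl⟩ | ⟨rfl, rfl⟩
    · exact q4
    · rw [sym]; exact q4
  obtain ⟨x, rfl⟩ := σ.surjective x
  obtain ⟨y, rfl⟩ := σ.surjective y
  have := main x y (fun e => xy (by rw [e])) (fun e => hx (by rw [e, s0])) (fun e => hy (by rw [e, s0]))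
  rw [hf] at this; exact this

theorem Msh.fin1 (h : Msh κ δ M) {p : L} (hp : ‖ps δ p‖ ≤ 6) {a b : Fin 6} (ab : a ≠ b) (pa : κ p ≠ a)
    (pb : κ p ≠ b) (hC : Cc κ M p a b = 1) : False := by
  obtain ⟨σ, s0, s1, s2⟩ := perm3 pa pb ab
  obtain ⟨v0, v1, v2, h01, h02, h12, p0, c1, c2⟩ := Cc_wit (κ := κ) (M := M) (p := p) (a := a) (b := b)
    (by rw [hC]; decide)
  have n0 := nd (h.diam (by linarith) p0)
  have n2 := h.nadj h02
  have c0 : κ v0 = σ 0 := p0.col.symm.trans s0.symm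
  have c1 : κ v1 = σ 1 := c1.trans s1.symm
  have c2 : κ v2 = σ 2 := c2.trans s2.symm
  obtain ⟨f, hf⟩ : ∃ f : L → Fin 6 → Fin 6 → ZMod 2, f = fun p i j => hh κ (ps δ) M p (σ i) (σ j) :=
    ⟨_, rfl⟩
  obtain ⟨C, hCd⟩ : ∃ C : Fin 6 → Fin 6 → ZMod 2, C = fun i j => Cc κ M p (σ i) (σ j) :=
    ⟨_, rfl⟩
  have sym : ∀ p i j, f p i j = f p j i := fun p i j => by rw [hf]; exact hh_symm
  have syC : ∀ i j, C i j = C j i := fun i j => by rw [hCd]; exact Cc_symm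
  have Z0 : ∀ i j, i ≠ j → i ≠ 0 → j ≠ 0 → f v0 i j = 0 := by
    intro i j hij hi hj
    rw [hf]; simp only
    rw [h.hh_cn (by linarith) p0]
    exact h.Z hp ab pa pb hC _ _ (fun e => hij (σ.injective e))
      (by rw [← s0]; exact fun e => hi (σ.injective e)) (by rw [← s0]; exact fun e => hj (σ.injective e))
  have W : ∀ i j, C i j ≠ 0 → Wt κ δ v0 (σ i) (σ j) := by
    intro i j hne
    rw [hCd] at hne
    obtain ⟨u, v, w, uv, uw, vw, pu, cv, cw⟩ := Cc_wit hne
    exact h.wt_cn (by linarith) p0 pu uv uw vw cv cw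
  have C12 : C 1 2 = 1 := by rw [hCd]; simp only [s1, s2]; exact hC
  -- the three kinds of pairs
  have K1 : ∀ i j k : Fin 6, (∀ t : Fin 6, t = 0 ∨ t = 1 ∨ t = i ∨ t = 2 ∨ t = j ∨ t = k) →
      C 1 i * f v2 j k = 0 := by
    intro i j k hc
    by_cases hz : C 1 i = 0
    · rw [hz, zero_mul]
    have : f v2 j k = 0 := by
      rw [hf]; exact h.M4s σ (by linarith) h02 0 1 i 2 j k c0 c2 hc (W _ _ hz)
    rw [this, mul_zero]
  have K2 : ∀ i j k : Fin 6, (∀ t : Fin 6, t = 0 ∨ t = 2 ∨ t = i ∨ t = 1 ∨ t = j ∨ t = k) →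
      (j ≠ k ∧ j ≠ 0 ∧ j ≠ 1 ∧ j ≠ 2 ∧ k ≠ 0 ∧ k ≠ 1 ∧ k ≠ 2) →
      C 2 i * (1 + f v2 j k) = 0 := by
    intro i j k hc hd
    by_cases hz : C 2 i = 0
    · rw [hz, zero_mul]
    have e1 : f v1 j k = 0 := by
      rw [hf]; exact h.M4s σ (by linarith) h01 0 2 i 1 j k c0 c1 hc (W _ _ hz)
    have e2 : f v0 j k + f v1 j k + f v2 j k = 1 := by
      rw [hf]; exact h.H3s σ (by linarith) h01 h02 0 1 2 j k c0 c1 c2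
        ⟨by decide, by decide, by decide, hd⟩
    rw [Z0 j k hd.1 hd.2.1 hd.2.2.2.2.1, e1] at e2
    linear_combination C 2 i * e2 + C 2 i * z2_two
  have K3 : ∀ i j k : Fin 6, (∀ t : Fin 6, t = 0 ∨ t = i ∨ t = j ∨ t = 2 ∨ t = 1 ∨ t = k) →
      (Finset.univ.erase 2).erase k = ({0, 1, i, j} : Finset (Fin 6)) ∧
      ((0:Fin 6) ∉ ({1, i, j} : Finset (Fin 6)) ∧ 1 ∉ ({i, j} : Finset (Fin 6)) ∧
      i ∉ ({j} : Finset (Fin 6))) ∧ k ≠ 0 ∧ k ≠ 2 →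
      C i j * (f v2 k i + f v2 k j) = 0 := by
    intro i j k hc hd
    by_cases hz : C i j = 0
    · rw [hz, zero_mul]
    have e1 : f v2 1 k = 0 := by
      rw [hf]; exact h.M4s σ (by linarith) h02 0 i j 2 1 k c0 c2 hc (W _ _ hz)
    have e2 : f v0 2 k = f v2 0 k := by
      rw [hf]; exact h.H2s σ (by linarith) h02 0 2 k c0 c2 ⟨by decide, hd.2.2⟩
    have e3 : f v2 k 0 + (f v2 k 1 + (f v2 k i + f v2 k j)) = 0 := by
      rw [hf]; exact h.H1s σ (by linarith) 2 k 0 1 i j c2 hd.1 hd.2.1 hd.2.2.2.symm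
    rw [Z0 2 k hd.2.2.2.symm (by decide) hd.2.2.1] at e2
    rw [sym v2 k 0, ← e2, sym v2 k 1, e1] at e3
    linear_combination C i j * e3
  have a3 := K1 3 4 5 (by decide)
  have a4 := K1 4 3 5 (by decide)
  have a5 := K1 5 3 4 (by decide)
  have b3 := K2 3 4 5 (by decide) (by decide)
  have b4 := K2 4 3 5 (by decide) (by decide)
  have b5 := K2 5 3 4 (by decide) (by decide)
  have d34 := K3 3 4 5 (by decide) (by decide)
  have d35 := K3 3 5 4 (by decide) (by decide)
  have d45 := K3 4 5 3 (by decide) (by decide)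
  have r2 : C 2 1 + (C 2 3 + (C 2 4 + C 2 5)) = 0 := by
    rw [hCd]; exact h.Cs σ (by linarith) 0 2 1 3 4 5 s0.symm (by decide) (by decide) (by decide)
  have r3 : C 3 1 + (C 3 2 + (C 3 4 + C 3 5)) = 0 := by
    rw [hCd]; exact h.Cs σ (by linarith) 0 3 1 2 4 5 s0.symm (by decide) (by decide) (by decide)
  have r4 : C 4 1 + (C 4 2 + (C 4 3 + C 4 5)) = 0 := by
    rw [hCd]; exact h.Cs σ (by linarith) 0 4 1 2 3 5 s0.symm (by decide) (by decide) (by decide)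
  have r5 : C 5 1 + (C 5 2 + (C 5 3 + C 5 4)) = 0 := by
    rw [hCd]; exact h.Cs σ (by linarith) 0 5 1 2 3 4 s0.symm (by decide) (by decide) (by decide)
  rw [syC 2 1, C12] at r2
  rw [syC 3 1, syC 3 2] at r3
  rw [syC 4 1, syC 4 2, syC 4 3] at r4
  rw [syC 5 1, syC 5 2, syC 5 3, syC 5 4] at r5
  rw [sym v2 5 3, sym v2 5 4] at d34
  rw [sym v2 4 3] at d35
  have : (1 : ZMod 2) = 0 := by
    linear_combination r2 + f v2 4 5 * r3 + f v2 3 5 * r4 + f v2 3 4 * r5 - a3 - a4 - a5 - b3 - b4 - b5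
      - d34 - d35 - d45
  exact absurd this (by decide)

theorem Msh.false (h : Msh κ δ M) : False := by
  obtain ⟨u, v, w, hu, uv, uw, vw, n1, n2, n3⟩ := h.tri
  obtain ⟨σ, s0, s1, s2⟩ := perm3 n1 n2 n3
  have inj : ∀ {i j : Fin 6}, i ≠ j → σ i ≠ σ j := fun hij e => hij (σ.injective e)
  have e := h.H3s σ (by linarith) uv uw 0 1 2 3 4 s0.symm s1.symm s2.symm (by decide)
  have fin : ∀ z, ‖ps δ z‖ ≤ 5 → κ z ≠ σ 3 → κ z ≠ σ 4 → hh κ (ps δ) M z (σ 3) (σ 4) = 0 := by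
    intro z hz z3 z4
    by_contra hne
    obtain ⟨q, hq, cq, hC⟩ := h.exC (by linarith) hne
    exact h.fin1 (by linarith) (inj (by decide)) (by rw [cq]; exact z3) (by rw [cq]; exact z4) hC
  have m1 := h.nadj uv
  have m2 := h.nadj uw
  rw [fin u (by linarith) (by rw [← s0]; exact inj (by decide)) (by rw [← s0]; exact inj (by decide)),
    fin v (by linarith) (by rw [← s1]; exact inj (by decide)) (by rw [← s1]; exact inj (by decide)),
    fin w (by linarith) (by rw [← s2]; exact inj (by decide)) (by rw [← s2]; exact inj (by decide))] at e
  exact absurd e (by decide)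

theorem Col.false {c : ℂ → Fin 6} {F : Set (Set ℂ)} (h : Col c F) : False := by
  obtain ⟨δ, M, hM⟩ := mesh_ex h
  exact hM.false

end Hx

/-- There is no polygonal proper coloring of the plane with 6 colors. -/
theorem stmt_14 :
    ¬ ∃ (c : EuclideanSpace ℝ (Fin 2) → Fin 6)
        (F : Set (Set (EuclideanSpace ℝ (Fin 2)))),
      -- (1) the coloring is proper
      (∀ x y : EuclideanSpace ℝ (Fin 2), dist x y = 1 → c x ≠ c y) ∧
      -- (2) every region is a nonempty open connected bounded set whose frontier is a finite
      -- union of nondegenerate closed segments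
      (∀ P ∈ F, P.Nonempty ∧ IsOpen P ∧ IsConnected P ∧ Bornology.IsBounded P ∧
        ∃ S : Finset (EuclideanSpace ℝ (Fin 2) × EuclideanSpace ℝ (Fin 2)),
          (∀ e ∈ S, e.1 ≠ e.2) ∧ frontier P = ⋃ e ∈ S, segment ℝ e.1 e.2) ∧
      -- (3) regions are pairwise disjoint
      (F.Pairwise fun P Q => Disjoint P Q) ∧
      -- (4) the closures of the regions cover the plane
      (⋃ P ∈ F, closure P) = Set.univ ∧
      -- (5) any bounded set meets only finitely many regions
      (∀ B : Set (EuclideanSpace ℝ (Fin 2)), Bornology.IsBounded B →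
        {P ∈ F | (P ∩ B).Nonempty}.Finite) ∧
      -- (6) the coloring is constant on each region
      (∀ P ∈ F, ∀ x ∈ P, ∀ y ∈ P, c x = c y) ∧
      -- (7) each point gets the color of an adjacent region
      (∀ x : EuclideanSpace ℝ (Fin 2), ∃ P ∈ F, x ∈ closure P ∧ ∀ y ∈ P, c y = c x) ∧
      -- (8) regions sharing a boundary (infinitely many frontier points) get different colors
      (∀ P ∈ F, ∀ Q ∈ F, P ≠ Q → (frontier P ∩ frontier Q).Infinite →
        ∀ x ∈ P, ∀ y ∈ Q, c x ≠ c y) := by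
  classical
  rintro ⟨c, F, hprop, hreg, -, -, hlf, hconst, hadj, -⟩
  let φ : ℂ ≃ₗᵢ[ℝ] EuclideanSpace ℝ (Fin 2) := Complex.orthonormalBasisOneI.repr
  let θ : ℂ ≃ₜ EuclideanSpace ℝ (Fin 2) := φ.toHomeomorph
  have hθ : ∀ x, θ x = φ x := fun x => rfl
  apply Hx.Col.false (c := fun z => c (φ z)) (F := (fun P => θ ⁻¹' P) '' F)
  refine ⟨?_, ?_, ?_, ?_, ?_, ?_, ?_, ?_⟩
  · intro x y hxy
    exact hprop _ _ (by rw [φ.dist_map]; exact hxy)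
  · rintro _ ⟨P, hP, rfl⟩
    exact (hreg P hP).1.preimage θ.surjective
  · rintro _ ⟨P, hP, rfl⟩
    exact (hreg P hP).2.1.preimage θ.continuous
  · rintro _ ⟨P, hP, rfl⟩
    have := (hreg P hP).2.2.1.isPreconnected.image θ.symm θ.symm.continuous.continuousOn
    rwa [Homeomorph.image_symm] at this
  · rintro _ ⟨P, hP, rfl⟩
    obtain ⟨S, -, hS⟩ := (hreg P hP).2.2.2.2
    refine ⟨S.image fun e => (φ.symm e.1, φ.symm e.2), ?_⟩
    simp only
    rw [← θ.preimage_frontier, hS]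
    intro x hx
    simp only [mem_preimage, mem_iUnion] at hx
    obtain ⟨e, he, hx⟩ := hx
    simp only [mem_iUnion]
    refine ⟨_, Finset.mem_image_of_mem _ he, ?_⟩
    obtain ⟨a, b, ha, hb, hab, hx⟩ := hx
    refine ⟨a, b, ha, hb, hab, ?_⟩
    apply φ.injective
    rw [← hθ x, ← hx]
    simp only [map_add, map_smul, LinearIsometryEquiv.apply_symm_apply]
  · intro B hB
    have hB' : Bornology.IsBounded (φ '' B) := φ.lipschitz.isBounded_image hB
    refine ((hlf _ hB').image (fun P => θ ⁻¹' P)).subset ?_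
    rintro _ ⟨⟨P, hP, rfl⟩, x, hx, hxB⟩
    exact ⟨P, ⟨hP, φ x, hx, mem_image_of_mem _ hxB⟩, rfl⟩
  · rintro _ ⟨P, hP, rfl⟩ x hx y hy
    exact hconst P hP _ hx _ hy
  · intro x
    obtain ⟨P, hP, hx, hy⟩ := hadj (φ x)
    refine ⟨_, ⟨P, hP, rfl⟩, ?_, fun y hyP => hy _ hyP⟩
    simp only
    rw [← θ.preimage_closure]
    exact hx
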